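/- Let μ be a Gibbs measure for the Gauss map associated to a locally Hölder potential φ ≤ 0 with P(φ) = 0 and 𝓛_φ1 = 1, satisfying the polynomial tail condition μ({x : a₁(x) ≥ n}) = O(n^{−δ}) for some δ > 0, and with Hausdorff dimension dim μ > 1/2. Then for every strictly increasing sequence (s_k)_{k∈ℕ} of natural numbers, the sequence (s_k x)_{k∈ℕ} equidistributes modulo 1 for μ-almost every x. In particular, μ-almost every x is n-normal for every integer n ≥ 2. -/

import Mathlib

open MeasureTheory Filter Set Topology
open scoped ENNReal NNReal Classical Real

noncomputable section

/-- The Gauss map `T(x) = 1/x mod 1`. -/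
def gaussMap (x : ℝ) : ℝ := Int.fract x⁻¹

/-- The space `X = [0,1] ∖ ℚ` of irrational numbers in the unit interval. -/
def gaussSet : Set ℝ := {x | x ∈ Set.Icc (0:ℝ) 1 ∧ Irrational x}

/-- The first continued fraction digit `a₁(x) = ⌊1/x⌋`. -/
def cfDigit1 (x : ℝ) : ℕ := ⌊x⁻¹⌋₊

/-- The `(i+1)`-th continued fraction digit `a_{i+1}(x) = a₁(Tⁱ x)`. -/
def cfDigit (i : ℕ) (x : ℝ) : ℕ := cfDigit1 (gaussMap^[i] x)

/-- The inverse branch `T_a(x) = 1/(x+a)` of the Gauss map. -/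
def invBranch1 (a : ℕ) (x : ℝ) : ℝ := (x + (a : ℝ))⁻¹

/-- The composed inverse branch `T_𝐚 = T_{a₁} ∘ ⋯ ∘ T_{aₙ}` for `𝐚 = [a₁,…,aₙ]`. -/
def invBranch (l : List ℕ) (x : ℝ) : ℝ := l.foldr invBranch1 x

/-- The cylinder set `I_𝐚` of points of `X` whose first digits are given by `𝐚`. -/
def cylinder (l : List ℕ) : Set ℝ :=
  {x | x ∈ gaussSet ∧ ∀ i : Fin l.length, cfDigit i.1 x = l.get i}

/-- The Birkhoff sum `S_n φ = ∑_{k<n} φ ∘ T^k`. -/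
def birkhoff (φ : ℝ → ℝ) (n : ℕ) (x : ℝ) : ℝ :=
  ∑ k ∈ Finset.range n, φ (gaussMap^[k] x)

/-- The pair `(pₙ(𝐚), qₙ(𝐚))` of numerator and denominator (continuant) of the
finite continued fraction `[a₁,…,aₙ] = pₙ/qₙ`. -/
def contPQ : List ℕ → ℕ × ℕ
  | [] => (0, 1)
  | a :: l => ((contPQ l).2, a * (contPQ l).2 + (contPQ l).1)

/-- The continuant `qₙ(𝐚)`, the denominator of `[a₁,…,aₙ]` in lowest terms. -/
def contQ (l : List ℕ) : ℕ := (contPQ l).2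

/-- Words of length `n` with digits in `ℕ = {1,2,…}`. -/
def Word (n : ℕ) : Type := {l : List ℕ // l.length = n ∧ ∀ a ∈ l, 0 < a}

/-- The periodic point `𝐚^∞` with periodic continued fraction expansion repeating `𝐚`. -/
def periodicPoint (l : List ℕ) : ℝ :=
  limUnder atTop fun k : ℕ => invBranch (List.flatten (List.replicate k l)) (1/2 : ℝ)

/-- The `n`-th partition sum `∑_{𝐚 ∈ ℕⁿ} exp(S_nφ(𝐚^∞))` appearing in the pressure. -/
def partSum (φ : ℝ → ℝ) (n : ℕ) : ℝ≥0∞ :=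
  ∑' l : Word n, ENNReal.ofReal (Real.exp (birkhoff φ n (periodicPoint l.1)))

/-- `φ` has (finite) pressure `P(φ) = p`, i.e. `(1/n) log ∑_{𝐚∈ℕⁿ} exp(S_nφ(𝐚^∞)) → p`. -/
def HasPressure (φ : ℝ → ℝ) (p : ℝ) : Prop :=
  (∀ n : ℕ, 0 < n → partSum φ n ≠ ⊤) ∧
    Tendsto (fun n : ℕ => Real.log (partSum φ n).toReal / (n : ℝ)) atTop (𝓝 p)

/-- The pressure of `φ` is finite: `P(φ) < ∞`. -/
def PressureFinite (φ : ℝ → ℝ) : Prop := ∃ p : ℝ, HasPressure φ p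

/-- `φ` is locally Hölder: oscillation on `n`-cylinders decays geometrically. -/
def LocHolder (φ : ℝ → ℝ) : Prop :=
  ∃ C > (0:ℝ), ∃ θ ∈ Set.Ioo (0:ℝ) 1, ∀ l : List ℕ, l ≠ [] → (∀ a ∈ l, 0 < a) →
    ∀ x ∈ cylinder l, ∀ y ∈ cylinder l, |φ x - φ y| ≤ C * θ ^ l.length

/-- The normalization `𝓛_φ 1 = 1` of the Ruelle transfer operator of `φ`. -/
def TransferNormalized (φ : ℝ → ℝ) : Prop :=
  ∀ x ∈ gaussSet, ∑' a : ℕ+, Real.exp (φ (invBranch1 (a : ℕ) x)) = 1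

/-- `μ` is invariant under the Gauss map. -/
def GaussInvariant (μ : Measure ℝ) : Prop :=
  ∀ s : Set ℝ, MeasurableSet s → μ (gaussMap ⁻¹' s) = μ s

/-- The Gibbs property for the potential `φ` (with `P(φ) = 0`):
`C⁻¹ e^{S_nφ(T_𝐚 x)} ≤ μ(I_𝐚) ≤ C e^{S_nφ(T_𝐚 x)}`. -/
def IsGibbs (φ : ℝ → ℝ) (μ : Measure ℝ) : Prop :=
  ∃ C : ℝ, 1 ≤ C ∧ ∀ l : List ℕ, l ≠ [] → (∀ a ∈ l, 0 < a) → ∀ x ∈ gaussSet,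
    C⁻¹ * Real.exp (birkhoff φ l.length (invBranch l x)) ≤ (μ (cylinder l)).toReal ∧
      (μ (cylinder l)).toReal ≤ C * Real.exp (birkhoff φ l.length (invBranch l x))

/-- The Kolmogorov–Sinai entropy of `μ`:
`h = lim (1/n) ∑_{𝐚∈ℕⁿ} -μ(I_𝐚) log μ(I_𝐚)`. -/
def HasEntropy (μ : Measure ℝ) (h : ℝ) : Prop :=
  Tendsto (fun n : ℕ => (∑' l : Word n, Real.negMulLog (μ (cylinder l.1)).toReal) / (n : ℝ))
    atTop (𝓝 h)

/-- `log |T'| (x) = log (1/x²)` for the Gauss map. -/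
def logAbsDerivGauss (x : ℝ) : ℝ := Real.log (1 / x ^ 2)

/-- The observable `ψ = -log |T'|`. -/
def gaussPsi (x : ℝ) : ℝ := -Real.log (1 / x ^ 2)

/-- The Lyapunov exponent `λ_μ = ∫ log|T'| dμ`. -/
def lyapunov (μ : Measure ℝ) : ℝ := ∫ x, logAbsDerivGauss x ∂μ

/-- The polynomial tail condition `μ({x : a₁(x) ≥ n}) = O(n^{-δ})`. -/
def PolyTail (μ : Measure ℝ) : Prop :=
  ∃ δ > (0:ℝ), ∃ K : ℝ, ∀ n : ℕ, 0 < n →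
    (μ {x | x ∈ gaussSet ∧ n ≤ cfDigit1 x}).toReal ≤ K * (n : ℝ) ^ (-δ)

/-- The Fourier transform `μ̂(ξ) = ∫ e^{-2πiξx} dμ(x)`. -/
def muFourier (μ : Measure ℝ) (ξ : ℝ) : ℂ :=
  ∫ x, Complex.exp (-(2 * Real.pi * ξ * x : ℝ) * Complex.I) ∂μ

/-- A sequence `u` equidistributes modulo 1. -/
def EquidistributedMod1 (u : ℕ → ℝ) : Prop :=
  ∀ a b : ℝ, 0 ≤ a → a ≤ b → b ≤ 1 →
    Tendsto (fun N : ℕ =>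
        (((Finset.range N).filter fun k => Int.fract (u k) ∈ Set.Ico a b).card : ℝ) / (N : ℝ))
      atTop (𝓝 (b - a))

/-- The set `B(𝒜)` of `𝒜`-badly approximable numbers: all digits lie in `𝒜`. -/
def badSet (A : Finset ℕ) : Set ℝ := {x | x ∈ gaussSet ∧ ∀ i : ℕ, cfDigit i x ∈ A}

/-- Locally Hölder on the subsystem `B(𝒜)`. -/
def LocHolderOn (A : Finset ℕ) (φ : ℝ → ℝ) : Prop :=
  ∃ C > (0:ℝ), ∃ θ ∈ Set.Ioo (0:ℝ) 1, ∀ l : List ℕ, l ≠ [] → (∀ a ∈ l, a ∈ A) →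
    ∀ x ∈ cylinder l ∩ badSet A, ∀ y ∈ cylinder l ∩ badSet A,
      |φ x - φ y| ≤ C * θ ^ l.length

/-- The Gibbs property for the Gauss map restricted to `B(𝒜)`. -/
def IsGibbsOn (A : Finset ℕ) (φ : ℝ → ℝ) (μ : Measure ℝ) : Prop :=
  ∃ C : ℝ, 1 ≤ C ∧ ∀ l : List ℕ, l ≠ [] → (∀ a ∈ l, a ∈ A) → ∀ x ∈ badSet A,
    C⁻¹ * Real.exp (birkhoff φ l.length (invBranch l x)) ≤ (μ (cylinder l)).toReal ∧
      (μ (cylinder l)).toReal ≤ C * Real.exp (birkhoff φ l.length (invBranch l x))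

/-- The `n`-regular set `A_n(ε)` of the large deviation decomposition. -/
def regSet (φ : ℝ → ℝ) (lam s ε : ℝ) (n : ℕ) : Set ℝ :=
  {x | |birkhoff gaussPsi n x / (n : ℝ) + lam| < ε ∧
       |birkhoff φ n x / birkhoff gaussPsi n x - s| < ε}

/-- The collection `𝓡ₙ` of `n`-regular words. -/
def regWords (φ : ℝ → ℝ) (lam s ε : ℝ) (n : ℕ) : Set (List ℕ) :=
  {l | l.length = n ∧ (∀ a ∈ l, 0 < a) ∧
       ∀ k : ℕ, n / 2 ≤ k → k ≤ n → cylinder (l.take k) ⊆ regSet φ lam s ε k}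

/-- The union `Rₙ` of the `n`-regular cylinders. -/
def regUnion (φ : ℝ → ℝ) (lam s ε : ℝ) (n : ℕ) : Set ℝ :=
  ⋃ l ∈ regWords φ lam s ε n, cylinder l

end

namespace GaussFourier

set_option linter.unusedSectionVars false

/-! ### Continued fraction digits and inverse branches -/

lemma gaussSet_pos {x : ℝ} (hx : x ∈ gaussSet) : 0 < x :=
  lt_of_le_of_ne hx.1.1 (fun h => hx.2.ne_zero h.symm)

lemma gaussSet_lt_one {x : ℝ} (hx : x ∈ gaussSet) : x < 1 :=
  lt_of_le_of_ne hx.1.2 (fun h => hx.2.ne_one h)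

lemma gaussMap_mem {x : ℝ} (hx : x ∈ gaussSet) : gaussMap x ∈ gaussSet := by
  refine ⟨⟨Int.fract_nonneg _, (Int.fract_lt_one _).le⟩, ?_⟩
  have h : Irrational x⁻¹ := irrational_inv_iff.2 hx.2
  have := h.sub_intCast ⌊x⁻¹⌋
  exact this

lemma iterate_mem {x : ℝ} (hx : x ∈ gaussSet) (n : ℕ) : gaussMap^[n] x ∈ gaussSet := by
  induction n generalizing x with
  | zero => exact hx
  | succ n ih => exact ih (gaussMap_mem hx)

lemma invBranch1_mem {a : ℕ} {x : ℝ} (ha : 0 < a) (hx : x ∈ gaussSet) :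
    invBranch1 a x ∈ gaussSet := by
  have h0 := gaussSet_pos hx
  have h1 : (1 : ℝ) ≤ a := by exact_mod_cast ha
  refine ⟨⟨by unfold invBranch1; positivity, ?_⟩, ?_⟩
  · unfold invBranch1
    exact inv_le_one_of_one_le₀ (by linarith)
  · exact irrational_inv_iff.2 (hx.2.add_natCast a)

lemma gaussMap_invBranch1 {x : ℝ} (a : ℕ) (hx : x ∈ gaussSet) :
    gaussMap (invBranch1 a x) = x := by
  unfold gaussMap invBranch1
  rw [inv_inv, Int.fract_add_natCast, Int.fract_eq_self]
  exact ⟨(gaussSet_pos hx).le, gaussSet_lt_one hx⟩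

lemma cfDigit1_invBranch1 {x : ℝ} (a : ℕ) (hx : x ∈ gaussSet) :
    cfDigit1 (invBranch1 a x) = a := by
  unfold cfDigit1 invBranch1
  rw [inv_inv, Nat.floor_add_natCast (gaussSet_pos hx).le,
    Nat.floor_eq_zero.2 (gaussSet_lt_one hx), zero_add]

lemma cfDigit1_pos {x : ℝ} (hx : x ∈ gaussSet) : 0 < cfDigit1 x := by
  unfold cfDigit1
  rw [Nat.floor_pos]
  exact (one_le_inv₀ (gaussSet_pos hx)).2 (gaussSet_lt_one hx).le

lemma invBranch1_cfDigit1 {x : ℝ} (hx : x ∈ gaussSet) :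
    invBranch1 (cfDigit1 x) (gaussMap x) = x := by
  unfold invBranch1 cfDigit1 gaussMap
  have h0 : 0 ≤ x⁻¹ := inv_nonneg.2 (gaussSet_pos hx).le
  rw [show ((⌊x⁻¹⌋₊ : ℕ) : ℝ) = ((⌊x⁻¹⌋ : ℤ) : ℝ) from natCast_floor_eq_intCast_floor h0,
    Int.fract_add_floor, inv_inv]

/-- All entries of the word are positive. -/
def PosWord (l : List ℕ) : Prop := ∀ a ∈ l, 0 < a

lemma PosWord.head {a : ℕ} {l : List ℕ} (h : PosWord (a :: l)) : 0 < a := h a (by simp)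

lemma PosWord.tail {a : ℕ} {l : List ℕ} (h : PosWord (a :: l)) : PosWord l :=
  fun b hb => h b (by simp [hb])

lemma PosWord.append {l l' : List ℕ} (h : PosWord l) (h' : PosWord l') : PosWord (l ++ l') := by
  intro a ha
  rcases List.mem_append.1 ha with ha | ha
  exacts [h a ha, h' a ha]

lemma PosWord.left {l l' : List ℕ} (h : PosWord (l ++ l')) : PosWord l :=
  fun a ha => h a (by simp [ha])

lemma PosWord.right {l l' : List ℕ} (h : PosWord (l ++ l')) : PosWord l' :=
  fun a ha => h a (by simp [ha])

lemma PosWord.reverse {l : List ℕ} (h : PosWord l) : PosWord l.reverse :=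
  fun a ha => h a (by simpa using ha)

/-- The word of the first `n` digits of `x`. -/
noncomputable def word : ℕ → ℝ → List ℕ
  | 0, _ => []
  | n + 1, x => cfDigit1 x :: word n (gaussMap x)

lemma length_word (n : ℕ) (x : ℝ) : (word n x).length = n := by
  induction n generalizing x with
  | zero => rfl
  | succ n ih => simp [word, ih]

lemma posWord_word (n : ℕ) {x : ℝ} (hx : x ∈ gaussSet) : PosWord (word n x) := by
  induction n generalizing x with
  | zero => intro a ha; simp [word] at ha
  | succ n ih =>
    intro a ha
    rcases List.mem_cons.1 ha with h | h
    · exact h ▸ cfDigit1_pos hx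
    · exact ih (gaussMap_mem hx) a h

lemma word_add (m n : ℕ) (x : ℝ) : word (m + n) x = word m x ++ word n (gaussMap^[m] x) := by
  induction m generalizing x with
  | zero => simp [word]
  | succ m ih => rw [show m + 1 + n = (m + n) + 1 by omega]; simp [word, ih]

lemma cylinder_nil : cylinder [] = gaussSet := by
  ext x; simp [_root_.cylinder]

lemma mem_cylinder_cons {a : ℕ} {l : List ℕ} {x : ℝ} :
    x ∈ cylinder (a :: l) ↔ x ∈ gaussSet ∧ cfDigit1 x = a ∧ gaussMap x ∈ cylinder l := by
  constructor
  · rintro ⟨hx, h⟩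
    refine ⟨hx, ?_, gaussMap_mem hx, fun i => ?_⟩
    · simpa [cfDigit] using h ⟨0, by simp⟩
    · have := h i.succ
      simpa [cfDigit] using this
  · rintro ⟨hx, h1, -, h⟩
    refine ⟨hx, fun i => ?_⟩
    refine Fin.cases ?_ (fun j => ?_) i
    · simpa [cfDigit] using h1
    · have := h j
      simpa [cfDigit] using this

lemma mem_cylinder_iff {l : List ℕ} {x : ℝ} :
    x ∈ cylinder l ↔ x ∈ gaussSet ∧ word l.length x = l := by
  induction l generalizing x with
  | nil => simp [cylinder_nil, word]
  | cons a l ih =>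
    rw [mem_cylinder_cons, ih]
    simp only [List.length_cons, word, List.cons.injEq]
    constructor
    · rintro ⟨h1, h2, -, h4⟩; exact ⟨h1, h2, h4⟩
    · rintro ⟨h1, h2, h4⟩; exact ⟨h1, h2, gaussMap_mem h1, h4⟩

lemma mem_cylinder_word (n : ℕ) {x : ℝ} (hx : x ∈ gaussSet) : x ∈ cylinder (word n x) := by
  rw [mem_cylinder_iff, length_word]; exact ⟨hx, rfl⟩

lemma cylinder_subset (l : List ℕ) : cylinder l ⊆ gaussSet := fun _ h => h.1

lemma mem_cylinder_append {l l' : List ℕ} {x : ℝ} :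
    x ∈ cylinder (l ++ l') ↔ x ∈ cylinder l ∧ gaussMap^[l.length] x ∈ cylinder l' := by
  induction l generalizing x with
  | nil =>
    simp only [List.nil_append, cylinder_nil, List.length_nil, Function.iterate_zero, id]
    exact ⟨fun h => ⟨h.1, h⟩, fun h => h.2⟩
  | cons a l ih =>
    simp only [List.cons_append, mem_cylinder_cons, ih, List.length_cons,
      Function.iterate_succ, Function.comp]
    tauto

lemma invBranch_cons (a : ℕ) (l : List ℕ) (x : ℝ) :
    invBranch (a :: l) x = invBranch1 a (invBranch l x) := rfl

lemma invBranch_append (l l' : List ℕ) (x : ℝ) :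
    invBranch (l ++ l') x = invBranch l (invBranch l' x) := by
  simp [invBranch, List.foldr_append]

lemma invBranch_mem {l : List ℕ} (hl : PosWord l) {x : ℝ} (hx : x ∈ gaussSet) :
    invBranch l x ∈ gaussSet := by
  induction l with
  | nil => exact hx
  | cons a l ih => exact invBranch1_mem hl.head (ih hl.tail)

lemma invBranch_mem_cylinder {l : List ℕ} (hl : PosWord l) {x : ℝ} (hx : x ∈ gaussSet) :
    invBranch l x ∈ cylinder l := by
  induction l with
  | nil => rw [cylinder_nil]; exact hx
  | cons a l ih =>
    have h := invBranch_mem hl.tail hx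
    rw [mem_cylinder_cons, invBranch_cons, cfDigit1_invBranch1 a h, gaussMap_invBranch1 a h]
    exact ⟨invBranch1_mem hl.head h, rfl, ih hl.tail⟩

lemma iterate_invBranch {l : List ℕ} (hl : PosWord l) {x : ℝ} (hx : x ∈ gaussSet) :
    gaussMap^[l.length] (invBranch l x) = x := by
  induction l with
  | nil => rfl
  | cons a l ih =>
    rw [List.length_cons, Function.iterate_succ_apply, invBranch_cons,
      gaussMap_invBranch1 a (invBranch_mem hl.tail hx), ih hl.tail]

lemma invBranch_iterate {l : List ℕ} {x : ℝ} (hx : x ∈ cylinder l) :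
    invBranch l (gaussMap^[l.length] x) = x := by
  induction l generalizing x with
  | nil => rfl
  | cons a l ih =>
    obtain ⟨h1, h2, h3⟩ := mem_cylinder_cons.1 hx
    rw [List.length_cons, Function.iterate_succ_apply, invBranch_cons, ih h3, ← h2,
      invBranch1_cfDigit1 h1]

lemma cylinder_disjoint {l l' : List ℕ} (hlen : l.length = l'.length) (hne : l ≠ l') :
    Disjoint (cylinder l) (cylinder l') := by
  rw [Set.disjoint_left]
  intro x hx hx'
  apply hne
  rw [← (mem_cylinder_iff.1 hx).2, hlen, (mem_cylinder_iff.1 hx').2]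

/-! ### Measurability -/

lemma measurableSet_gaussSet : MeasurableSet gaussSet := by
  have : gaussSet = Set.Icc (0:ℝ) 1 ∩ (Set.range ((↑) : ℚ → ℝ))ᶜ := by
    ext x; rfl
  rw [this]
  exact measurableSet_Icc.inter (Set.countable_range _).measurableSet.compl

lemma measurable_gaussMap : Measurable gaussMap := measurable_fract.comp measurable_inv

lemma measurable_iterate (n : ℕ) : Measurable (gaussMap^[n]) := measurable_gaussMap.iterate n

lemma measurable_cfDigit1 : Measurable cfDigit1 := Nat.measurable_floor.comp measurable_inv

lemma measurable_invBranch1 (a : ℕ) : Measurable (invBranch1 a) :=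
  (measurable_id.add_const _).inv

lemma measurable_invBranch (l : List ℕ) : Measurable (invBranch l) := by
  induction l with
  | nil => exact measurable_id
  | cons a l ih => exact (measurable_invBranch1 a).comp ih

lemma measurableSet_cylinder (l : List ℕ) : MeasurableSet (cylinder l) := by
  induction l with
  | nil => rw [cylinder_nil]; exact measurableSet_gaussSet
  | cons a l ih =>
    have : cylinder (a :: l) = gaussSet ∩ (cfDigit1 ⁻¹' {a} ∩ gaussMap ⁻¹' cylinder l) := by
      ext x; rw [mem_cylinder_cons]; rfl
    rw [this]
    exact measurableSet_gaussSet.inter ((measurable_cfDigit1 (measurableSet_singleton a)).inter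
      (measurable_gaussMap ih))

lemma measurable_birkhoff {f : ℝ → ℝ} (hf : Measurable f) (n : ℕ) : Measurable (birkhoff f n) := by
  unfold birkhoff
  exact Finset.measurable_sum _ fun k _ => hf.comp (measurable_iterate k)

lemma birkhoff_succ (f : ℝ → ℝ) (n : ℕ) (x : ℝ) :
    birkhoff f (n + 1) x = f x + birkhoff f n (gaussMap x) := by
  simp [birkhoff, Finset.sum_range_succ', add_comm]

/-! ### Continuants -/

/-- The product of the elementary continued fraction matrices of a word. -/
def contMat (l : List ℕ) : Matrix (Fin 2) (Fin 2) ℕ := (l.map fun a => !![0, 1; 1, a]).prod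

/-- The denominator `q` of the word. -/
def qden (l : List ℕ) : ℕ := contMat l 1 1

/-- The denominator of the word without its last letter. -/
def qprev (l : List ℕ) : ℕ := contMat l 1 0

/-- The denominator of the Möbius map `invBranch l`. -/
noncomputable def den (l : List ℕ) (x : ℝ) : ℝ := qprev l * x + qden l

lemma qden_nil : qden [] = 1 := by simp [qden, contMat]

lemma qprev_nil : qprev [] = 0 := by simp [qprev, contMat]

lemma qden_append_singleton (l : List ℕ) (a : ℕ) :
    qden (l ++ [a]) = a * qden l + qprev l := by
  simp [qden, qprev, contMat, Matrix.mul_apply, Fin.sum_univ_two]; ring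

lemma qprev_append_singleton (l : List ℕ) (a : ℕ) : qprev (l ++ [a]) = qden l := by
  simp [qden, qprev, contMat, Matrix.mul_apply, Fin.sum_univ_two]

lemma qden_reverse (l : List ℕ) : qden l.reverse = qden l := by
  have : contMat l.reverse = (contMat l).transpose := by
    unfold contMat
    rw [Matrix.transpose_list_prod, List.map_reverse, List.map_map]
    congr 2
    apply List.map_congr_left
    intro a _
    ext i j
    fin_cases i <;> fin_cases j <;> rfl
  simp [qden, this]

lemma qprev_le_and_pos {l : List ℕ} (hl : PosWord l) : qprev l ≤ qden l ∧ 0 < qden l := by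
  induction l using List.reverseRecOn with
  | nil => simp [qden_nil, qprev_nil]
  | append_singleton l a ih =>
    have ha : 0 < a := hl a (by simp)
    obtain ⟨h1, h2⟩ := ih hl.left
    rw [qden_append_singleton, qprev_append_singleton]
    constructor
    · nlinarith
    · positivity

lemma two_pow_le_qden {l : List ℕ} (hl : PosWord l) : 2 ^ l.length ≤ 2 * qden l ^ 2 := by
  suffices 2 ^ l.length ≤ 2 * qden l ^ 2 ∧ 2 ^ l.length ≤ (qden l + qprev l) ^ 2 from this.1
  induction l using List.reverseRecOn with
  | nil => simp [qden_nil, qprev_nil]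
  | append_singleton l a ih =>
    have ha : 1 ≤ a := hl a (by simp)
    obtain ⟨h1, h2⟩ := ih hl.left
    rw [qden_append_singleton, qprev_append_singleton, List.length_append, List.length_singleton,
      pow_succ]
    have h3 : qden l + qprev l ≤ a * qden l + qprev l := by nlinarith
    have h4 := Nat.pow_le_pow_left h3 2
    have h5 : 2 * qden l ≤ a * qden l + qprev l + qden l := by nlinarith
    have h6 := Nat.pow_le_pow_left h5 2
    constructor <;> nlinarith

lemma den_pos {l : List ℕ} (hl : PosWord l) {x : ℝ} (hx : 0 ≤ x) : 0 < den l x := by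
  have := (qprev_le_and_pos hl).2
  unfold den; positivity

lemma qden_le_den (l : List ℕ) {x : ℝ} (hx : 0 ≤ x) : (qden l : ℝ) ≤ den l x := by
  unfold den
  have : 0 ≤ (qprev l : ℝ) * x := by positivity
  linarith

lemma den_le {l : List ℕ} (hl : PosWord l) {x : ℝ} (hx : 0 ≤ x) :
    den l x ≤ (1 + x) * qden l := by
  unfold den
  have h : (qprev l : ℝ) ≤ qden l := by exact_mod_cast (qprev_le_and_pos hl).1
  nlinarith

lemma invBranch_nonneg (l : List ℕ) {x : ℝ} (hx : 0 ≤ x) : 0 ≤ invBranch l x := by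
  induction l with
  | nil => exact hx
  | cons a l ih => rw [invBranch_cons]; unfold invBranch1; positivity

lemma invBranch_le_one {l : List ℕ} (hl : PosWord l) {x : ℝ} (hx : 0 ≤ x) (hx1 : x ≤ 1) :
    invBranch l x ≤ 1 := by
  cases l with
  | nil => exact hx1
  | cons a l =>
    rw [invBranch_cons]; unfold invBranch1
    have h1 : (1 : ℝ) ≤ a := by exact_mod_cast hl.head
    exact inv_le_one_of_one_le₀ (by linarith [invBranch_nonneg l hx])

lemma den_cons {a : ℕ} {l : List ℕ} (hl : PosWord (a :: l)) {x : ℝ} (hx : 0 ≤ x) :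
    den (a :: l) x = den l x * (invBranch l x + a) := by
  have key : ∀ l : List ℕ, PosWord l →
      invBranch l x * den l x = contMat l 0 0 * x + contMat l 0 1 := by
    intro l
    induction l with
    | nil => intro _; simp [invBranch, den, qden, qprev, contMat]
    | cons a l ih =>
      intro hl
      have h1 := ih hl.tail
      have h2 : (0:ℝ) < invBranch l x + a := by
        have : (0:ℝ) < a := by exact_mod_cast hl.head
        linarith [invBranch_nonneg l hx]
      rw [invBranch_cons]
      unfold invBranch1
      rw [inv_mul_eq_iff_eq_mul₀ h2.ne']
      have e0 : contMat (a :: l) 0 0 = contMat l 1 0 := by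
        simp [contMat, Matrix.mul_apply, Fin.sum_univ_two]
      have e1 : contMat (a :: l) 0 1 = contMat l 1 1 := by
        simp [contMat, Matrix.mul_apply, Fin.sum_univ_two]
      have e2 : contMat (a :: l) 1 0 = contMat l 0 0 + a * contMat l 1 0 := by
        simp [contMat, Matrix.mul_apply, Fin.sum_univ_two]
      have e3 : contMat (a :: l) 1 1 = contMat l 0 1 + a * contMat l 1 1 := by
        simp [contMat, Matrix.mul_apply, Fin.sum_univ_two]
      unfold den qden qprev at *
      rw [e0, e1, e2, e3]
      push_cast
      linear_combination -h1
  have h1 := key l hl.tail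
  have e2 : contMat (a :: l) 1 0 = contMat l 0 0 + a * contMat l 1 0 := by
    simp [contMat, Matrix.mul_apply, Fin.sum_univ_two]
  have e3 : contMat (a :: l) 1 1 = contMat l 0 1 + a * contMat l 1 1 := by
    simp [contMat, Matrix.mul_apply, Fin.sum_univ_two]
  unfold den qden qprev at *
  rw [e2, e3]
  push_cast
  linear_combination -h1

lemma invBranch_sub {l : List ℕ} (hl : PosWord l) {x y : ℝ} (hx : 0 ≤ x) (hy : 0 ≤ y) :
    invBranch l x - invBranch l y = (-1) ^ l.length * (x - y) / (den l x * den l y) := by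
  induction l with
  | nil => simp [invBranch, den, qden_nil, qprev_nil]
  | cons a l ih =>
    have ha : (0:ℝ) < a := by exact_mod_cast hl.head
    have h1 : (0:ℝ) < invBranch l x + a := by linarith [invBranch_nonneg l hx]
    have h2 : (0:ℝ) < invBranch l y + a := by linarith [invBranch_nonneg l hy]
    have d1 := den_pos hl.tail hx
    have d2 := den_pos hl.tail hy
    rw [den_cons hl hx, den_cons hl hy, invBranch_cons, invBranch_cons]
    unfold invBranch1
    have h3 : (invBranch l x + a)⁻¹ - (invBranch l y + a)⁻¹
        = -(invBranch l x - invBranch l y) / ((invBranch l x + a) * (invBranch l y + a)) := by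
      field_simp; ring
    rw [h3, ih hl.tail, List.length_cons, pow_succ]
    field_simp

lemma abs_invBranch_sub_le {l : List ℕ} (hl : PosWord l) {x y : ℝ} (hx : 0 ≤ x) (hy : 0 ≤ y) :
    |invBranch l x - invBranch l y| ≤ |x - y| / (qden l : ℝ) ^ 2 := by
  have hq : (0:ℝ) < qden l := by exact_mod_cast (qprev_le_and_pos hl).2
  rw [invBranch_sub hl hx hy, abs_div, abs_mul, abs_pow, abs_neg, abs_one, one_pow, one_mul,
    abs_of_pos (mul_pos (den_pos hl hx) (den_pos hl hy))]
  apply div_le_div_of_nonneg_left (abs_nonneg _) (by positivity)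
  rw [sq]
  exact mul_le_mul (qden_le_den l hx) (qden_le_den l hy) hq.le (den_pos hl hx).le

lemma abs_invBranch_sub_le_two_pow {l : List ℕ} (hl : PosWord l) {x y : ℝ} (hx : 0 ≤ x)
    (hy : 0 ≤ y) (hx1 : x ≤ 1) (hy1 : y ≤ 1) :
    |invBranch l x - invBranch l y| ≤ 2 * (1 / 2) ^ l.length := by
  have hq : (0:ℝ) < qden l := by exact_mod_cast (qprev_le_and_pos hl).2
  refine (abs_invBranch_sub_le hl hx hy).trans ?_
  have h1 : (2:ℝ) ^ l.length ≤ 2 * (qden l : ℝ) ^ 2 := by exact_mod_cast two_pow_le_qden hl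
  have h2 : |x - y| ≤ 1 := abs_le.2 ⟨by linarith, by linarith⟩
  rw [div_le_iff₀ (by positivity), one_div, inv_pow]
  have h3 : (1:ℝ) ≤ ((2:ℝ) ^ l.length)⁻¹ * (2 * (qden l : ℝ) ^ 2) := by
    rw [inv_mul_eq_div, le_div_iff₀ (by positivity)]; linarith
  linarith

lemma continuousOn_invBranch {l : List ℕ} (hl : PosWord l) :
    ContinuousOn (invBranch l) (Set.Ici 0) := by
  have hq : (0:ℝ) < qden l := by exact_mod_cast (qprev_le_and_pos hl).2
  rw [Metric.continuousOn_iff]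
  intro x hx ε hε
  refine ⟨ε * (qden l : ℝ) ^ 2, by positivity, fun y hy h => ?_⟩
  rw [Real.dist_eq] at *
  refine lt_of_le_of_lt (abs_invBranch_sub_le hl hy hx) ?_
  rw [div_lt_iff₀ (by positivity)]
  exact h

/-! ### Gibbs systems and the transfer operator -/

/-- The weight `exp (S_n φ (T_l x))` of a word `l` of length `n`. -/
noncomputable def wt (φ : ℝ → ℝ) (l : List ℕ) (x : ℝ) : ℝ :=
  Real.exp (birkhoff φ l.length (invBranch l x))

/-- A Gibbs measure for a measurable normalized potential, with explicit constants. -/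
structure GibbsSys (φ : ℝ → ℝ) (μ : Measure ℝ) (B θ C : ℝ) : Prop where
  meas : Measurable φ
  full : μ gaussSetᶜ = 0
  inv : MeasurePreserving gaussMap μ μ
  B_pos : 0 < B
  half_le : 1 / 2 ≤ θ
  lt_one : θ < 1
  one_le : 1 ≤ C
  holder : ∀ k, 0 < k → ∀ x ∈ gaussSet, ∀ y ∈ gaussSet, word k x = word k y →
    |φ x - φ y| ≤ B * θ ^ k
  nonpos : ∀ x ∈ gaussSet, φ x ≤ 0
  norm : ∀ x ∈ gaussSet, HasSum (fun a : ℕ+ => Real.exp (φ (invBranch1 a x))) 1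
  gibbs : ∀ l, PosWord l → ∀ x ∈ gaussSet,
    wt φ l x ≤ C * μ.real (_root_.cylinder l) ∧ μ.real (_root_.cylinder l) ≤ C * wt φ l x

lemma wt_pos (φ : ℝ → ℝ) (l : List ℕ) (x : ℝ) : 0 < wt φ l x := Real.exp_pos _

lemma wt_nil (φ : ℝ → ℝ) (x : ℝ) : wt φ [] x = 1 := by simp [wt, birkhoff]

lemma wt_cons {φ : ℝ → ℝ} {a : ℕ} {l : List ℕ} (hl : PosWord (a :: l)) {x : ℝ}
    (hx : x ∈ gaussSet) :
    wt φ (a :: l) x = Real.exp (φ (invBranch1 a (invBranch l x))) * wt φ l x := by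
  unfold wt
  rw [List.length_cons, birkhoff_succ, Real.exp_add, invBranch_cons,
    gaussMap_invBranch1 a (invBranch_mem hl.tail hx)]

lemma wt_append {φ : ℝ → ℝ} {l l' : List ℕ} (hl : PosWord (l ++ l')) {x : ℝ}
    (hx : x ∈ gaussSet) :
    wt φ (l ++ l') x = wt φ l (invBranch l' x) * wt φ l' x := by
  induction l with
  | nil => simp [wt_nil]
  | cons a l ih =>
    have h2 : PosWord (a :: (l ++ l')) := hl
    rw [List.cons_append, wt_cons h2 hx, ih h2.tail,
      wt_cons (PosWord.left (l' := l') hl) (invBranch_mem hl.right hx), invBranch_append]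
    ring

lemma measurable_wt {φ : ℝ → ℝ} (hφ : Measurable φ) (l : List ℕ) : Measurable (wt φ l) :=
  Real.measurable_exp.comp ((measurable_birkhoff hφ _).comp (measurable_invBranch l))

/-- The transfer operator acting on nonnegative functions. -/
noncomputable def tr (φ : ℝ → ℝ) (f : ℝ → ℝ≥0∞) (x : ℝ) : ℝ≥0∞ :=
  ∑' a : ℕ+, ENNReal.ofReal (Real.exp (φ (invBranch1 a x))) * f (invBranch1 a x)

lemma measurable_expBranch {φ : ℝ → ℝ} (hφ : Measurable φ) (a : ℕ) :
    Measurable fun x => ENNReal.ofReal (Real.exp (φ (invBranch1 a x))) :=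
  (Real.measurable_exp.comp (hφ.comp (measurable_invBranch1 a))).ennreal_ofReal

lemma measurable_tr {φ : ℝ → ℝ} (hφ : Measurable φ) {f : ℝ → ℝ≥0∞} (hf : Measurable f) :
    Measurable (tr φ f) :=
  Measurable.tsum fun a =>
    (measurable_expBranch hφ a).mul (hf.comp (measurable_invBranch1 a))

lemma measurable_tr_iterate {φ : ℝ → ℝ} (hφ : Measurable φ) {f : ℝ → ℝ≥0∞} (hf : Measurable f)
    (n : ℕ) : Measurable ((tr φ)^[n] f) := by
  induction n generalizing f with
  | zero => exact hf
  | succ n ih => exact ih (measurable_tr hφ hf)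

/-- The dual transfer operator acting on measures. -/
noncomputable def trDual (φ : ℝ → ℝ) (m : Measure ℝ) : Measure ℝ :=
  Measure.sum fun a : ℕ+ =>
    (m.withDensity fun x => ENNReal.ofReal (Real.exp (φ (invBranch1 a x)))).map (invBranch1 a)

lemma lintegral_trDual {φ : ℝ → ℝ} (hφ : Measurable φ) (m : Measure ℝ) {f : ℝ → ℝ≥0∞}
    (hf : Measurable f) : ∫⁻ x, f x ∂(trDual φ m) = ∫⁻ x, tr φ f x ∂m := by
  unfold trDual tr
  rw [lintegral_sum_measure, lintegral_tsum]
  · congr 1; ext a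
    rw [lintegral_map hf (measurable_invBranch1 a)]
    exact lintegral_withDensity_eq_lintegral_mul _
      (measurable_expBranch hφ a) (hf.comp (measurable_invBranch1 a))
  · exact fun a => ((measurable_expBranch hφ a).mul (hf.comp (measurable_invBranch1 a))).aemeasurable

lemma lintegral_trDual_iterate {φ : ℝ → ℝ} (hφ : Measurable φ) (m : Measure ℝ) {f : ℝ → ℝ≥0∞}
    (hf : Measurable f) (n : ℕ) :
    ∫⁻ x, f x ∂((trDual φ)^[n] m) = ∫⁻ x, (tr φ)^[n] f x ∂m := by
  induction n generalizing f with
  | zero => rfl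
  | succ n ih =>
    rw [Function.iterate_succ_apply', lintegral_trDual hφ _ hf, ih (measurable_tr hφ hf),
      Function.iterate_succ_apply]

lemma tr_congr {φ : ℝ → ℝ} {f g : ℝ → ℝ≥0∞} (h : ∀ x ∈ gaussSet, f x = g x) {x : ℝ}
    (hx : x ∈ gaussSet) : tr φ f x = tr φ g x := by
  unfold tr
  congr 1; ext a
  rw [h _ (invBranch1_mem a.pos hx)]

lemma tr_iterate_congr {φ : ℝ → ℝ} {f g : ℝ → ℝ≥0∞} (h : ∀ x ∈ gaussSet, f x = g x) (n : ℕ)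
    {x : ℝ} (hx : x ∈ gaussSet) : (tr φ)^[n] f x = (tr φ)^[n] g x := by
  induction n generalizing f g with
  | zero => exact h x hx
  | succ n ih => exact ih fun y hy => tr_congr h hy

lemma tr_mul_comp {φ : ℝ → ℝ} (f k : ℝ → ℝ≥0∞) {x : ℝ} (hx : x ∈ gaussSet) :
    tr φ (fun y => f y * k (gaussMap y)) x = tr φ f x * k x := by
  unfold tr
  rw [← ENNReal.tsum_mul_right]
  congr 1; ext a
  beta_reduce
  rw [gaussMap_invBranch1 a hx, mul_assoc]

lemma tr_iterate_mul_comp {φ : ℝ → ℝ} (f k : ℝ → ℝ≥0∞) (n : ℕ) {x : ℝ} (hx : x ∈ gaussSet) :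
    (tr φ)^[n] (fun y => f y * k (gaussMap^[n] y)) x = (tr φ)^[n] f x * k x := by
  induction n generalizing f with
  | zero => rfl
  | succ n ih =>
    rw [Function.iterate_succ_apply, Function.iterate_succ_apply, ← ih]
    apply tr_iterate_congr _ n hx
    intro y hy
    exact tr_mul_comp f (fun z => k (gaussMap^[n] z)) hy

lemma tr_indicator_cons {φ : ℝ → ℝ} {a : ℕ} {l : List ℕ} (hl : PosWord (a :: l))
    (h : ℝ → ℝ≥0∞) {x : ℝ} (hx : x ∈ gaussSet) :
    tr φ ((_root_.cylinder (a :: l)).indicator h) x = (_root_.cylinder l).indicator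
      (fun y => ENNReal.ofReal (Real.exp (φ (invBranch1 a y))) * h (invBranch1 a y)) x := by
  unfold tr
  rw [tsum_eq_single ⟨a, hl.head⟩]
  · have : invBranch1 a x ∈ _root_.cylinder (a :: l) ↔ x ∈ _root_.cylinder l := by
      rw [mem_cylinder_cons, gaussMap_invBranch1 a hx, cfDigit1_invBranch1 a hx]
      simp [invBranch1_mem hl.head hx]
    by_cases hxl : x ∈ _root_.cylinder l
    · simp [indicator, this, hxl]
    · simp [indicator, this, hxl]
  · intro b hb
    have : invBranch1 b x ∉ _root_.cylinder (a :: l) := by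
      rw [mem_cylinder_cons, cfDigit1_invBranch1 b hx]
      rintro ⟨-, h, -⟩
      exact hb (PNat.eq h)
    simp [indicator, this]

lemma tr_iterate_indicator {φ : ℝ → ℝ} {l l' : List ℕ} (hl : PosWord (l ++ l'))
    (h : ℝ → ℝ≥0∞) {x : ℝ} (hx : x ∈ gaussSet) :
    (tr φ)^[l.length] ((_root_.cylinder (l ++ l')).indicator h) x = (_root_.cylinder l').indicator
      (fun y => ENNReal.ofReal (wt φ l y) * h (invBranch l y)) x := by
  induction l generalizing h with
  | nil => simp [wt_nil, invBranch]
  | cons a l ih =>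
    have hl2 : PosWord (a :: (l ++ l')) := hl
    rw [List.length_cons, Function.iterate_succ_apply, List.cons_append,
      tr_iterate_congr (fun y hy => tr_indicator_cons hl2 h hy) _ hx, ih hl2.tail]
    unfold indicator
    split_ifs with hxl
    · beta_reduce
      rw [wt_cons hl.left hx, ENNReal.ofReal_mul (Real.exp_pos _).le, invBranch_cons]
      ring
    · rfl

/-! ### Comparison of measures on cylinders -/

lemma measure_le_of_cylinder {m₁ m₂ : Measure ℝ} [IsFiniteMeasure m₂]
    (h₁ : m₁ gaussSetᶜ = 0) (K : ℝ≥0) (N : ℕ)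
    (h : ∀ l, PosWord l → N ≤ l.length → m₁ (_root_.cylinder l) ≤ K * m₂ (_root_.cylinder l)) :
    m₁ ≤ K • m₂ := by
  have hopen : ∀ U : Set ℝ, IsOpen U → m₁ U ≤ (K • m₂) U := by
    intro U hU
    set S : ℕ → Set (List ℕ) := fun k =>
      {w | w.length = k ∧ PosWord w ∧ _root_.cylinder w ⊆ U} with hS
    set A : ℕ → Set ℝ := fun k => ⋃ w ∈ S k, _root_.cylinder w with hA
    have hmono : Monotone fun k => A (N + k) := by
      apply monotone_nat_of_le_succ
      intro k x hx
      simp only [hA, mem_iUnion] at hx ⊢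
      obtain ⟨w, ⟨hw1, hw2, hw3⟩, hxw⟩ := hx
      have hxX := hxw.1
      refine ⟨word (N + (k + 1)) x, ⟨length_word _ _, posWord_word _ hxX, ?_⟩,
        mem_cylinder_word _ hxX⟩
      have : word (N + (k + 1)) x = w ++ word 1 (gaussMap^[N + k] x) := by
        rw [← add_assoc, word_add]
        congr 1
        rw [← hw1]; exact (mem_cylinder_iff.1 hxw).2
      rw [this]
      exact fun y hy => hw3 (mem_cylinder_append.1 hy).1
    have hcov : U ∩ gaussSet ⊆ ⋃ k, A (N + k) := by
      rintro x ⟨hxU, hxX⟩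
      obtain ⟨ε, hε, hball⟩ := Metric.isOpen_iff.1 hU x hxU
      obtain ⟨k, hk⟩ := exists_pow_lt_of_lt_one (show 0 < ε / 2 by positivity)
        (show (1 / 2 : ℝ) < 1 by norm_num)
      rw [mem_iUnion]
      refine ⟨k, ?_⟩
      simp only [hA, mem_iUnion]
      refine ⟨word (N + k) x, ⟨length_word _ _, posWord_word _ hxX, ?_⟩,
        mem_cylinder_word _ hxX⟩
      intro y hy
      apply hball
      rw [Metric.mem_ball, Real.dist_eq]
      have hx2 := mem_cylinder_word (N + k) hxX
      have e1 := invBranch_iterate hx2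
      have e2 := invBranch_iterate hy
      have p1 := iterate_mem hxX (word (N + k) x).length
      have p2 := iterate_mem hy.1 (word (N + k) x).length
      rw [← e1, ← e2]
      refine lt_of_le_of_lt (abs_invBranch_sub_le_two_pow (posWord_word _ hxX) p2.1.1 p1.1.1
        p2.1.2 p1.1.2) ?_
      rw [length_word, pow_add]
      have h3 : (1 / 2 : ℝ) ^ N ≤ 1 := pow_le_one₀ (by norm_num) (by norm_num)
      have h4 : (0:ℝ) < (1 / 2) ^ k := by positivity
      nlinarith
    have hdisj : ∀ k, (S k).PairwiseDisjoint _root_.cylinder := by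
      intro k w hw w' hw' hne
      exact cylinder_disjoint (hw.1.trans hw'.1.symm) hne
    have hle : ∀ k, m₁ (A (N + k)) ≤ (K • m₂) U := by
      intro k
      calc m₁ (A (N + k)) = ∑' w : S (N + k), m₁ (_root_.cylinder w) :=
            measure_biUnion (Set.to_countable _) (hdisj _) fun w _ => measurableSet_cylinder w
        _ ≤ ∑' w : S (N + k), (K • m₂) (_root_.cylinder w) := by
            apply ENNReal.tsum_le_tsum
            intro w
            have := h w.1 w.2.2.1 (by rw [w.2.1]; omega)
            rw [Measure.smul_apply]
            exact this
        _ = (K • m₂) (A (N + k)) :=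
            (measure_biUnion (Set.to_countable _) (hdisj _) fun w _ => measurableSet_cylinder w).symm
        _ ≤ (K • m₂) U := measure_mono (iUnion₂_subset fun w hw => hw.2.2)
    calc m₁ U ≤ m₁ (U ∩ gaussSet) + m₁ (U \ gaussSet) := measure_le_inter_add_sdiff _ _ _
      _ ≤ m₁ (⋃ k, A (N + k)) + 0 := by
          gcongr
          exact (measure_mono (fun x hx => hx.2)).trans h₁.le
      _ = ⨆ k, m₁ (A (N + k)) := by rw [add_zero, hmono.measure_iUnion]
      _ ≤ _ := iSup_le hle
  rw [Measure.le_iff]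
  intro E _
  apply le_of_forall_gt
  intro r hr
  obtain ⟨U, hEU, hU, hUr⟩ := E.exists_isOpen_lt_of_lt r hr
  exact ((measure_mono hEU).trans (hopen U hU)).trans_lt hUr

/-! ### Invariance of a Gibbs measure under the dual transfer operator -/

lemma tr_one {φ : ℝ → ℝ} {μ : Measure ℝ} {B θ C : ℝ} (S : GibbsSys φ μ B θ C) {x : ℝ}
    (hx : x ∈ gaussSet) : tr φ (fun _ => 1) x = 1 := by
  unfold tr
  have h := S.norm x hx
  simp only [mul_one]
  rw [← ENNReal.ofReal_tsum_of_nonneg (fun a => (Real.exp_pos _).le) h.summable, h.tsum_eq,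
    ENNReal.ofReal_one]

section
variable {φ : ℝ → ℝ} {μ : Measure ℝ} {B θ C : ℝ} [IsProbabilityMeasure μ]

lemma GibbsSys.ae_mem (S : GibbsSys φ μ B θ C) : ∀ᵐ x ∂μ, x ∈ gaussSet := by
  rw [ae_iff]; exact S.full

lemma GibbsSys.C_pos (S : GibbsSys φ μ B θ C) : 0 < C := lt_of_lt_of_le one_pos S.one_le

lemma GibbsSys.wt_append_le (S : GibbsSys φ μ B θ C) {l l' : List ℕ} (hl : PosWord (l ++ l'))
    {x : ℝ} (hx : x ∈ _root_.cylinder l') :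
    wt φ l x * μ.real (_root_.cylinder l') ≤ C ^ 2 * μ.real (_root_.cylinder (l ++ l')) ∧
    μ.real (_root_.cylinder (l ++ l')) ≤ C ^ 2 * (wt φ l x * μ.real (_root_.cylinder l')) := by
  have hy := iterate_mem hx.1 l'.length
  have e := invBranch_iterate hx
  set y := gaussMap^[l'.length] x
  have h1 := S.gibbs _ hl y hy
  have h2 := S.gibbs _ hl.right y hy
  rw [wt_append hl hy, e] at h1
  have hw := wt_pos φ l x
  have hC := S.C_pos
  constructor
  · calc wt φ l x * μ.real (_root_.cylinder l') ≤ wt φ l x * (C * wt φ l' y) := by gcongr; exact h2.2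
      _ = C * (wt φ l x * wt φ l' y) := by ring
      _ ≤ C * (C * μ.real (_root_.cylinder (l ++ l'))) := mul_le_mul_of_nonneg_left h1.1 hC.le
      _ = _ := by ring
  · calc _ ≤ C * (wt φ l x * wt φ l' y) := h1.2
      _ ≤ C * (wt φ l x * (C * μ.real (_root_.cylinder l'))) := by gcongr; exact h2.1
      _ = _ := by ring

lemma GibbsSys.trDual_iterate_cylinder (S : GibbsSys φ μ B θ C) {l l' : List ℕ}
    (hl : PosWord (l ++ l')) : ((trDual φ)^[l.length] μ) (_root_.cylinder (l ++ l')) =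
      ∫⁻ x in _root_.cylinder l', ENNReal.ofReal (wt φ l x) ∂μ := by
  rw [← lintegral_indicator_one (measurableSet_cylinder _),
    lintegral_trDual_iterate S.meas _ (measurable_one.indicator (measurableSet_cylinder _)),
    ← lintegral_indicator (measurableSet_cylinder _)]
  apply lintegral_congr_ae
  filter_upwards [S.ae_mem] with x hx
  rw [tr_iterate_indicator hl _ hx]
  simp

lemma GibbsSys.trDual_iterate_full (S : GibbsSys φ μ B θ C) (n : ℕ) :
    ((trDual φ)^[n] μ) gaussSetᶜ = 0 := by
  rw [← lintegral_indicator_one measurableSet_gaussSet.compl,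
    lintegral_trDual_iterate S.meas _ (measurable_one.indicator measurableSet_gaussSet.compl)]
  rw [lintegral_eq_zero_iff (measurable_tr_iterate S.meas
    (measurable_one.indicator measurableSet_gaussSet.compl) n)]
  filter_upwards [S.ae_mem] with x hx
  rw [tr_iterate_congr (g := fun _ => 0) (fun y hy => by simp [hy]) n hx]
  have : ∀ n : ℕ, (tr φ)^[n] (fun _ => 0) = fun _ => 0 := by
    intro n
    induction n with
    | zero => rfl
    | succ n ih => rw [Function.iterate_succ_apply]; convert ih using 2; ext x; simp [tr]
  rw [this]; rfl

lemma GibbsSys.trDual_iterate_univ (S : GibbsSys φ μ B θ C) (n : ℕ) :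
    ((trDual φ)^[n] μ) univ = 1 := by
  rw [← lintegral_indicator_one MeasurableSet.univ,
    lintegral_trDual_iterate S.meas _ (measurable_one.indicator MeasurableSet.univ)]
  rw [← measure_univ (μ := μ), ← lintegral_one]
  apply lintegral_congr_ae
  filter_upwards [S.ae_mem] with x hx
  induction n with
  | zero => simp
  | succ n ih =>
    rw [Function.iterate_succ_apply, ← ih]
    exact tr_iterate_congr (fun y hy => by
      rw [tr_congr (g := fun _ => 1) (fun z _ => by simp) hy, tr_one S hy]; simp) n hx

lemma GibbsSys.isProb_trDual_iterate (S : GibbsSys φ μ B θ C) (n : ℕ) :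
    IsProbabilityMeasure ((trDual φ)^[n] μ) := ⟨S.trDual_iterate_univ n⟩

lemma ofReal_measureReal_cyl (l : List ℕ) :
    ENNReal.ofReal (μ.real (_root_.cylinder l)) = μ (_root_.cylinder l) :=
  ENNReal.ofReal_toReal (measure_ne_top _ _)

lemma GibbsSys.trDual_iterate_le (S : GibbsSys φ μ B θ C) (n : ℕ) :
    (trDual φ)^[n] μ ≤ (C ^ 2).toNNReal • μ := by
  apply measure_le_of_cylinder (S.trDual_iterate_full n) _ n
  intro w hw hn
  obtain ⟨l, l', rfl, rfl⟩ : ∃ l l', l.length = n ∧ w = l ++ l' :=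
    ⟨w.take n, w.drop n, by simp [hn], by simp⟩
  rw [S.trDual_iterate_cylinder hw]
  by_cases h0 : μ (_root_.cylinder l') = 0
  · rw [Measure.restrict_eq_zero.2 h0]; simp
  have hpos : 0 < μ.real (_root_.cylinder l') :=
    ENNReal.toReal_pos h0 (measure_ne_top _ _)
  calc ∫⁻ x in _root_.cylinder l', ENNReal.ofReal (wt φ l x) ∂μ
      ≤ ∫⁻ x in _root_.cylinder l', ENNReal.ofReal
          (C ^ 2 * μ.real (_root_.cylinder (l ++ l')) / μ.real (_root_.cylinder l')) ∂μ := by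
        apply setLIntegral_mono measurable_const
        intro x hx
        apply ENNReal.ofReal_le_ofReal
        rw [le_div_iff₀ hpos]
        exact (S.wt_append_le hw hx).1
    _ = ENNReal.ofReal (C ^ 2 * μ.real (_root_.cylinder (l ++ l')) / μ.real (_root_.cylinder l'))
          * ENNReal.ofReal (μ.real (_root_.cylinder l')) := by
        rw [setLIntegral_const, ofReal_measureReal_cyl]
    _ = ENNReal.ofReal (C ^ 2) * ENNReal.ofReal (μ.real (_root_.cylinder (l ++ l'))) := by
        rw [← ENNReal.ofReal_mul (by positivity), ← ENNReal.ofReal_mul (by positivity)]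
        congr 1; field_simp
    _ ≤ _ := by rw [ofReal_measureReal_cyl]; rfl

lemma GibbsSys.le_trDual_iterate (S : GibbsSys φ μ B θ C) (n : ℕ) :
    μ ≤ (C ^ 2).toNNReal • (trDual φ)^[n] μ := by
  have := S.isProb_trDual_iterate n
  apply measure_le_of_cylinder S.full _ n
  intro w hw hn
  obtain ⟨l, l', rfl, rfl⟩ : ∃ l l', l.length = n ∧ w = l ++ l' :=
    ⟨w.take n, w.drop n, by simp [hn], by simp⟩
  rw [S.trDual_iterate_cylinder hw]
  have hC := S.C_pos
  by_cases h0 : μ (_root_.cylinder l') = 0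
  · have : _root_.cylinder (l ++ l') ⊆ gaussMap^[l.length] ⁻¹' _root_.cylinder l' := by
      intro x hx; exact (mem_cylinder_append.1 hx).2
    have h1 := measure_mono (μ := μ) this
    rw [(S.inv.iterate l.length).measure_preimage (measurableSet_cylinder _).nullMeasurableSet,
      h0] at h1
    exact h1.trans zero_le
  have hpos : 0 < μ.real (_root_.cylinder l') :=
    ENNReal.toReal_pos h0 (measure_ne_top _ _)
  calc μ (_root_.cylinder (l ++ l')) = ENNReal.ofReal (C ^ 2) * (ENNReal.ofReal
          (μ.real (_root_.cylinder (l ++ l')) / (C ^ 2 * μ.real (_root_.cylinder l')))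
          * ENNReal.ofReal (μ.real (_root_.cylinder l'))) := by
        rw [← ENNReal.ofReal_mul (by positivity), ← ENNReal.ofReal_mul (by positivity),
          ← ofReal_measureReal_cyl]
        congr 1; field_simp
    _ = ENNReal.ofReal (C ^ 2) * ∫⁻ x in _root_.cylinder l', ENNReal.ofReal
          (μ.real (_root_.cylinder (l ++ l')) / (C ^ 2 * μ.real (_root_.cylinder l'))) ∂μ := by
        rw [setLIntegral_const, ofReal_measureReal_cyl]
    _ ≤ ENNReal.ofReal (C ^ 2) * ∫⁻ x in _root_.cylinder l', ENNReal.ofReal (wt φ l x) ∂μ := by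
        refine mul_le_mul_right ?_ _
        apply setLIntegral_mono (measurable_wt S.meas l).ennreal_ofReal
        intro x hx
        apply ENNReal.ofReal_le_ofReal
        rw [div_le_iff₀ (by positivity)]
        refine (S.wt_append_le hw hx).2.trans (le_of_eq ?_); ring
    _ = _ := rfl

/-- The density of `trDual φ μ` with respect to `μ`. -/
noncomputable def trDens (φ : ℝ → ℝ) (μ : Measure ℝ) : ℝ → ℝ≥0∞ := (trDual φ μ).rnDeriv μ

lemma measurable_trDens : Measurable (trDens φ μ) := Measure.measurable_rnDeriv _ _

lemma GibbsSys.lintegral_tr_eq_dens (S : GibbsSys φ μ B θ C) {f : ℝ → ℝ≥0∞} (hf : Measurable f) :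
    ∫⁻ x, tr φ f x ∂μ = ∫⁻ x, f x * trDens φ μ x ∂μ := by
  have hac : trDual φ μ ≪ μ :=
    (Measure.absolutelyContinuous_of_le (S.trDual_iterate_le 1)).trans Measure.smul_absolutelyContinuous
  have : IsProbabilityMeasure (trDual φ μ) := S.isProb_trDual_iterate 1
  rw [← lintegral_trDual S.meas μ hf]
  have e : trDual φ μ = μ.withDensity (trDens φ μ) := (Measure.withDensity_rnDeriv_eq _ _ hac).symm
  calc ∫⁻ x, f x ∂(trDual φ μ) = ∫⁻ x, f x ∂(μ.withDensity (trDens φ μ)) := by rw [← e]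
    _ = ∫⁻ x, trDens φ μ x * f x ∂μ := lintegral_withDensity_eq_lintegral_mul _ measurable_trDens hf
    _ = _ := by simp_rw [mul_comm]

lemma GibbsSys.lintegral_tr_iterate_eq_dens (S : GibbsSys φ μ B θ C) {f : ℝ → ℝ≥0∞}
    (hf : Measurable f) (n : ℕ) : ∫⁻ x, (tr φ)^[n] f x ∂μ =
      ∫⁻ x, f x * ∏ k ∈ Finset.range n, trDens φ μ (gaussMap^[k] x) ∂μ := by
  induction n generalizing f with
  | zero => simp
  | succ n ih =>
    rw [Function.iterate_succ_apply', S.lintegral_tr_eq_dens (measurable_tr_iterate S.meas hf n)]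
    have : ∫⁻ x, (tr φ)^[n] f x * trDens φ μ x ∂μ =
        ∫⁻ x, (tr φ)^[n] (fun y => f y * trDens φ μ (gaussMap^[n] y)) x ∂μ := by
      apply lintegral_congr_ae
      filter_upwards [S.ae_mem] with x hx
      exact (tr_iterate_mul_comp _ _ n hx).symm
    rw [this, ih (f := fun y => f y * trDens φ μ (gaussMap^[n] y))
      (hf.mul (measurable_trDens.comp (measurable_iterate n)))]
    congr 1; ext x
    rw [Finset.prod_range_succ]
    ring

lemma measurable_prod_trDens (n : ℕ) :
    Measurable fun x => ∏ k ∈ Finset.range n, trDens φ μ (gaussMap^[k] x) :=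
  Finset.measurable_prod _ fun k _ => measurable_trDens.comp (measurable_iterate k)

lemma GibbsSys.prod_dens_le (S : GibbsSys φ μ B θ C) (n : ℕ) :
    ∀ᵐ x ∂μ, ∏ k ∈ Finset.range n, trDens φ μ (gaussMap^[k] x) ≤ ENNReal.ofReal (C ^ 2) := by
  apply ae_le_of_forall_setLIntegral_le_of_sigmaFinite₀ (measurable_prod_trDens n).aemeasurable
  intro s hs _
  have h := S.trDual_iterate_le n s
  rw [← lintegral_indicator_one hs, lintegral_trDual_iterate S.meas _ (measurable_one.indicator hs),
    S.lintegral_tr_iterate_eq_dens (measurable_one.indicator hs)] at h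
  rw [setLIntegral_const, ← lintegral_indicator hs]
  refine le_trans (le_of_eq ?_) h
  congr 1; ext x
  by_cases hx : x ∈ s <;> simp [hx]

lemma GibbsSys.le_prod_dens (S : GibbsSys φ μ B θ C) (n : ℕ) :
    ∀ᵐ x ∂μ, 1 ≤ ENNReal.ofReal (C ^ 2) * ∏ k ∈ Finset.range n, trDens φ μ (gaussMap^[k] x) := by
  apply ae_le_of_forall_setLIntegral_le_of_sigmaFinite₀ aemeasurable_const
  intro s hs _
  have h := S.le_trDual_iterate n s
  rw [Measure.smul_apply, ← lintegral_indicator_one (μ := (trDual φ)^[n] μ) hs,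
    lintegral_trDual_iterate S.meas _ (measurable_one.indicator hs),
    S.lintegral_tr_iterate_eq_dens (measurable_one.indicator hs)] at h
  rw [lintegral_const_mul _ (measurable_prod_trDens n), setLIntegral_one, ← lintegral_indicator hs]
  refine le_trans h (le_of_eq ?_)
  change ENNReal.ofReal (C ^ 2) * _ = _
  congr 2; ext x
  by_cases hx : x ∈ s <;> simp [hx]

lemma integral_comp_iterate (hinv : MeasurePreserving gaussMap μ μ) {f : ℝ → ℝ}
    (hf : Measurable f) (n : ℕ) : ∫ x, f (gaussMap^[n] x) ∂μ = ∫ x, f x ∂μ := by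
  have h := (hinv.iterate n)
  conv_rhs => rw [← h.map_eq]
  rw [integral_map h.measurable.aemeasurable hf.aestronglyMeasurable]

lemma GibbsSys.dens_eq_one (S : GibbsSys φ μ B θ C) : ∀ᵐ x ∂μ, trDens φ μ x = 1 := by
  set r : ℝ → ℝ := fun x => (trDens φ μ x).toReal with hr
  have hrm : Measurable r := measurable_trDens.ennreal_toReal
  have hC := S.C_pos
  have hC2 : (0:ℝ) < C ^ 2 := by positivity
  have hup : ∀ᵐ x ∂μ, trDens φ μ x ≤ ENNReal.ofReal (C ^ 2) := by
    simpa using S.prod_dens_le 1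
  have hlo : ∀ n : ℕ, ∀ᵐ x ∂μ, (C ^ 2)⁻¹ ≤ ∏ k ∈ Finset.range n, r (gaussMap^[k] x) := by
    intro n
    filter_upwards [S.le_prod_dens n, S.prod_dens_le n] with x hx hx2
    have h := ENNReal.toReal_mono (by
      exact ENNReal.mul_ne_top ENNReal.ofReal_ne_top (hx2.trans_lt ENNReal.ofReal_lt_top).ne) hx
    rw [ENNReal.toReal_mul, ENNReal.toReal_ofReal hC2.le, ENNReal.toReal_prod] at h
    rw [inv_le_iff_one_le_mul₀ hC2, mul_comm]
    simpa using h
  have hlo1 : ∀ᵐ x ∂μ, (C ^ 2)⁻¹ ≤ r x := by simpa using hlo 1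
  have hup1 : ∀ᵐ x ∂μ, r x ≤ C ^ 2 := by
    filter_upwards [hup] with x hx
    exact ENNReal.toReal_le_of_le_ofReal hC2.le hx
  have hint1 : Integrable r μ := by
    refine Integrable.of_bound hrm.aestronglyMeasurable (C ^ 2) ?_
    filter_upwards [hup1] with x hx
    rw [Real.norm_of_nonneg ENNReal.toReal_nonneg]; exact hx
  have hlogm : Measurable fun x => Real.log (r x) := Real.measurable_log.comp hrm
  have hint2 : Integrable (fun x => Real.log (r x)) μ := by
    refine Integrable.of_bound hlogm.aestronglyMeasurable (Real.log (C ^ 2)) ?_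
    filter_upwards [hup1, hlo1] with x hx hx2
    have hp : 0 < r x := lt_of_lt_of_le (by positivity) hx2
    rw [Real.norm_eq_abs, abs_le, ← Real.log_inv]
    exact ⟨Real.log_le_log (by positivity) hx2, Real.log_le_log hp hx⟩
  have hr1 : ∫ x, r x ∂μ = 1 := by
    rw [hr, integral_toReal measurable_trDens.aemeasurable
      (by filter_upwards [hup] with x hx using hx.trans_lt ENNReal.ofReal_lt_top)]
    have h := S.lintegral_tr_eq_dens (f := fun _ => 1) measurable_const
    simp only [one_mul] at h
    rw [← h, lintegral_congr_ae (g := fun _ => 1)]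
    · simp
    · filter_upwards [S.ae_mem] with x hx using tr_one S hx
  have hlog0 : ∀ n : ℕ, -Real.log (C ^ 2) ≤ n * ∫ x, Real.log (r x) ∂μ := by
    intro n
    have hi : ∀ k ∈ Finset.range n, Integrable (fun x => Real.log (r (gaussMap^[k] x))) μ :=
      fun k _ => (S.inv.iterate k).integrable_comp_of_integrable hint2
    have e : ∫ x, ∑ k ∈ Finset.range n, Real.log (r (gaussMap^[k] x)) ∂μ =
        n * ∫ x, Real.log (r x) ∂μ := by
      rw [integral_finsetSum _ hi]
      simp_rw [integral_comp_iterate S.inv hlogm]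
      simp
    rw [← e]
    calc -Real.log (C ^ 2) = ∫ x, -Real.log (C ^ 2) ∂μ := by simp
      _ ≤ _ := by
        apply integral_mono_ae (integrable_const _) (integrable_finsetSum _ hi)
        have hall : ∀ᵐ x ∂μ, ∀ k : ℕ, (C ^ 2)⁻¹ ≤ r (gaussMap^[k] x) :=
          ae_all_iff.2 fun k => (S.inv.iterate k).quasiMeasurePreserving.ae hlo1
        filter_upwards [hlo n, hall] with x hx hx2
        have : 0 < (C ^ 2)⁻¹ := by positivity
        rw [← Real.log_prod (fun k _ => (lt_of_lt_of_le this (hx2 k)).ne'), ← Real.log_inv]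
        exact Real.log_le_log this hx
  have hge : 0 ≤ ∫ x, Real.log (r x) ∂μ := by
    by_contra! hneg
    obtain ⟨n, hn⟩ := exists_nat_gt (Real.log (C ^ 2) / -(∫ x, Real.log (r x) ∂μ))
    rw [div_lt_iff₀ (by linarith)] at hn
    have := hlog0 n
    linarith
  have hnn : 0 ≤ᵐ[μ] fun x => r x - 1 - Real.log (r x) := by
    filter_upwards [hlo1] with x hx
    have hp : 0 < r x := lt_of_lt_of_le (by positivity) hx
    have := Real.log_le_sub_one_of_pos hp
    simp only [Pi.zero_apply]; linarith
  have hz : ∫ x, (r x - 1 - Real.log (r x)) ∂μ = 0 := by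
    apply le_antisymm _ (integral_nonneg_of_ae hnn)
    rw [integral_sub (f := fun x => r x - 1) (hint1.sub (integrable_const _)) hint2, integral_sub hint1 (integrable_const _),
      hr1]
    simp only [integral_const, probReal_univ, smul_eq_mul, mul_one]
    linarith
  rw [integral_eq_zero_iff_of_nonneg_ae hnn ((hint1.sub (integrable_const _)).sub hint2)] at hz
  filter_upwards [hz, hlo1] with x hx hx2
  have hp : 0 < r x := lt_of_lt_of_le (by positivity) hx2
  have h1 : r x = 1 := by
    by_contra hne
    have := Real.log_lt_sub_one_of_pos hp hne
    simp only [Pi.zero_apply] at hx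
    linarith
  exact (ENNReal.toReal_eq_one_iff _).1 h1

lemma GibbsSys.lintegral_tr (S : GibbsSys φ μ B θ C) {f : ℝ → ℝ≥0∞} (hf : Measurable f) :
    ∫⁻ x, tr φ f x ∂μ = ∫⁻ x, f x ∂μ := by
  rw [S.lintegral_tr_eq_dens hf]
  apply lintegral_congr_ae
  filter_upwards [S.dens_eq_one] with x hx
  rw [hx, mul_one]

lemma GibbsSys.lintegral_tr_iterate (S : GibbsSys φ μ B θ C) {f : ℝ → ℝ≥0∞} (hf : Measurable f)
    (n : ℕ) : ∫⁻ x, (tr φ)^[n] f x ∂μ = ∫⁻ x, f x ∂μ := by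
  induction n generalizing f with
  | zero => rfl
  | succ n ih => rw [Function.iterate_succ_apply, ih (measurable_tr S.meas hf), S.lintegral_tr hf]

/-- Change of variables along an inverse branch. -/
lemma GibbsSys.restrict_cylinder (S : GibbsSys φ μ B θ C) {l : List ℕ} (hl : PosWord l) :
    μ.restrict (_root_.cylinder l) =
      (μ.withDensity fun x => ENNReal.ofReal (wt φ l x)).map (invBranch l) := by
  ext s hs
  have h := S.lintegral_tr_iterate (f := (_root_.cylinder (l ++ [])).indicator (s.indicator 1))
    ((measurable_one.indicator hs).indicator (measurableSet_cylinder _)) l.length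
  rw [Measure.restrict_apply hs, Measure.map_apply (measurable_invBranch l) hs,
    withDensity_apply _ (measurable_invBranch l hs),
    ← lintegral_indicator (measurable_invBranch l hs), inter_comm,
    ← lintegral_indicator_one ((measurableSet_cylinder l).inter hs)]
  have e1 : (_root_.cylinder (l ++ [])).indicator (s.indicator (1 : ℝ → ℝ≥0∞)) =
      (_root_.cylinder l ∩ s).indicator 1 := by
    rw [List.append_nil, indicator_indicator]
  rw [← e1, ← h]
  apply lintegral_congr_ae
  filter_upwards [S.ae_mem] with x hx
  rw [tr_iterate_indicator (by simpa using hl) _ hx, cylinder_nil, indicator_of_mem hx]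
  by_cases hxs : invBranch l x ∈ s <;> simp [hxs]

end

/-! ### Distortion -/

lemma word_invBranch {l : List ℕ} (hl : PosWord l) (k : ℕ) {x : ℝ} (hx : x ∈ gaussSet) :
    word (l.length + k) (invBranch l x) = l ++ word k x := by
  rw [word_add, (mem_cylinder_iff.1 (invBranch_mem_cylinder hl hx)).2, iterate_invBranch hl hx]

/-- The distortion constant. -/
noncomputable def distC (B θ : ℝ) : ℝ := B * θ / (1 - θ)

section
variable {φ : ℝ → ℝ} {μ : Measure ℝ} {B θ C : ℝ} [IsProbabilityMeasure μ]

lemma GibbsSys.θ_pos (S : GibbsSys φ μ B θ C) : 0 < θ := by linarith [S.half_le]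

lemma GibbsSys.distC_pos (S : GibbsSys φ μ B θ C) : 0 < distC B θ :=
  div_pos (mul_pos S.B_pos S.θ_pos) (by linarith [S.lt_one])

lemma GibbsSys.wt_le_wt (S : GibbsSys φ μ B θ C) {l : List ℕ} (hl : PosWord l) {k : ℕ} {x y : ℝ}
    (hx : x ∈ gaussSet) (hy : y ∈ gaussSet) (h : word k x = word k y) :
    wt φ l x ≤ Real.exp (distC B θ * θ ^ k) * wt φ l y := by
  have h1 : 0 < 1 - θ := by linarith [S.lt_one]
  have hθ := S.θ_pos
  have hD := S.distC_pos
  suffices hs : wt φ l x ≤ Real.exp (distC B θ * θ ^ k * (1 - θ ^ l.length)) * wt φ l y by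
    refine hs.trans (mul_le_mul_of_nonneg_right (Real.exp_le_exp.2 ?_) (wt_pos _ _ _).le)
    have : 0 ≤ distC B θ * θ ^ k := by positivity
    have h2 : 0 ≤ θ ^ l.length := by positivity
    nlinarith
  induction l with
  | nil => simp [wt_nil]
  | cons a l ih =>
    rw [wt_cons hl hx, wt_cons hl hy]
    have hw : word (l.length + 1 + k) (invBranch1 a (invBranch l x)) =
        word (l.length + 1 + k) (invBranch1 a (invBranch l y)) := by
      have e1 := word_invBranch hl k hx
      have e2 := word_invBranch hl k hy
      rw [List.length_cons, invBranch_cons] at e1 e2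
      rw [e1, e2, h]
    have h3 := S.holder _ (by omega) _ (invBranch1_mem hl.head (invBranch_mem hl.tail hx)) _
      (invBranch1_mem hl.head (invBranch_mem hl.tail hy)) hw
    have h4 := (abs_le.1 h3).2
    calc Real.exp (φ (invBranch1 a (invBranch l x))) * wt φ l x
        ≤ Real.exp (B * θ ^ (l.length + 1 + k) + φ (invBranch1 a (invBranch l y))) *
          (Real.exp (distC B θ * θ ^ k * (1 - θ ^ l.length)) * wt φ l y) := by
          apply mul_le_mul (Real.exp_le_exp.2 (by linarith)) (ih hl.tail) (wt_pos _ _ _).le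
            (Real.exp_pos _).le
      _ = Real.exp (B * θ ^ (l.length + 1 + k) + distC B θ * θ ^ k * (1 - θ ^ l.length)) *
          (Real.exp (φ (invBranch1 a (invBranch l y))) * wt φ l y) := by
          rw [Real.exp_add, Real.exp_add]; ring
      _ = _ := by
          congr 2
          rw [distC, List.length_cons]
          field_simp
          ring

lemma GibbsSys.abs_wt_sub_le (S : GibbsSys φ μ B θ C) {l : List ℕ} (hl : PosWord l) {k : ℕ}
    {x y : ℝ} (hx : x ∈ gaussSet) (hy : y ∈ gaussSet) (h : word k x = word k y) :
    |wt φ l x - wt φ l y| ≤ distC B θ * Real.exp (2 * distC B θ) * θ ^ k * wt φ l x := by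
  have hD := S.distC_pos
  have ht : 0 < distC B θ * θ ^ k := mul_pos hD (pow_pos S.θ_pos k)
  have ht2 : distC B θ * θ ^ k ≤ distC B θ :=
    mul_le_of_le_one_right hD.le (pow_le_one₀ S.θ_pos.le S.lt_one.le)
  have h1 := S.wt_le_wt hl hx hy h
  have h2 := S.wt_le_wt hl hy hx h.symm
  set t := distC B θ * θ ^ k
  have hw := wt_pos φ l x
  have hv := wt_pos φ l y
  have he : Real.exp t - 1 ≤ t * Real.exp t := by
    have := Real.add_one_le_exp (-t)
    rw [Real.exp_neg] at this
    have hp := Real.exp_pos t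
    have := mul_le_mul_of_nonneg_right this hp.le
    rw [inv_mul_cancel₀ hp.ne'] at this
    linarith
  have he2 : Real.exp t ≤ Real.exp (distC B θ) := Real.exp_le_exp.2 ht2
  have he3 : Real.exp (2 * distC B θ) = Real.exp (distC B θ) * Real.exp (distC B θ) := by
    rw [← Real.exp_add]; ring_nf
  have he4 : 1 ≤ Real.exp (distC B θ) := Real.one_le_exp hD.le
  have e0 : distC B θ * Real.exp (2 * distC B θ) * θ ^ k * wt φ l x =
      t * Real.exp (distC B θ) * (Real.exp (distC B θ) * wt φ l x) := by rw [he3]; ring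
  have hve : wt φ l y ≤ Real.exp (distC B θ) * wt φ l x :=
    h2.trans (mul_le_mul_of_nonneg_right he2 hw.le)
  have hwe : wt φ l x ≤ Real.exp (distC B θ) * wt φ l x := by nlinarith
  have hte : Real.exp t - 1 ≤ t * Real.exp (distC B θ) :=
    he.trans (mul_le_mul_of_nonneg_left he2 ht.le)
  have hte0 : 0 ≤ t * Real.exp (distC B θ) := by positivity
  rw [e0, abs_le]
  constructor
  · have : wt φ l y - wt φ l x ≤ (Real.exp t - 1) * wt φ l x := by linarith
    have h3 := mul_le_mul hte hwe hw.le hte0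
    linarith
  · have : wt φ l x - wt φ l y ≤ (Real.exp t - 1) * wt φ l y := by linarith
    have h3 := mul_le_mul hte hve hv.le hte0
    linarith

/-! ### Moments of the first digit -/

/-- The moment function `(a₁ + 1) ^ β`. -/
noncomputable def momF (β : ℝ) (x : ℝ) : ℝ := ((cfDigit1 x : ℝ) + 1) ^ β

lemma measurable_momF (β : ℝ) : Measurable (momF β) := by
  unfold momF
  have : Measurable fun x => (cfDigit1 x : ℝ) := measurable_from_top.comp measurable_cfDigit1
  fun_prop

lemma one_le_momF {β : ℝ} (hβ : 0 ≤ β) (x : ℝ) : 1 ≤ momF β x :=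
  Real.one_le_rpow (by linarith [Nat.cast_nonneg (α := ℝ) (cfDigit1 x)]) hβ

lemma GibbsSys.exists_moment (S : GibbsSys φ μ B θ C) (ht : PolyTail μ) :
    ∃ β > 0, ∫⁻ x, ENNReal.ofReal (momF β x) ∂μ < ⊤ := by
  obtain ⟨δ, hδ, K, hK⟩ := ht
  refine ⟨δ / 2, by positivity, ?_⟩
  set β := δ / 2 with hβ
  have hβ0 : 0 < β := by positivity
  have hpt : ∀ x ∈ gaussSet, ENNReal.ofReal (momF β x) ≤ ∑' i : ℕ,
      {x | x ∈ gaussSet ∧ 2 ^ i ≤ cfDigit1 x}.indicator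
        (fun _ => ENNReal.ofReal ((2 : ℝ) ^ (β * (i + 1)))) x := by
    intro x hx
    set i := Nat.log 2 (cfDigit1 x) with hi
    refine le_trans ?_ (ENNReal.le_tsum i)
    have h1 : 2 ^ i ≤ cfDigit1 x := Nat.pow_log_le_self 2 (cfDigit1_pos hx).ne'
    rw [indicator_of_mem (show x ∈ {x | x ∈ gaussSet ∧ 2 ^ i ≤ cfDigit1 x} from ⟨hx, h1⟩)]
    apply ENNReal.ofReal_le_ofReal
    have h2 : cfDigit1 x + 1 ≤ 2 ^ (i + 1) := Nat.lt_pow_succ_log_self (by norm_num) _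
    have h3 : (cfDigit1 x : ℝ) + 1 ≤ (2:ℝ) ^ ((i : ℝ) + 1) := by
      have : ((cfDigit1 x + 1 : ℕ) : ℝ) ≤ ((2 ^ (i + 1) : ℕ) : ℝ) := by exact_mod_cast h2
      push_cast at this
      rw [show ((i : ℝ) + 1) = ((i + 1 : ℕ) : ℝ) by push_cast; ring, Real.rpow_natCast]
      exact this
    unfold momF
    calc ((cfDigit1 x : ℝ) + 1) ^ β ≤ ((2:ℝ) ^ ((i : ℝ) + 1)) ^ β :=
          Real.rpow_le_rpow (by positivity) h3 hβ0.le
      _ = (2:ℝ) ^ (β * ((i : ℝ) + 1)) := by rw [← Real.rpow_mul (by norm_num)]; ring_nf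
  have hms : ∀ i : ℕ, MeasurableSet {x | x ∈ gaussSet ∧ 2 ^ i ≤ cfDigit1 x} := fun i =>
    measurableSet_gaussSet.inter (measurable_cfDigit1 (measurableSet_Ici (a := 2 ^ i)))
  calc ∫⁻ x, ENNReal.ofReal (momF β x) ∂μ ≤ ∫⁻ x, ∑' i : ℕ,
      {x | x ∈ gaussSet ∧ 2 ^ i ≤ cfDigit1 x}.indicator
        (fun _ => ENNReal.ofReal ((2 : ℝ) ^ (β * (i + 1)))) x ∂μ := by
        apply lintegral_mono_ae
        filter_upwards [S.ae_mem] with x hx using hpt x hx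
    _ = ∑' i : ℕ, ENNReal.ofReal ((2 : ℝ) ^ (β * (i + 1))) *
          μ {x | x ∈ gaussSet ∧ 2 ^ i ≤ cfDigit1 x} := by
        rw [lintegral_tsum fun i => (measurable_const.indicator (hms i)).aemeasurable]
        congr 1; ext i
        rw [lintegral_indicator (hms i), setLIntegral_const]
    _ ≤ ∑' i : ℕ, ENNReal.ofReal ((2:ℝ) ^ β * |K| * ((2:ℝ) ^ (-β)) ^ i) := by
        apply ENNReal.tsum_le_tsum
        intro i
        have h1 : μ {x | x ∈ gaussSet ∧ 2 ^ i ≤ cfDigit1 x} ≤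
            ENNReal.ofReal (|K| * ((2:ℝ) ^ i) ^ (-δ)) := by
          rw [← ENNReal.ofReal_toReal (measure_ne_top μ {x | x ∈ gaussSet ∧ 2 ^ i ≤ cfDigit1 x})]
          apply ENNReal.ofReal_le_ofReal
          have := hK (2 ^ i) (by positivity)
          push_cast at this
          refine this.trans ?_
          have hp : 0 ≤ ((2:ℝ) ^ i) ^ (-δ) := by positivity
          exact mul_le_mul_of_nonneg_right (le_abs_self K) hp
        calc _ ≤ ENNReal.ofReal ((2 : ℝ) ^ (β * (i + 1))) *
              ENNReal.ofReal (|K| * ((2:ℝ) ^ i) ^ (-δ)) := by gcongr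
          _ = _ := by
              rw [← ENNReal.ofReal_mul (by positivity)]
              congr 1
              rw [← Real.rpow_natCast, ← Real.rpow_natCast, ← Real.rpow_mul (by norm_num),
                ← Real.rpow_mul (by norm_num)]
              have e : (2:ℝ) ^ (β * (i + 1)) * (2:ℝ) ^ ((i:ℝ) * -δ) =
                  (2:ℝ) ^ β * (2:ℝ) ^ (-β * (i:ℝ)) := by
                rw [← Real.rpow_add (by norm_num), ← Real.rpow_add (by norm_num)]
                congr 1; rw [hβ]; ring
              linear_combination |K| * e
    _ < ⊤ := by
        have hs : Summable fun i : ℕ => (2:ℝ) ^ β * |K| * ((2:ℝ) ^ (-β)) ^ i := by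
          apply Summable.mul_left
          apply summable_geometric_of_lt_one (by positivity)
          exact Real.rpow_lt_one_of_one_lt_of_neg (by norm_num) (by linarith)
        rw [← ENNReal.ofReal_tsum_of_nonneg (fun i => by positivity) hs]
        exact ENNReal.ofReal_lt_top

lemma mem_cylinder_singleton {a : ℕ} {x : ℝ} :
    x ∈ _root_.cylinder [a] ↔ x ∈ gaussSet ∧ cfDigit1 x = a := by
  rw [mem_cylinder_cons, cylinder_nil]
  exact ⟨fun h => ⟨h.1, h.2.1⟩, fun h => ⟨h.1, h.2, gaussMap_mem h.1⟩⟩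

lemma posWord_singleton (a : ℕ+) : PosWord [(a : ℕ)] := by
  intro b hb
  rw [List.mem_singleton.1 hb]
  exact a.pos

lemma exp_invBranch1_eq_wt (φ : ℝ → ℝ) (a : ℕ) {x : ℝ} :
    Real.exp (φ (invBranch1 a x)) = wt φ [a] x := by
  simp [wt, birkhoff, invBranch]

lemma GibbsSys.tr_momF_le (S : GibbsSys φ μ B θ C) (β : ℝ) {x : ℝ} (hx : x ∈ gaussSet) :
    tr φ (fun y => ENNReal.ofReal (momF β y)) x ≤
      ENNReal.ofReal C * ∫⁻ x, ENNReal.ofReal (momF β x) ∂μ := by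
  have e : ∀ y ∈ gaussSet, ∑' a : ℕ+, (_root_.cylinder [(a : ℕ)]).indicator
      (fun _ => ENNReal.ofReal (((a : ℕ) + 1 : ℝ) ^ β)) y = ENNReal.ofReal (momF β y) := by
    intro y hy
    obtain ⟨d, hd⟩ : ∃ d : ℕ+, (d : ℕ) = cfDigit1 y := ⟨⟨_, cfDigit1_pos hy⟩, rfl⟩
    rw [tsum_eq_single d]
    · rw [indicator_of_mem (mem_cylinder_singleton.2 ⟨hy, hd.symm⟩), hd]; rfl
    · intro b hb
      apply indicator_of_notMem
      intro h
      exact hb (PNat.eq ((mem_cylinder_singleton.1 h).2.symm.trans hd.symm))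
  have e2 : ∫⁻ x, ENNReal.ofReal (momF β x) ∂μ = ∑' a : ℕ+,
      ENNReal.ofReal (((a : ℕ) + 1 : ℝ) ^ β) * μ (_root_.cylinder [(a : ℕ)]) := by
    rw [← lintegral_congr_ae (by filter_upwards [S.ae_mem] with y hy using e y hy),
      lintegral_tsum fun a => (measurable_const.indicator (measurableSet_cylinder _)).aemeasurable]
    congr 1; ext a
    rw [lintegral_indicator (measurableSet_cylinder _), setLIntegral_const]
  rw [e2, ← ENNReal.tsum_mul_left]
  apply ENNReal.tsum_le_tsum
  intro a
  beta_reduce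
  unfold momF
  rw [exp_invBranch1_eq_wt, cfDigit1_invBranch1 _ hx, mul_comm, mul_left_comm]
  gcongr
  rw [← ofReal_measureReal_cyl, ← ENNReal.ofReal_mul S.C_pos.le]
  exact ENNReal.ofReal_le_ofReal (S.gibbs _ (posWord_singleton a) x hx).1

/-! ### The transfer operator on real functions -/

/-- The transfer operator acting on real functions. -/
noncomputable def trR (φ : ℝ → ℝ) (f : ℝ → ℝ) (x : ℝ) : ℝ :=
  ∑' a : ℕ+, Real.exp (φ (invBranch1 a x)) * f (invBranch1 a x)

/-- Summability of the series defining the transfer operator. -/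
def TrSum (φ : ℝ → ℝ) (f : ℝ → ℝ) : Prop :=
  ∀ x ∈ gaussSet, Summable fun a : ℕ+ => Real.exp (φ (invBranch1 a x)) * f (invBranch1 a x)

lemma TrSum.mono {f g : ℝ → ℝ} (hg : TrSum φ g) (h : ∀ x ∈ gaussSet, |f x| ≤ g x) :
    TrSum φ f := by
  intro x hx
  refine Summable.of_norm_bounded (hg x hx) fun a => ?_
  rw [norm_mul, Real.norm_eq_abs, Real.abs_exp]
  exact mul_le_mul_of_nonneg_left (h _ (invBranch1_mem a.pos hx)) (Real.exp_pos _).le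

lemma TrSum.add {f g : ℝ → ℝ} (hf : TrSum φ f) (hg : TrSum φ g) : TrSum φ (fun x => f x + g x) := by
  intro x hx
  simpa only [mul_add] using (hf x hx).add (hg x hx)

lemma TrSum.const_mul {f : ℝ → ℝ} (hf : TrSum φ f) (c : ℝ) : TrSum φ (fun x => c * f x) := by
  intro x hx
  simpa only [mul_left_comm] using (hf x hx).mul_left c

lemma GibbsSys.trSum_const (S : GibbsSys φ μ B θ C) (c : ℝ) : TrSum φ (fun _ => c) :=
  fun x hx => (S.norm x hx).summable.mul_right c

lemma trR_add {f g : ℝ → ℝ} (hf : TrSum φ f) (hg : TrSum φ g) {x : ℝ} (hx : x ∈ gaussSet) :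
    trR φ (fun x => f x + g x) x = trR φ f x + trR φ g x := by
  unfold trR
  simp only [mul_add]
  exact (hf x hx).tsum_add (hg x hx)

lemma trR_const_mul (f : ℝ → ℝ) (c : ℝ) (x : ℝ) :
    trR φ (fun x => c * f x) x = c * trR φ f x := by
  unfold trR
  simp only [mul_left_comm _ c]
  exact tsum_mul_left

lemma GibbsSys.trR_const (S : GibbsSys φ μ B θ C) (c : ℝ) {x : ℝ} (hx : x ∈ gaussSet) :
    trR φ (fun _ => c) x = c := by
  unfold trR
  rw [tsum_mul_right, (S.norm x hx).tsum_eq, one_mul]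

lemma trR_mono {f g : ℝ → ℝ} (hf : TrSum φ f) (hg : TrSum φ g) (h : ∀ x ∈ gaussSet, f x ≤ g x)
    {x : ℝ} (hx : x ∈ gaussSet) : trR φ f x ≤ trR φ g x :=
  (hf x hx).tsum_le_tsum (fun a => mul_le_mul_of_nonneg_left (h _ (invBranch1_mem a.pos hx))
    (Real.exp_pos _).le) (hg x hx)

lemma trR_congr {f g : ℝ → ℝ} (h : ∀ x ∈ gaussSet, f x = g x) {x : ℝ} (hx : x ∈ gaussSet) :
    trR φ f x = trR φ g x := by
  unfold trR
  congr 1; ext a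
  rw [h _ (invBranch1_mem a.pos hx)]

lemma trR_iterate_congr {f g : ℝ → ℝ} (h : ∀ x ∈ gaussSet, f x = g x) (n : ℕ) {x : ℝ}
    (hx : x ∈ gaussSet) : (trR φ)^[n] f x = (trR φ)^[n] g x := by
  induction n generalizing f g with
  | zero => exact h x hx
  | succ n ih => exact ih fun y hy => trR_congr h hy

lemma measurable_trR (hφ : Measurable φ) {f : ℝ → ℝ} (hf : Measurable f) :
    Measurable (trR φ f) :=
  Measurable.tsum fun a : ℕ+ => (Real.measurable_exp.comp
    (hφ.comp (measurable_invBranch1 a))).mul (hf.comp (measurable_invBranch1 a))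

lemma measurable_trR_iterate (hφ : Measurable φ) {f : ℝ → ℝ} (hf : Measurable f) (n : ℕ) :
    Measurable ((trR φ)^[n] f) := by
  induction n generalizing f with
  | zero => exact hf
  | succ n ih => exact ih (measurable_trR hφ hf)

lemma ofReal_trR {f : ℝ → ℝ} (hf : TrSum φ f) (h0 : ∀ x ∈ gaussSet, 0 ≤ f x) {x : ℝ}
    (hx : x ∈ gaussSet) :
    ENNReal.ofReal (trR φ f x) = tr φ (fun y => ENNReal.ofReal (f y)) x := by
  unfold trR tr
  rw [ENNReal.ofReal_tsum_of_nonneg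
    (fun a => mul_nonneg (Real.exp_pos _).le (h0 _ (invBranch1_mem a.pos hx))) (hf x hx)]
  congr 1; ext a
  rw [ENNReal.ofReal_mul (Real.exp_pos _).le]

lemma GibbsSys.integral_trR (S : GibbsSys φ μ B θ C) {f : ℝ → ℝ} (hfm : Measurable f)
    (hf : TrSum φ f) (h0 : ∀ x ∈ gaussSet, 0 ≤ f x) : ∫ x, trR φ f x ∂μ = ∫ x, f x ∂μ := by
  rw [integral_eq_lintegral_of_nonneg_ae, integral_eq_lintegral_of_nonneg_ae]
  · rw [← S.lintegral_tr hfm.ennreal_ofReal]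
    congr 1
    apply lintegral_congr_ae
    filter_upwards [S.ae_mem] with x hx using ofReal_trR hf h0 hx
  · filter_upwards [S.ae_mem] with x hx using h0 x hx
  · exact hfm.aestronglyMeasurable
  · filter_upwards [S.ae_mem] with x hx
    exact tsum_nonneg fun a => mul_nonneg (Real.exp_pos _).le (h0 _ (invBranch1_mem a.pos hx))
  · exact (measurable_trR S.meas hfm).aestronglyMeasurable

lemma GibbsSys.trSum_momF (S : GibbsSys φ μ B θ C) {β : ℝ}
    (hβ : ∫⁻ x, ENNReal.ofReal (momF β x) ∂μ < ⊤) :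
    TrSum φ (momF β) ∧ ∀ x ∈ gaussSet, trR φ (momF β) x ≤
      C * (∫⁻ x, ENNReal.ofReal (momF β x) ∂μ).toReal := by
  have h0 : ∀ x, 0 ≤ momF β x := fun x => by unfold momF; positivity
  have hS : TrSum φ (momF β) := by
    intro x hx
    have h1 := (S.tr_momF_le β hx).trans_lt (ENNReal.mul_lt_top ENNReal.ofReal_lt_top hβ)
    have h2 := ENNReal.summable_toReal h1.ne
    refine h2.congr fun a => ?_
    rw [ENNReal.toReal_mul, ENNReal.toReal_ofReal (Real.exp_pos _).le,
      ENNReal.toReal_ofReal (h0 _)]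
  refine ⟨hS, fun x hx => ?_⟩
  have h1 := S.tr_momF_le β hx
  rw [← ofReal_trR hS (fun x _ => h0 x) hx] at h1
  have h2 := ENNReal.toReal_mono (ENNReal.mul_lt_top ENNReal.ofReal_lt_top hβ).ne h1
  rw [ENNReal.toReal_mul, ENNReal.toReal_ofReal S.C_pos.le] at h2
  rwa [ENNReal.toReal_ofReal] at h2
  exact tsum_nonneg fun a => mul_nonneg (Real.exp_pos _).le (h0 _)

end

/-! ### Contraction of the transfer operator on cones -/

/-- Nonnegative functions with multiplicative Hölder control. -/
def InCone (k₀ : ℕ) (θ b : ℝ) (v : ℝ → ℝ) : Prop :=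
  (∀ x ∈ gaussSet, 0 ≤ v x) ∧ ∀ k, k₀ ≤ k → ∀ x ∈ gaussSet, ∀ y ∈ gaussSet,
    word k x = word k y → v x ≤ Real.exp (b * θ ^ k) * v y

lemma InCone.congr {k₀ : ℕ} {θ b : ℝ} {v w : ℝ → ℝ} (h : InCone k₀ θ b v)
    (hvw : ∀ x ∈ gaussSet, v x = w x) : InCone k₀ θ b w := by
  refine ⟨fun x hx => hvw x hx ▸ h.1 x hx, fun k hk x hx y hy hw => ?_⟩
  rw [← hvw x hx, ← hvw y hy]
  exact h.2 k hk x hx y hy hw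

lemma exists_mem_gaussSet : ∃ x, x ∈ gaussSet := by
  refine ⟨Real.sqrt 2 - 1, ⟨?_, ?_⟩, ?_⟩
  · have : (1:ℝ) ≤ Real.sqrt 2 := by rw [Real.one_le_sqrt]; norm_num
    linarith
  · have : Real.sqrt 2 ≤ 2 := by rw [Real.sqrt_le_left (by norm_num)]; norm_num
    linarith
  · exact_mod_cast irrational_sqrt_two.sub_natCast 1

section
variable {φ : ℝ → ℝ} {μ : Measure ℝ} {B θ C : ℝ} [IsProbabilityMeasure μ]

lemma GibbsSys.trR_mem_cone (S : GibbsSys φ μ B θ C) {k₀ : ℕ} (hk₀ : k₀ ≤ 1) {b : ℝ} {v : ℝ → ℝ}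
    (hv : InCone k₀ θ b v) (hs : TrSum φ v) : InCone 0 θ (θ * (B + b)) (trR φ v) := by
  refine ⟨fun x hx => tsum_nonneg fun a => mul_nonneg (Real.exp_pos _).le
    (hv.1 _ (invBranch1_mem a.pos hx)), fun k _ x hx y hy hw => ?_⟩
  unfold trR
  rw [← tsum_mul_left]
  refine (hs x hx).tsum_le_tsum (fun a => ?_) ((hs y hy).mul_left _)
  have hw' : word (k + 1) (invBranch1 a x) = word (k + 1) (invBranch1 a y) := by
    have e1 := word_invBranch (posWord_singleton a) k hx
    have e2 := word_invBranch (posWord_singleton a) k hy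
    rw [hw] at e1
    have := e1.trans e2.symm
    rwa [List.length_singleton, add_comm] at this
  have mx := invBranch1_mem a.pos hx
  have my := invBranch1_mem a.pos hy
  have h1 := (abs_le.1 (S.holder (k + 1) (by omega) _ mx _ my hw')).2
  have h2 := hv.2 (k + 1) (by omega) _ mx _ my hw'
  calc Real.exp (φ (invBranch1 a x)) * v (invBranch1 a x)
      ≤ Real.exp (B * θ ^ (k + 1) + φ (invBranch1 a y)) *
        (Real.exp (b * θ ^ (k + 1)) * v (invBranch1 a y)) :=
        mul_le_mul (Real.exp_le_exp.2 (by linarith)) h2 (hv.1 _ mx) (Real.exp_pos _).le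
    _ = _ := by
        rw [Real.exp_add, show θ * (B + b) * θ ^ k = B * θ ^ (k + 1) + b * θ ^ (k + 1) by ring,
          Real.exp_add]
        ring

lemma InCone.sub_const {θ b b' c ε : ℝ} {w : ℝ → ℝ} (hθ : 0 ≤ θ) (hθ1 : θ ≤ 1) (hb' : 0 ≤ b')
    (hbb : b' ≤ b) (hw : InCone 0 θ b' w) (hc : 0 ≤ c) (hwc : ∀ x ∈ gaussSet, c ≤ w x)
    (hε : 0 ≤ ε) (hε1 : ε ≤ 1) (hεb : ε * (b * Real.exp b) ≤ b - b') :
    InCone 0 θ b (fun x => w x - ε * c) := by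
  have hb : 0 ≤ b := hb'.trans hbb
  refine ⟨fun x hx => ?_, fun k _ x hx y hy h => ?_⟩
  · have := hwc x hx
    nlinarith
  set t := θ ^ k
  have ht0 : 0 ≤ t := pow_nonneg hθ k
  have ht1 : t ≤ 1 := pow_le_one₀ hθ hθ1
  have h1 : w x ≤ Real.exp (b' * t) * w y := hw.2 k (Nat.zero_le _) x hx y hy h
  have h2 : (b - b') * t ≤ Real.exp (b * t) - Real.exp (b' * t) := by
    have e : Real.exp (b * t) = Real.exp (b' * t) * Real.exp ((b - b') * t) := by
      rw [← Real.exp_add]; ring_nf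
    have h3 := Real.add_one_le_exp ((b - b') * t)
    have h4 : 1 ≤ Real.exp (b' * t) := Real.one_le_exp (by positivity)
    have h5 : 0 ≤ (b - b') * t := mul_nonneg (by linarith) ht0
    rw [e]
    nlinarith
  have h3 : Real.exp (b * t) - 1 ≤ b * t * Real.exp b := by
    have h4 := Real.add_one_le_exp (-(b * t))
    have hp := Real.exp_pos (b * t)
    have h5 := mul_le_mul_of_nonneg_right h4 hp.le
    rw [← Real.exp_add] at h5
    simp only [neg_add_cancel, Real.exp_zero] at h5
    have h6 : Real.exp (b * t) ≤ Real.exp b := Real.exp_le_exp.2 (mul_le_of_le_one_right hb ht1)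
    have h7 : 0 ≤ b * t := by positivity
    nlinarith
  have hy' := hwc y hy
  have h5 : ε * c * (Real.exp (b * t) - 1) ≤ (Real.exp (b * t) - Real.exp (b' * t)) * w y := by
    calc ε * c * (Real.exp (b * t) - 1) ≤ ε * c * (b * t * Real.exp b) := by gcongr
      _ = ε * (b * Real.exp b) * t * c := by ring
      _ ≤ (b - b') * t * c := by gcongr
      _ ≤ (Real.exp (b * t) - Real.exp (b' * t)) * w y :=
        mul_le_mul h2 hy' hc ((mul_nonneg (by linarith) ht0).trans h2)
  linarith

/-- The aperture of the invariant cone. -/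
noncomputable def coneB (B θ : ℝ) : ℝ := 2 * θ * B / (1 - θ)

/-- The contraction rate on the invariant cone. -/
noncomputable def coneEps (B θ : ℝ) : ℝ :=
  (coneB B θ - θ * (B + coneB B θ)) / (coneB B θ * Real.exp (coneB B θ))

lemma GibbsSys.cone_facts (S : GibbsSys φ μ B θ C) : 0 < coneB B θ ∧
    θ * (B + coneB B θ) < coneB B θ ∧ 0 < coneEps B θ ∧ coneEps B θ ≤ 1 ∧
    coneEps B θ * (coneB B θ * Real.exp (coneB B θ)) = coneB B θ - θ * (B + coneB B θ) := by
  have h1 : 0 < 1 - θ := by linarith [S.lt_one]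
  have hθ := S.θ_pos
  have hB := S.B_pos
  have hb : 0 < coneB B θ := by unfold coneB; positivity
  have hlt : θ * (B + coneB B θ) < coneB B θ := by
    have : (1 - θ) * coneB B θ = 2 * θ * B := by unfold coneB; field_simp
    nlinarith [mul_pos hθ hB]
  have he := Real.exp_pos (coneB B θ)
  have he1 : 1 ≤ Real.exp (coneB B θ) := Real.one_le_exp hb.le
  refine ⟨hb, hlt, div_pos (by linarith) (by positivity), ?_, ?_⟩
  · unfold coneEps
    rw [div_le_one (by positivity)]
    have : 0 ≤ θ * (B + coneB B θ) := by positivity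
    nlinarith
  · unfold coneEps; field_simp

lemma GibbsSys.iterate_add_const (S : GibbsSys φ μ B θ C) {M : ℝ} (n : ℕ) {v : ℝ → ℝ} (c : ℝ)
    (hv : ∀ x ∈ gaussSet, |v x| ≤ M) {x : ℝ} (hx : x ∈ gaussSet) :
    (trR φ)^[n] (fun y => v y + c) x = (trR φ)^[n] v x + c := by
  induction n generalizing v with
  | zero => rfl
  | succ n ih =>
    have hs : TrSum φ v := (S.trSum_const M).mono hv
    have hb : ∀ y ∈ gaussSet, |trR φ v y| ≤ M := by
      intro y hy
      rw [abs_le]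
      constructor
      · rw [← S.trR_const (-M) hy]
        exact trR_mono (S.trSum_const _) hs (fun z hz => (abs_le.1 (hv z hz)).1) hy
      · rw [← S.trR_const M hy]
        exact trR_mono hs (S.trSum_const _) (fun z hz => (abs_le.1 (hv z hz)).2) hy
    rw [Function.iterate_succ_apply, Function.iterate_succ_apply, ← ih hb]
    apply trR_iterate_congr _ n hx
    intro y hy
    rw [trR_add hs (S.trSum_const c) hy, S.trR_const c hy]

lemma GibbsSys.trR_bounds (S : GibbsSys φ μ B θ C) {M : ℝ} {v : ℝ → ℝ}
    (hv : ∀ x ∈ gaussSet, 0 ≤ v x ∧ v x ≤ M) {x : ℝ} (hx : x ∈ gaussSet) :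
    0 ≤ trR φ v x ∧ trR φ v x ≤ M := by
  have hs : TrSum φ v := (S.trSum_const M).mono fun y hy => by
    rw [abs_of_nonneg (hv y hy).1]; exact (hv y hy).2
  refine ⟨tsum_nonneg fun a => mul_nonneg (Real.exp_pos _).le
    (hv _ (invBranch1_mem a.pos hx)).1, ?_⟩
  rw [← S.trR_const M hx]
  exact trR_mono hs (S.trSum_const _) (fun z hz => (hv z hz).2) hx

lemma GibbsSys.iterate_bounds (S : GibbsSys φ μ B θ C) {M : ℝ} {v : ℝ → ℝ}
    (hv : ∀ x ∈ gaussSet, 0 ≤ v x ∧ v x ≤ M) (n : ℕ) :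
    ∀ x ∈ gaussSet, 0 ≤ (trR φ)^[n] v x ∧ (trR φ)^[n] v x ≤ M := by
  induction n generalizing v with
  | zero => exact hv
  | succ n ih => exact ih fun y hy => S.trR_bounds hv hy

lemma GibbsSys.iterate_osc (S : GibbsSys φ μ B θ C) (n : ℕ) {M : ℝ} {v : ℝ → ℝ}
    (hv : InCone 0 θ (coneB B θ) v) (hM : ∀ x ∈ gaussSet, v x ≤ M) {x y : ℝ}
    (hx : x ∈ gaussSet) (hy : y ∈ gaussSet) :
    |(trR φ)^[n] v x - (trR φ)^[n] v y| ≤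
      (1 - coneEps B θ * Real.exp (-(2 * coneB B θ))) ^ n * M := by
  obtain ⟨hb, hlt, hε, hε1, hεb⟩ := S.cone_facts
  set b := coneB B θ
  set ε := coneEps B θ
  have hθ := S.θ_pos
  induction n generalizing v M with
  | zero =>
    have h1 := hv.1 x hx
    have h2 := hv.1 y hy
    have h3 := hM x hx
    have h4 := hM y hy
    simp only [Function.iterate_zero, id_eq, pow_zero, one_mul]
    rw [abs_le]; constructor <;> linarith
  | succ n ih =>
    have hbd : ∀ x ∈ gaussSet, 0 ≤ v x ∧ v x ≤ M := fun z hz => ⟨hv.1 z hz, hM z hz⟩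
    have hs : TrSum φ v := (S.trSum_const M).mono fun y hy => by
      rw [abs_of_nonneg (hbd y hy).1]; exact (hbd y hy).2
    have hc1 := S.trR_mem_cone (by norm_num) hv hs
    set w := trR φ v with hw
    obtain ⟨x₀, hx₀⟩ := exists_mem_gaussSet
    have hwb : ∀ z ∈ gaussSet, 0 ≤ w z ∧ w z ≤ M := fun z hz => S.trR_bounds hbd hz
    have hb'0 : 0 ≤ θ * (B + b) := mul_nonneg hθ.le (add_nonneg S.B_pos.le hb.le)
    have hcmp : ∀ z ∈ gaussSet, ∀ z' ∈ gaussSet, w z ≤ Real.exp b * w z' := by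
      intro z hz z' hz'
      refine (hc1.2 0 le_rfl z hz z' hz' rfl).trans ?_
      apply mul_le_mul_of_nonneg_right _ (hwb z' hz').1
      rw [pow_zero, mul_one]
      exact Real.exp_le_exp.2 hlt.le
    set c := Real.exp (-b) * w x₀ with hc
    have hc0 : 0 ≤ c := mul_nonneg (Real.exp_pos _).le (hwb x₀ hx₀).1
    have hex : Real.exp b * Real.exp (-b) = 1 := by rw [← Real.exp_add]; simp
    have hwc : ∀ z ∈ gaussSet, c ≤ w z := by
      intro z hz
      have h1 := mul_le_mul_of_nonneg_left (hcmp x₀ hx₀ z hz) (Real.exp_pos (-b)).le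
      calc c ≤ Real.exp (-b) * (Real.exp b * w z) := h1
        _ = w z := by rw [← mul_assoc, mul_comm (Real.exp (-b)), hex, one_mul]
    have hcone := InCone.sub_const hθ.le S.lt_one.le hb'0 hlt.le hc1 hc0 hwc hε.le hε1 hεb.le
    have hM' : ∀ z ∈ gaussSet, w z - ε * c ≤ (1 - ε * Real.exp (-(2 * b))) * M := by
      intro z hz
      have h1 : w z ≤ Real.exp (2 * b) * c := by
        refine (hcmp z hz x₀ hx₀).trans (le_of_eq ?_)
        rw [hc, ← mul_assoc, ← Real.exp_add]; ring_nf
      have h2 := (hwb z hz).2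
      set e := Real.exp (-(2 * b)) with he
      have hep : 0 < e := Real.exp_pos _
      have h3 : e * w z ≤ c := by
        have := mul_le_mul_of_nonneg_left h1 hep.le
        rwa [← mul_assoc, he, ← Real.exp_add, neg_add_cancel, Real.exp_zero, one_mul] at this
      have he1 : e ≤ 1 := Real.exp_le_one_iff.2 (by linarith)
      have h4 : ε * (e * w z) ≤ ε * c := mul_le_mul_of_nonneg_left h3 hε.le
      have h5 : 0 ≤ 1 - ε * e := by nlinarith
      nlinarith
    have key := ih hM' hcone
    have e1 : ∀ z ∈ gaussSet, (trR φ)^[n + 1] v z =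
        (trR φ)^[n] (fun y => w y - ε * c) z + ε * c := by
      intro z hz
      rw [Function.iterate_succ_apply, ← S.iterate_add_const n (v := fun y => w y - ε * c)
        (M := M + |ε * c|) (ε * c) ?_ hz]
      · simp only [sub_add_cancel]; rfl
      · intro y hy
        refine (abs_sub _ _).trans ?_
        rw [abs_of_nonneg (hwb y hy).1]
        linarith [(hwb y hy).2]
    rw [e1 x hx, e1 y hy, pow_succ, mul_assoc]
    simpa using key

end

/-! ### Large deviations of Birkhoff sums -/

lemma InCone.mono {k₀ : ℕ} {θ b b' : ℝ} {v : ℝ → ℝ} (hθ : 0 ≤ θ) (hb : b ≤ b')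
    (h : InCone k₀ θ b v) : InCone k₀ θ b' v := by
  refine ⟨h.1, fun k hk x hx y hy hw => (h.2 k hk x hx y hy hw).trans ?_⟩
  exact mul_le_mul_of_nonneg_right
    (Real.exp_le_exp.2 (mul_le_mul_of_nonneg_right hb (pow_nonneg hθ k))) (h.1 y hy)

section
variable {φ : ℝ → ℝ} {μ : Measure ℝ} {B θ C : ℝ} [IsProbabilityMeasure μ]

lemma GibbsSys.integral_trR_iterate (S : GibbsSys φ μ B θ C) {M : ℝ} (n : ℕ) {v : ℝ → ℝ}
    (hvm : Measurable v) (hv : ∀ x ∈ gaussSet, 0 ≤ v x ∧ v x ≤ M) :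
    ∫ x, (trR φ)^[n] v x ∂μ = ∫ x, v x ∂μ := by
  induction n generalizing v with
  | zero => rfl
  | succ n ih =>
    have hs : TrSum φ v := (S.trSum_const M).mono fun y hy => by
      rw [abs_of_nonneg (hv y hy).1]; exact (hv y hy).2
    rw [← S.integral_trR hvm hs fun x hx => (hv x hx).1,
      ← ih (measurable_trR S.meas hvm) fun y hy => S.trR_bounds hv hy]
    rfl

lemma GibbsSys.exists_telescope (S : GibbsSys φ μ B θ C) {M : ℝ} {v : ℝ → ℝ}
    (hvm : Measurable v) (hv : ∀ x ∈ gaussSet, 0 ≤ v x ∧ v x ≤ M) (N : ℕ) :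
    ∃ w : ℝ → ℝ, Measurable w ∧ (∀ x ∈ gaussSet, 0 ≤ w x ∧ w x ≤ N * M) ∧
      ∀ x ∈ gaussSet, trR φ w x = w x - v x + (trR φ)^[N] v x := by
  induction N with
  | zero =>
    refine ⟨fun _ => 0, measurable_const, fun x hx => by simp, fun x hx => ?_⟩
    rw [S.trR_const 0 hx]; simp
  | succ N ih =>
    obtain ⟨w, hwm, hwb, hw⟩ := ih
    have hb := S.iterate_bounds hv N
    have hs : TrSum φ w := (S.trSum_const (N * M)).mono fun y hy => by
      rw [abs_of_nonneg (hwb y hy).1]; exact (hwb y hy).2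
    have hs' : TrSum φ ((trR φ)^[N] v) := (S.trSum_const M).mono fun y hy => by
      rw [abs_of_nonneg (hb y hy).1]; exact (hb y hy).2
    refine ⟨fun x => w x + (trR φ)^[N] v x, hwm.add (measurable_trR_iterate S.meas hvm N),
      fun x hx => ⟨add_nonneg (hwb x hx).1 (hb x hx).1, ?_⟩, fun x hx => ?_⟩
    · push_cast
      linarith [(hwb x hx).2, (hb x hx).2]
    · rw [trR_add hs hs' hx, hw x hx, ← Function.iterate_succ_apply' (trR φ)]
      ring

/-- A function with negative mean is, up to a coboundary of the transfer operator, uniformly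
negative. -/
lemma GibbsSys.exists_coboundary (S : GibbsSys φ μ B θ C) {f g : ℝ → ℝ} {A K Bf : ℝ}
    (hfm : Measurable f) (hg : TrSum φ g)
    (hgK : ∀ x ∈ gaussSet, trR φ g x ≤ K) (hgi : Integrable g μ)
    (hfg : ∀ x ∈ gaussSet, |f x| ≤ g x) (hA : 0 ≤ A) (hlo : ∀ x ∈ gaussSet, -A ≤ f x)
    (hBf : 0 < Bf)
    (hol : ∀ k, 0 < k → ∀ x ∈ gaussSet, ∀ y ∈ gaussSet, word k x = word k y →
      |f x - f y| ≤ Bf * θ ^ k) (hneg : ∫ x, f x ∂μ < 0) :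
    ∃ w : ℝ → ℝ, ∃ V > 0, ∃ κ > 0, Measurable w ∧ (∀ x ∈ gaussSet, 0 ≤ w x ∧ w x ≤ V) ∧
      ∀ x ∈ gaussSet, trR φ f x + trR φ w x ≤ w x - κ := by
  obtain ⟨hb, hlt, hε, hε1, hεb⟩ := S.cone_facts
  set b := coneB B θ with hbdef
  have hθ := S.θ_pos
  set A' := A + Bf / b with hA'
  have hBb : 0 < Bf / b := by positivity
  set F : ℝ → ℝ := fun x => f x + A' with hF
  have hFlo : ∀ x ∈ gaussSet, Bf / b ≤ F x := fun x hx => by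
    have := hlo x hx; simp only [hF]; linarith
  have hFcone : InCone 1 θ b F := by
    refine ⟨fun x hx => hBb.le.trans (hFlo x hx), fun k hk x hx y hy hw => ?_⟩
    have h1 := (abs_le.1 (hol k hk x hx y hy hw)).2
    have h2 := hFlo y hy
    have h3 := Real.add_one_le_exp (b * θ ^ k)
    have h4 : 0 ≤ θ ^ k := by positivity
    have h5 : Bf ≤ F y * b := (div_le_iff₀ hb).1 h2
    have h6 : Bf * θ ^ k ≤ F y * b * θ ^ k := mul_le_mul_of_nonneg_right h5 h4
    have h7 : F x ≤ F y + Bf * θ ^ k := by simp only [hF]; linarith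
    have h8 := mul_le_mul_of_nonneg_right h3 (hBb.le.trans h2)
    linarith
  have hfs : TrSum φ f := hg.mono hfg
  have hFs : TrSum φ F := hfs.add (S.trSum_const A')
  set v := trR φ F with hv
  have hvx : ∀ x ∈ gaussSet, v x = trR φ f x + A' := fun x hx => by
    rw [hv, trR_add hfs (S.trSum_const A') hx, S.trR_const A' hx]
  have hFm : Measurable F := hfm.add_const A'
  have hvm : Measurable v := measurable_trR S.meas hFm
  have hvc : InCone 0 θ b v := (S.trR_mem_cone le_rfl hFcone hFs).mono hθ.le hlt.le
  set M := |K| + A' with hM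
  have hA'0 : 0 < A' := by linarith
  have hM0 : 0 < M := by have := abs_nonneg K; linarith
  have hvM : ∀ x ∈ gaussSet, v x ≤ M := fun x hx => by
    rw [hvx x hx]
    have h1 := trR_mono hfs hg (fun z hz => (le_abs_self _).trans (hfg z hz)) hx
    have h2 := hgK x hx
    have h3 := le_abs_self K
    linarith
  have hvb : ∀ x ∈ gaussSet, 0 ≤ v x ∧ v x ≤ M := fun x hx => ⟨hvc.1 x hx, hvM x hx⟩
  have hfi : Integrable f μ := hgi.mono' hfm.aestronglyMeasurable (by
    filter_upwards [S.ae_mem] with x hx using hfg x hx)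
  have hvint : ∫ x, v x ∂μ = ∫ x, f x ∂μ + A' := by
    rw [hv, S.integral_trR hFm hFs fun x hx => hFcone.1 x hx]
    simp only [hF]
    rw [integral_add hfi (integrable_const _)]
    simp
  set r := 1 - coneEps B θ * Real.exp (-(2 * b)) with hr
  have hr1 : r < 1 := by
    have : 0 < coneEps B θ * Real.exp (-(2 * b)) := by positivity
    linarith
  have hr0 : 0 ≤ r := by
    have h1 : Real.exp (-(2 * b)) ≤ 1 := Real.exp_le_one_iff.2 (by linarith)
    have h2 : 0 < Real.exp (-(2 * b)) := Real.exp_pos _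
    nlinarith
  set κ := -(∫ x, f x ∂μ) / 2 with hκ
  have hκ0 : 0 < κ := by linarith
  obtain ⟨N, hN⟩ := exists_pow_lt_of_lt_one (show 0 < κ / M by positivity) hr1
  rw [lt_div_iff₀ hM0] at hN
  have hLN : ∀ x ∈ gaussSet, (trR φ)^[N] v x ≤ A' - κ := by
    intro x hx
    have hintegr : ∫ x, (trR φ)^[N] v x ∂μ = ∫ x, f x ∂μ + A' := by
      rw [S.integral_trR_iterate N hvm hvb, hvint]
    have hbd := S.iterate_bounds hvb N
    have hi : Integrable ((trR φ)^[N] v) μ :=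
      (integrable_const M).mono' (measurable_trR_iterate S.meas hvm N).aestronglyMeasurable (by
        filter_upwards [S.ae_mem] with y hy
        rw [Real.norm_eq_abs, abs_of_nonneg (hbd y hy).1]; exact (hbd y hy).2)
    have h1 : (trR φ)^[N] v x - κ ≤ ∫ y, (trR φ)^[N] v y ∂μ := by
      have : ∫ _, ((trR φ)^[N] v x - κ) ∂μ ≤ ∫ y, (trR φ)^[N] v y ∂μ := by
        apply integral_mono_ae (integrable_const _) hi
        filter_upwards [S.ae_mem] with y hy
        have := (abs_le.1 (S.iterate_osc N hvc hvM hx hy)).2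
        linarith
      simpa using this
    linarith
  obtain ⟨w, hwm, hwb, hw⟩ := S.exists_telescope hvm hvb N
  refine ⟨w, N * M + 1, by positivity, κ, hκ0, hwm,
    fun x hx => ⟨(hwb x hx).1, by linarith [(hwb x hx).2]⟩, fun x hx => ?_⟩
  rw [hw x hx, hvx x hx]
  linarith [hLN x hx]

lemma exp_le_quadratic (z : ℝ) : Real.exp z ≤ 1 + z + z ^ 2 * Real.exp |z| := by
  have h := Complex.norm_exp_sub_sum_le_norm_mul_exp (z : ℂ) 2
  have e : Complex.exp (z : ℂ) - ∑ m ∈ Finset.range 2, (z : ℂ) ^ m / (m.factorial : ℂ) =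
      ((Real.exp z - (1 + z) : ℝ) : ℂ) := by
    simp [Finset.sum_range_succ]
  rw [e, Complex.norm_real, Complex.norm_real, Real.norm_eq_abs, Real.norm_eq_abs, sq_abs] at h
  have := (abs_le.1 h).2
  linarith

lemma momF_eq_pow {β : ℝ} (x : ℝ) : momF β x = (momF (β / 4) x) ^ 4 := by
  unfold momF
  rw [← Real.rpow_natCast, ← Real.rpow_mul (by positivity)]
  congr 1
  push_cast; ring

lemma log_le_momF {β : ℝ} (hβ : 0 < β) (x : ℝ) :
    Real.log ((cfDigit1 x : ℝ) + 1) ≤ momF β x / β :=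
  Real.log_le_rpow_div (by positivity) hβ

lemma exp_growth_le {A t β : ℝ} (ht : t * A ≤ β) (ht0 : 0 ≤ t) {x u : ℝ}
    (hu : u ≤ A * (1 + Real.log ((cfDigit1 x : ℝ) + 1))) :
    Real.exp (t * u) ≤ Real.exp β * momF β x := by
  have hl : 0 ≤ Real.log ((cfDigit1 x : ℝ) + 1) := Real.log_nonneg (by simp)
  unfold momF
  rw [Real.rpow_def_of_pos (by positivity), ← Real.exp_add]
  apply Real.exp_le_exp.2
  calc t * u ≤ t * (A * (1 + Real.log ((cfDigit1 x : ℝ) + 1))) :=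
        mul_le_mul_of_nonneg_left hu ht0
    _ = (t * A) * (1 + Real.log ((cfDigit1 x : ℝ) + 1)) := by ring
    _ ≤ β * (1 + Real.log ((cfDigit1 x : ℝ) + 1)) :=
        mul_le_mul_of_nonneg_right ht (by linarith)
    _ = _ := by ring

lemma GibbsSys.exists_eigen (S : GibbsSys φ μ B θ C) {β : ℝ} (hβ : 0 < β)
    (hm : ∫⁻ x, ENNReal.ofReal (momF β x) ∂μ < ⊤) {f : ℝ → ℝ} {A Bf : ℝ} (hfm : Measurable f)
    (hA : 0 < A) (hup : ∀ x ∈ gaussSet, |f x| ≤ A * (1 + Real.log ((cfDigit1 x : ℝ) + 1)))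
    (hlo : ∀ x ∈ gaussSet, -A ≤ f x) (hBf : 0 < Bf)
    (hol : ∀ k, 0 < k → ∀ x ∈ gaussSet, ∀ y ∈ gaussSet, word k x = word k y →
      |f x - f y| ≤ Bf * θ ^ k) (hneg : ∫ x, f x ∂μ < 0) :
    ∃ t > 0, ∃ ρ ∈ Set.Ioo (0:ℝ) 1, ∃ H : ℝ → ℝ, Measurable H ∧
      (∀ x ∈ gaussSet, 1 ≤ H x ∧ H x ≤ 2) ∧
      ∀ x ∈ gaussSet, tr φ (fun y => ENNReal.ofReal (Real.exp (t * f y) * H y)) x ≤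
        ENNReal.ofReal ρ * ENNReal.ofReal (H x) := by
  obtain ⟨hgs, hgK⟩ := S.trSum_momF hm
  set Kg := C * (∫⁻ x, ENNReal.ofReal (momF β x) ∂μ).toReal with hKg
  have hKg0 : 0 ≤ Kg := mul_nonneg S.C_pos.le ENNReal.toReal_nonneg
  have hgi : Integrable (momF β) μ := by
    refine ⟨(measurable_momF β).aestronglyMeasurable, ?_⟩
    rw [hasFiniteIntegral_iff_ofReal (ae_of_all _ fun x => zero_le_one.trans (one_le_momF hβ.le x))]
    exact hm
  have hβ4 : 0 < β / 4 := by positivity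
  set p := momF (β / 4) with hp
  have hp1 : ∀ x, 1 ≤ p x := one_le_momF hβ4.le
  have hg4 : ∀ x, momF β x = p x ^ 4 := momF_eq_pow
  set K := A * (1 + 1 / (β / 4)) with hK
  have hK0 : 0 < K := by positivity
  have hfp : ∀ x ∈ gaussSet, |f x| ≤ K * p x := by
    intro x hx
    have h1 : Real.log ((cfDigit1 x : ℝ) + 1) ≤ p x / (β / 4) := log_le_momF hβ4 x
    calc |f x| ≤ A * (1 + Real.log ((cfDigit1 x : ℝ) + 1)) := hup x hx
      _ ≤ A * (p x + p x / (β / 4)) :=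
        mul_le_mul_of_nonneg_left (add_le_add (hp1 x) h1) hA.le
      _ = K * p x := by rw [hK]; ring
  have hfg : ∀ x ∈ gaussSet, |f x| ≤ K * momF β x := fun x hx => by
    refine (hfp x hx).trans (mul_le_mul_of_nonneg_left ?_ hK0.le)
    rw [hg4]
    exact le_self_pow₀ (hp1 x) (by norm_num)
  obtain ⟨w, V, hV, κ, hκ, hwm, hwb, hw⟩ := S.exists_coboundary (g := fun x => K * momF β x)
    (K := K * Kg) hfm (hgs.const_mul K)
    (fun x hx => by rw [trR_const_mul]; exact mul_le_mul_of_nonneg_left (hgK x hx) hK0.le)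
    (hgi.const_mul K) hfg hA.le hlo hBf hol hneg
  set D := V * K + 2 * (K ^ 2 * Real.exp (β / 4)) with hD
  have hD0 : 0 < D := by positivity
  obtain ⟨t, ht0, ht1, ht2, ht3, ht4⟩ : ∃ t > 0, t * A ≤ β / 4 ∧ t * V ≤ 1 ∧
      t * (D * Kg) ≤ κ / 2 ∧ t * κ ≤ 1 := by
    refine ⟨min (min (β / 4 / A) (1 / V)) (min (κ / 2 / (D * Kg + 1)) (1 / κ)), by positivity,
      ?_, ?_, ?_, ?_⟩
    · rw [← le_div_iff₀ hA]; exact (min_le_left _ _).trans (min_le_left _ _)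
    · rw [← le_div_iff₀ hV]; exact (min_le_left _ _).trans (min_le_right _ _)
    · have h0 : 0 < D * Kg + 1 := by positivity
      have h1 : min (min (β / 4 / A) (1 / V)) (min (κ / 2 / (D * Kg + 1)) (1 / κ)) ≤
        κ / 2 / (D * Kg + 1) := (min_le_right _ _).trans (min_le_left _ _)
      rw [le_div_iff₀ h0] at h1
      refine le_trans (mul_le_mul_of_nonneg_left (by linarith) (by positivity)) h1
    · rw [← le_div_iff₀ hκ]; exact (min_le_right _ _).trans (min_le_right _ _)
  set H : ℝ → ℝ := fun x => 1 + t * w x with hH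
  have hHb : ∀ x ∈ gaussSet, 1 ≤ H x ∧ H x ≤ 2 := fun x hx => by
    have h1 := mul_nonneg ht0.le (hwb x hx).1
    have h2 := mul_le_mul_of_nonneg_left (hwb x hx).2 ht0.le
    simp only [hH]
    constructor <;> linarith
  set G : ℝ → ℝ := fun x => (1 + t * (f x + w x)) + t ^ 2 * D * momF β x with hG
  have hpt : ∀ x ∈ gaussSet, Real.exp (t * f x) * H x ≤ G x := by
    intro x hx
    have hpx := hp1 x
    have h1 := exp_le_quadratic (t * f x)
    have h2 : Real.exp |t * f x| ≤ Real.exp (β / 4) * p x := by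
      rw [abs_mul, abs_of_pos ht0]
      exact exp_growth_le ht1 ht0.le (hup x hx)
    have hf2 : f x ^ 2 ≤ K ^ 2 * p x ^ 2 := by
      rw [← sq_abs, ← mul_pow]
      exact pow_le_pow_left₀ (abs_nonneg _) (hfp x hx) 2
    have h3 : (t * f x) ^ 2 * Real.exp |t * f x| ≤
        t ^ 2 * (K ^ 2 * Real.exp (β / 4)) * p x ^ 3 := by
      calc (t * f x) ^ 2 * Real.exp |t * f x|
          = t ^ 2 * (f x ^ 2 * Real.exp |t * f x|) := by ring
        _ ≤ t ^ 2 * ((K ^ 2 * p x ^ 2) * (Real.exp (β / 4) * p x)) :=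
          mul_le_mul_of_nonneg_left (mul_le_mul hf2 h2 (Real.exp_pos _).le (by positivity))
            (by positivity)
        _ = _ := by ring
    have hp3 : p x ^ 3 ≤ momF β x := by
      rw [hg4]; exact pow_le_pow_right₀ hpx (by norm_num)
    have hp4 : p x ≤ momF β x := by rw [hg4]; exact le_self_pow₀ hpx (by norm_num)
    have hHx := hHb x hx
    have h4 : Real.exp (t * f x) ≤ 1 + t * f x + t ^ 2 * (K ^ 2 * Real.exp (β / 4)) * momF β x := by
      have := mul_le_mul_of_nonneg_left hp3
        (show 0 ≤ t ^ 2 * (K ^ 2 * Real.exp (β / 4)) by positivity)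
      linarith
    have h5 : f x * w x ≤ K * momF β x * V := by
      calc f x * w x ≤ |f x| * w x := mul_le_mul_of_nonneg_right (le_abs_self _) (hwb x hx).1
        _ ≤ K * momF β x * V := mul_le_mul (hfg x hx) (hwb x hx).2 (hwb x hx).1
            ((abs_nonneg _).trans (hfg x hx))
    have hm0 : 0 ≤ t ^ 2 * (K ^ 2 * Real.exp (β / 4)) * momF β x := by
      have := zero_le_one.trans (one_le_momF hβ.le x)
      positivity
    calc Real.exp (t * f x) * H x
        ≤ (1 + t * f x + t ^ 2 * (K ^ 2 * Real.exp (β / 4)) * momF β x) * H x :=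
          mul_le_mul_of_nonneg_right h4 (by linarith)
      _ = (1 + t * (f x + w x)) + t ^ 2 * (f x * w x) +
          t ^ 2 * (K ^ 2 * Real.exp (β / 4)) * momF β x * H x := by simp only [hH]; ring
      _ ≤ (1 + t * (f x + w x)) + t ^ 2 * (K * momF β x * V) +
          t ^ 2 * (K ^ 2 * Real.exp (β / 4)) * momF β x * 2 := by
        have a1 := mul_le_mul_of_nonneg_left h5 (sq_nonneg t)
        have a2 := mul_le_mul_of_nonneg_left hHx.2 hm0
        linarith
      _ = G x := by simp only [hG, hD]; ring
  have hfs : TrSum φ f := (hgs.const_mul K).mono hfg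
  have hws : TrSum φ w := (S.trSum_const V).mono fun y hy => by
    rw [abs_of_nonneg (hwb y hy).1]; exact (hwb y hy).2
  have hGs1 : TrSum φ (fun x => t * (f x + w x)) := (hfs.add hws).const_mul t
  have hGs2 : TrSum φ (fun x => t ^ 2 * D * momF β x) := hgs.const_mul _
  have hGs : TrSum φ G := ((S.trSum_const 1).add hGs1).add hGs2
  have hLG : ∀ x ∈ gaussSet, trR φ G x ≤ (1 - t * κ / 4) * H x := by
    intro x hx
    have e : trR φ G x = 1 + t * (trR φ f x + trR φ w x) + t ^ 2 * D * trR φ (momF β) x := by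
      rw [hG, trR_add ((S.trSum_const 1).add hGs1) hGs2 hx, trR_add (S.trSum_const 1) hGs1 hx,
        S.trR_const 1 hx, trR_const_mul, trR_const_mul, trR_add hfs hws hx]
    rw [e]
    have h1 := mul_le_mul_of_nonneg_left (hw x hx) ht0.le
    have h2 := mul_le_mul_of_nonneg_left (hgK x hx) (show 0 ≤ t ^ 2 * D by positivity)
    have h3 := mul_le_mul_of_nonneg_left ht3 ht0.le
    have h4 := mul_le_mul_of_nonneg_left (hHb x hx).2 (show 0 ≤ t * κ / 4 by positivity)
    have h5 : H x = 1 + t * w x := rfl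
    nlinarith
  have htκ : 0 < t * κ := by positivity
  refine ⟨t, ht0, 1 - t * κ / 4, ⟨by linarith, by linarith⟩, H, (hwm.const_mul t).const_add 1, hHb,
    fun x hx => ?_⟩
  rw [← ENNReal.ofReal_mul (by linarith)]
  have hG0 : ∀ y ∈ gaussSet, 0 ≤ Real.exp (t * f y) * H y := fun y hy =>
    mul_nonneg (Real.exp_pos _).le (by linarith [(hHb y hy).1])
  have hHs : TrSum φ (fun y => Real.exp (t * f y) * H y) := hGs.mono fun y hy => by
    rw [abs_of_nonneg (hG0 y hy)]; exact hpt y hy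
  rw [← ofReal_trR hHs hG0 hx]
  exact ENNReal.ofReal_le_ofReal ((trR_mono hHs hGs hpt hx).trans (hLG x hx))

/-- Exponential large deviation estimate for observables with negative mean. -/
lemma GibbsSys.large_dev (S : GibbsSys φ μ B θ C) {β : ℝ} (hβ : 0 < β)
    (hm : ∫⁻ x, ENNReal.ofReal (momF β x) ∂μ < ⊤) {f : ℝ → ℝ} {A Bf : ℝ} (hfm : Measurable f)
    (hA : 0 < A) (hup : ∀ x ∈ gaussSet, |f x| ≤ A * (1 + Real.log ((cfDigit1 x : ℝ) + 1)))
    (hlo : ∀ x ∈ gaussSet, -A ≤ f x) (hBf : 0 < Bf)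
    (hol : ∀ k, 0 < k → ∀ x ∈ gaussSet, ∀ y ∈ gaussSet, word k x = word k y →
      |f x - f y| ≤ Bf * θ ^ k) (hneg : ∫ x, f x ∂μ < 0) :
    ∃ t > 0, ∃ ρ ∈ Set.Ioo (0:ℝ) 1, ∀ (n : ℕ) (c : ℝ),
      μ.real {x | x ∈ gaussSet ∧ -c ≤ birkhoff f n x} ≤ 2 * Real.exp (t * c) * ρ ^ n := by
  obtain ⟨t, ht, ρ, hρ, H, hHm, hHb, hH⟩ := S.exists_eigen hβ hm hfm hA hup hlo hBf hol hneg
  refine ⟨t, ht, ρ, hρ, fun n c => ?_⟩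
  set E : ℕ → ℝ → ℝ≥0∞ := fun n x => ENNReal.ofReal (Real.exp (t * birkhoff f n x)) with hE
  have hEm : ∀ n, Measurable (E n) := fun n =>
    (Real.measurable_exp.comp ((measurable_birkhoff hfm n).const_mul t)).ennreal_ofReal
  have hJ : ∀ n, ∫⁻ x, ENNReal.ofReal (H x) * E n x ∂μ ≤ ENNReal.ofReal (2 * ρ ^ n) := by
    intro n
    induction n with
    | zero =>
      calc ∫⁻ x, ENNReal.ofReal (H x) * E 0 x ∂μ ≤ ∫⁻ _, ENNReal.ofReal 2 ∂μ := by
            apply lintegral_mono_ae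
            filter_upwards [S.ae_mem] with x hx
            simp only [hE, birkhoff, Finset.range_zero, Finset.sum_empty, mul_zero, Real.exp_zero,
              ENNReal.ofReal_one, mul_one]
            exact ENNReal.ofReal_le_ofReal (hHb x hx).2
        _ = _ := by simp
    | succ n ih =>
      have e1 : ∀ᵐ x ∂μ, ENNReal.ofReal (H x) * E (n + 1) x =
          ENNReal.ofReal (Real.exp (t * f x) * H x) * E n (gaussMap x) := by
        filter_upwards [S.ae_mem] with x hx
        simp only [hE]
        rw [birkhoff_succ, mul_add, Real.exp_add, ← ENNReal.ofReal_mul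
          (by linarith [(hHb x hx).1]), ← ENNReal.ofReal_mul
          (mul_nonneg (Real.exp_pos _).le (by linarith [(hHb x hx).1]))]
        congr 1; ring
      have hmm : Measurable fun x => ENNReal.ofReal (Real.exp (t * f x) * H x) :=
        ((Real.measurable_exp.comp (hfm.const_mul t)).mul hHm).ennreal_ofReal
      rw [lintegral_congr_ae e1, ← S.lintegral_tr (f := fun x => ENNReal.ofReal (Real.exp (t * f x) * H x) * E n (gaussMap x))
        (hmm.mul ((hEm n).comp measurable_gaussMap))]
      calc _ ≤ ∫⁻ x, ENNReal.ofReal ρ * (ENNReal.ofReal (H x) * E n x) ∂μ := by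
            apply lintegral_mono_ae
            filter_upwards [S.ae_mem] with x hx
            refine (le_of_eq (tr_mul_comp _ _ hx)).trans ?_
            rw [← mul_assoc]
            exact mul_le_mul_left (hH x hx) _
        _ = ENNReal.ofReal ρ * ∫⁻ x, ENNReal.ofReal (H x) * E n x ∂μ :=
            lintegral_const_mul _ (hHm.ennreal_ofReal.mul (hEm n))
        _ ≤ ENNReal.ofReal ρ * ENNReal.ofReal (2 * ρ ^ n) := mul_le_mul_right ih _
        _ = _ := by
            rw [← ENNReal.ofReal_mul hρ.1.le]; congr 1; ring
  have h1 : ENNReal.ofReal (Real.exp (-(t * c))) *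
      μ {x | x ∈ gaussSet ∧ -c ≤ birkhoff f n x} ≤ ENNReal.ofReal (2 * ρ ^ n) := by
    refine le_trans ?_ (hJ n)
    rw [← setLIntegral_const]
    refine le_trans (lintegral_mono_ae ?_) (setLIntegral_le_lintegral
      {x | x ∈ gaussSet ∧ -c ≤ birkhoff f n x} _)
    have hms : MeasurableSet {x | x ∈ gaussSet ∧ -c ≤ birkhoff f n x} :=
      measurableSet_gaussSet.inter (measurableSet_le measurable_const (measurable_birkhoff hfm n))
    filter_upwards [ae_restrict_mem hms] with x hx
    simp only [hE]
    rw [← ENNReal.ofReal_mul (by linarith [(hHb x hx.1).1])]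
    apply ENNReal.ofReal_le_ofReal
    have h2 : Real.exp (-(t * c)) ≤ Real.exp (t * birkhoff f n x) := by
      apply Real.exp_le_exp.2
      have := mul_le_mul_of_nonneg_left hx.2 ht.le
      linarith
    nlinarith [Real.exp_pos (t * birkhoff f n x), (hHb x hx.1).1]
  have h2 := ENNReal.toReal_mono ENNReal.ofReal_ne_top h1
  rw [ENNReal.toReal_mul, ENNReal.toReal_ofReal (Real.exp_pos _).le,
    ENNReal.toReal_ofReal (by have := hρ.1; positivity)] at h2
  have h3 := mul_le_mul_of_nonneg_left h2 (Real.exp_pos (t * c)).le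
  rw [← mul_assoc, ← Real.exp_add, add_neg_cancel, Real.exp_zero, one_mul] at h3
  calc _ ≤ _ := h3
    _ = _ := by ring

end

/-! ### Entropy, Lyapunov exponent and regular words -/

lemma logAbsDerivGauss_eq (x : ℝ) : logAbsDerivGauss x = -2 * Real.log x := by
  unfold logAbsDerivGauss
  rw [one_div, Real.log_inv, Real.log_pow]; push_cast; ring

lemma measurable_logAbsDerivGauss : Measurable logAbsDerivGauss := by
  unfold logAbsDerivGauss
  exact Real.measurable_log.comp (by fun_prop)

lemma logAbsDerivGauss_nonneg {x : ℝ} (hx : x ∈ gaussSet) : 0 ≤ logAbsDerivGauss x := by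
  rw [logAbsDerivGauss_eq x]
  have := Real.log_nonpos (gaussSet_pos hx).le (gaussSet_lt_one hx).le
  linarith

lemma digit_add_gaussMap {x : ℝ} (hx : x ∈ gaussSet) :
    gaussMap x + cfDigit1 x = x⁻¹ := by
  have := invBranch1_cfDigit1 hx
  unfold invBranch1 at this
  rw [← this, inv_inv, this]

lemma logAbsDerivGauss_le {x : ℝ} (hx : x ∈ gaussSet) :
    logAbsDerivGauss x ≤ 2 * Real.log ((cfDigit1 x : ℝ) + 1) := by
  rw [logAbsDerivGauss_eq x]
  have h1 := digit_add_gaussMap hx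
  have h2 := gaussSet_lt_one (gaussMap_mem hx)
  have h3 : Real.log x⁻¹ ≤ Real.log ((cfDigit1 x : ℝ) + 1) :=
    Real.log_le_log (inv_pos.2 (gaussSet_pos hx)) (by linarith)
  rw [Real.log_inv] at h3
  linarith

lemma abs_log_sub_log_le {u v : ℝ} (hu : 1 ≤ u) (hv : 1 ≤ v) :
    |Real.log u - Real.log v| ≤ |u - v| := by
  have key : ∀ a b : ℝ, 1 ≤ a → 1 ≤ b → Real.log a - Real.log b ≤ |a - b| := by
    intro a b ha hb
    rw [← Real.log_div (by linarith) (by linarith)]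
    have h1 := Real.log_le_sub_one_of_pos (show 0 < a / b by positivity)
    have h2 : a / b - 1 = (a - b) / b := by field_simp
    rw [h2] at h1
    refine h1.trans ?_
    rw [div_le_iff₀ (by linarith)]
    have h3 := le_abs_self (a - b)
    nlinarith [abs_nonneg (a - b)]
  rw [abs_le]
  constructor
  · have := key v u hv hu
    rw [abs_sub_comm] at this; linarith
  · exact key u v hu hv

lemma abs_logAbsDerivGauss_sub_le {k : ℕ} (hk : 0 < k) {x y : ℝ} (hx : x ∈ gaussSet)
    (hy : y ∈ gaussSet) (h : word k x = word k y) :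
    |logAbsDerivGauss x - logAbsDerivGauss y| ≤ 8 * (1 / 2) ^ k := by
  obtain ⟨j, rfl⟩ : ∃ j, k = j + 1 := ⟨k - 1, by omega⟩
  simp only [word, List.cons.injEq] at h
  obtain ⟨h1, h2⟩ := h
  have mx := gaussMap_mem hx
  have my := gaussMap_mem hy
  have ex := invBranch_iterate (mem_cylinder_word j mx)
  have ey := invBranch_iterate (mem_cylinder_word j my)
  rw [length_word] at ex ey
  have ix := iterate_mem mx j
  have iy := iterate_mem my j
  have h3 := abs_invBranch_sub_le_two_pow (posWord_word j mx) (gaussSet_pos ix).le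
    (gaussSet_pos iy).le (gaussSet_lt_one ix).le (gaussSet_lt_one iy).le
  rw [ex, h2, ey, length_word] at h3
  have dx := digit_add_gaussMap hx
  have dy := digit_add_gaussMap hy
  have px := one_le_inv_iff₀.2 ⟨gaussSet_pos hx, (gaussSet_lt_one hx).le⟩
  have py := one_le_inv_iff₀.2 ⟨gaussSet_pos hy, (gaussSet_lt_one hy).le⟩
  have h4 := abs_log_sub_log_le px py
  rw [← dx, ← dy, h1, add_sub_add_right_eq_sub, ← h1, dx, h1, dy] at h4
  rw [logAbsDerivGauss_eq x, logAbsDerivGauss_eq y]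
  rw [Real.log_inv, Real.log_inv] at h4
  have h5 : -2 * Real.log x - -2 * Real.log y = 2 * (-Real.log x - -Real.log y) := by ring
  rw [h5, abs_mul, abs_of_pos (by norm_num : (0:ℝ) < 2), pow_succ]
  linarith

lemma birkhoff_logAbsDerivGauss (n : ℕ) {x : ℝ} (hx : x ∈ gaussSet) :
    birkhoff logAbsDerivGauss n x = 2 * Real.log (den (word n x) (gaussMap^[n] x)) := by
  induction n generalizing x with
  | zero => simp [birkhoff, word, den, qden_nil, qprev_nil]
  | succ n ih =>
    have mx := gaussMap_mem hx
    have e := invBranch_iterate (mem_cylinder_word n mx)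
    rw [length_word] at e
    have ip := (gaussSet_pos (iterate_mem mx n)).le
    have hw : PosWord (cfDigit1 x :: word n (gaussMap x)) := posWord_word (n + 1) hx
    rw [birkhoff_succ, ih mx, word, Function.iterate_succ_apply, den_cons hw ip, e,
      digit_add_gaussMap hx, Real.log_mul (den_pos hw.tail ip).ne'
        (inv_pos.2 (gaussSet_pos hx)).ne', Real.log_inv, logAbsDerivGauss_eq x]
    ring

instance (n : ℕ) : Countable (Word n) := by unfold Word; infer_instance

section
variable {φ : ℝ → ℝ} {μ : Measure ℝ} {B θ C : ℝ} [IsProbabilityMeasure μ]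

lemma wt_word (φ : ℝ → ℝ) (n : ℕ) {x : ℝ} (hx : x ∈ gaussSet) :
    wt φ (word n x) (gaussMap^[n] x) = Real.exp (birkhoff φ n x) := by
  have e := invBranch_iterate (mem_cylinder_word n hx)
  rw [length_word] at e
  unfold wt
  rw [e, length_word]

lemma GibbsSys.lintegral_birkhoff_le (S : GibbsSys φ μ B θ C) (n : ℕ) :
    ∫⁻ x, ENNReal.ofReal (-birkhoff φ n x) ∂μ ≤ n * ∫⁻ x, ENNReal.ofReal (-φ x) ∂μ := by
  have hm : ∀ k, Measurable fun x => ENNReal.ofReal (-φ (gaussMap^[k] x)) := fun k =>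
    (S.meas.comp (measurable_iterate k)).neg.ennreal_ofReal
  calc ∫⁻ x, ENNReal.ofReal (-birkhoff φ n x) ∂μ
      ≤ ∫⁻ x, ∑ k ∈ Finset.range n, ENNReal.ofReal (-φ (gaussMap^[k] x)) ∂μ := by
        apply lintegral_mono_ae
        filter_upwards [S.ae_mem] with x hx
        rw [← ENNReal.ofReal_sum_of_nonneg, birkhoff, Finset.sum_neg_distrib]
        intro k _
        have := S.nonpos _ (iterate_mem hx k)
        linarith
    _ = ∑ k ∈ Finset.range n, ∫⁻ x, ENNReal.ofReal (-φ (gaussMap^[k] x)) ∂μ :=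
        lintegral_finsetSum _ fun k _ => hm k
    _ = ∑ k ∈ Finset.range n, ∫⁻ x, ENNReal.ofReal (-φ x) ∂μ := by
        apply Finset.sum_congr rfl
        intro k _
        exact (S.inv.iterate k).lintegral_comp (S.meas.neg.ennreal_ofReal)
    _ = _ := by simp

lemma GibbsSys.entropy_sum_le (S : GibbsSys φ μ B θ C) (n : ℕ) :
    ENNReal.ofReal (∑' l : Word n, Real.negMulLog (μ (_root_.cylinder l.1)).toReal) ≤
      ENNReal.ofReal (Real.log C) + n * ∫⁻ x, ENNReal.ofReal (-φ x) ∂μ := by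
  by_cases hs : Summable fun l : Word n => Real.negMulLog (μ (_root_.cylinder l.1)).toReal
  swap
  · rw [tsum_eq_zero_of_not_summable hs]; simp
  have hmeas : ∀ l : Word n, MeasurableSet (_root_.cylinder l.1) := fun l =>
    measurableSet_cylinder _
  have hterm : ∀ l : Word n, ENNReal.ofReal (Real.negMulLog (μ (_root_.cylinder l.1)).toReal) ≤
      ∫⁻ x in _root_.cylinder l.1, ENNReal.ofReal (Real.log C - birkhoff φ n x) ∂μ := by
    intro l
    set m := (μ (_root_.cylinder l.1)).toReal with hm
    have hm1 : m ≤ 1 := measureReal_le_one (μ := μ)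
    have hm0 : 0 < m := by
      obtain ⟨x₀, hx₀⟩ := exists_mem_gaussSet
      have h1 := (S.gibbs l.1 l.2.2 x₀ hx₀).1
      have h2 := wt_pos φ l.1 x₀
      exact pos_of_mul_pos_right (h2.trans_le h1) S.C_pos.le
    have hlm : 0 ≤ -Real.log m := by
      have := Real.log_nonpos hm0.le hm1; linarith
    calc ENNReal.ofReal (Real.negMulLog m) =
          ENNReal.ofReal (-Real.log m) * μ (_root_.cylinder l.1) := by
          rw [← ofReal_measureReal_cyl, ← ENNReal.ofReal_mul hlm]
          congr 1
          unfold Real.negMulLog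
          rw [measureReal_def, ← hm]; ring
      _ = ∫⁻ x in _root_.cylinder l.1, ENNReal.ofReal (-Real.log m) ∂μ := by
          rw [setLIntegral_const]
      _ ≤ _ := by
          apply setLIntegral_mono_ae ((measurable_birkhoff S.meas n).const_sub _).ennreal_ofReal.aemeasurable
          refine ae_of_all _ fun x hx => ENNReal.ofReal_le_ofReal ?_
          have hxX := cylinder_subset _ hx
          have hw : word n x = l.1 := by
            have := (mem_cylinder_iff.1 hx).2
            rwa [l.2.1] at this
          have h1 := (S.gibbs l.1 l.2.2 _ (iterate_mem hxX n)).1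
          rw [← hw, wt_word φ n hxX, hw] at h1
          have h2 := Real.log_le_log (Real.exp_pos _) h1
          rw [Real.log_exp, Real.log_mul S.C_pos.ne' (by rw [measureReal_def]; exact hm0.ne')] at h2
          rw [measureReal_def, ← hm] at h2
          linarith
  rw [ENNReal.ofReal_tsum_of_nonneg (fun l => Real.negMulLog_nonneg ENNReal.toReal_nonneg
    (measureReal_le_one (μ := μ))) hs]
  calc _ ≤ ∑' l : Word n, ∫⁻ x in _root_.cylinder l.1,
        ENNReal.ofReal (Real.log C - birkhoff φ n x) ∂μ := ENNReal.tsum_le_tsum hterm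
    _ = ∫⁻ x in ⋃ l : Word n, _root_.cylinder l.1,
        ENNReal.ofReal (Real.log C - birkhoff φ n x) ∂μ := by
        rw [lintegral_iUnion hmeas]
        intro l l' hne
        exact cylinder_disjoint (l.2.1.trans l'.2.1.symm) fun h => hne (Subtype.ext h)
    _ ≤ ∫⁻ x, ENNReal.ofReal (Real.log C - birkhoff φ n x) ∂μ := setLIntegral_le_lintegral _ _
    _ ≤ ∫⁻ x, (ENNReal.ofReal (Real.log C) + ENNReal.ofReal (-birkhoff φ n x)) ∂μ :=
        lintegral_mono fun x => by rw [sub_eq_add_neg]; exact ENNReal.ofReal_add_le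
    _ = ENNReal.ofReal (Real.log C) + ∫⁻ x, ENNReal.ofReal (-birkhoff φ n x) ∂μ := by
        rw [lintegral_add_left measurable_const]; simp
    _ ≤ _ := by gcongr; exact S.lintegral_birkhoff_le n

lemma GibbsSys.entropy_le (S : GibbsSys φ μ B θ C) {h : ℝ} (hent : HasEntropy μ h) :
    ENNReal.ofReal h ≤ ∫⁻ x, ENNReal.ofReal (-φ x) ∂μ := by
  set I := ∫⁻ x, ENNReal.ofReal (-φ x) ∂μ with hI
  rcases eq_or_ne I ⊤ with htop | htop
  · rw [htop]; exact le_top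
  apply ENNReal.ofReal_le_of_le_toReal
  have hlim : Tendsto (fun n : ℕ => Real.log C / n + I.toReal) atTop (𝓝 (0 + I.toReal)) :=
    (tendsto_const_div_atTop_nhds_zero_nat _).add_const _
  rw [zero_add] at hlim
  refine le_of_tendsto_of_tendsto hent hlim ?_
  filter_upwards [eventually_gt_atTop 0] with n hn
  have hn' : (0:ℝ) < n := by exact_mod_cast hn
  have h1 := S.entropy_sum_le n
  have hC : 0 ≤ Real.log C := Real.log_nonneg S.one_le
  have h2 : ENNReal.ofReal (Real.log C) + n * I = ENNReal.ofReal (Real.log C + n * I.toReal) := by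
    rw [ENNReal.ofReal_add hC (by positivity), ENNReal.ofReal_mul (by positivity),
      ENNReal.ofReal_toReal htop, ENNReal.ofReal_natCast]
  rw [h2, ENNReal.ofReal_le_ofReal_iff (by positivity)] at h1
  rw [div_le_iff₀ hn', add_mul, div_mul_cancel₀ _ hn'.ne']
  linarith

/-- A nonnegative function with large integral has a truncation with large integral. -/
lemma exists_truncation {μ : Measure ℝ} [IsProbabilityMeasure μ] {g : ℝ → ℝ}
    (hg : Measurable g) (hg0 : ∀ᵐ x ∂μ, 0 ≤ g x) {c : ℝ} (hc : 0 ≤ c)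
    (h : ENNReal.ofReal c < ∫⁻ x, ENNReal.ofReal (g x) ∂μ) :
    ∃ b > 0, c < ∫ x, min (g x) b ∂μ := by
  have hsup : ∫⁻ x, ENNReal.ofReal (g x) ∂μ = ⨆ n : ℕ, ∫⁻ x, ENNReal.ofReal (min (g x) n) ∂μ := by
    rw [← lintegral_iSup (fun n => (hg.min measurable_const).ennreal_ofReal)]
    · congr 1; ext x
      apply le_antisymm
      · obtain ⟨n, hn⟩ := exists_nat_ge (g x)
        refine le_iSup_of_le n ?_
        rw [min_eq_left hn]
      · exact iSup_le fun n => ENNReal.ofReal_le_ofReal (min_le_left _ _)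
    · intro n m hnm x
      exact ENNReal.ofReal_le_ofReal (min_le_min_left _ (by exact_mod_cast hnm))
  rw [hsup, lt_iSup_iff] at h
  obtain ⟨n, hn⟩ := h
  have hi : ∀ b : ℝ, 0 ≤ b → Integrable (fun x => min (g x) b) μ := fun b hb =>
    (integrable_const b).mono' (hg.min measurable_const).aestronglyMeasurable (by
      filter_upwards [hg0] with x hx
      rw [Real.norm_eq_abs, abs_of_nonneg (le_min hx hb)]
      exact min_le_right _ _)
  have hn0 : (0:ℝ) ≤ n := Nat.cast_nonneg n
  refine ⟨n + 1, by positivity, ?_⟩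
  rw [← ofReal_integral_eq_lintegral_ofReal (hi n hn0) (by
    filter_upwards [hg0] with x hx using le_min hx hn0)] at hn
  have h1 := (ENNReal.ofReal_lt_ofReal_iff_of_nonneg hc).1 hn
  refine h1.trans_le (integral_mono (hi n hn0) (hi _ (by positivity)) fun x => ?_)
  exact min_le_min_left _ (by linarith)

/-- Words whose continuant and measure have the expected exponential size. -/
structure RegWord (μ : Measure ℝ) (C Λ s ε : ℝ) (l : List ℕ) : Prop where
  pos : PosWord l
  lower : Real.exp ((Λ - ε) * l.length) / 2 ≤ qden l
  upper : qden l ≤ Real.exp ((Λ + ε) * l.length)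
  meas : μ.real (_root_.cylinder l) ≤ C * Real.exp (-(2 * s * Λ * l.length))

lemma GibbsSys.regWord_of (S : GibbsSys φ μ B θ C) {Λ s ε : ℝ} {n : ℕ} {x : ℝ}
    (hx : x ∈ gaussSet) (h1 : birkhoff logAbsDerivGauss n x ≤ 2 * (Λ + ε) * n)
    (h2 : 2 * (Λ - ε) * n ≤ birkhoff logAbsDerivGauss n x)
    (h3 : birkhoff φ n x ≤ -(2 * s * Λ * n)) : RegWord μ C Λ s ε (word n x) := by
  have hp := posWord_word n hx
  have ix := iterate_mem hx n
  have hd := den_pos hp (gaussSet_pos ix).le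
  have hd1 := qden_le_den (word n x) (gaussSet_pos ix).le
  have hd2 := den_le hp (gaussSet_pos ix).le
  rw [birkhoff_logAbsDerivGauss n hx] at h1 h2
  refine ⟨hp, ?_, ?_, ?_⟩
  · rw [length_word]
    have : Real.exp ((Λ - ε) * n) ≤ den (word n x) (gaussMap^[n] x) := by
      rw [← Real.le_log_iff_exp_le hd]; linarith
    have h4 : (1 + gaussMap^[n] x) * (qden (word n x) : ℝ) ≤ 2 * qden (word n x) :=
      mul_le_mul_of_nonneg_right (by linarith [gaussSet_lt_one ix]) (Nat.cast_nonneg _)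
    linarith
  · rw [length_word]
    refine hd1.trans ?_
    rw [← Real.log_le_iff_le_exp hd]; linarith
  · refine ((S.gibbs _ hp _ ix).2).trans ?_
    rw [wt_word φ n hx, length_word]
    exact mul_le_mul_of_nonneg_left (Real.exp_le_exp.2 h3) S.C_pos.le

/-- Exponentially few points have an irregular word. -/
lemma GibbsSys.exists_regular (S : GibbsSys φ μ B θ C) (ht : PolyTail μ) {h : ℝ}
    (hent : HasEntropy μ h) (hdim : 1 / 2 < h / lyapunov μ) :
    ∃ Λ > 0, ∃ s > 1 / 2, ∀ ε > 0, ∃ K > 0, ∃ ρ ∈ Set.Ioo (0:ℝ) 1, ∀ n : ℕ,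
      μ.real {x | x ∈ gaussSet ∧ ¬ RegWord μ C Λ s ε (word n x)} ≤ K * ρ ^ n := by
  obtain ⟨β, hβ, hm⟩ := S.exists_moment ht
  set lam := lyapunov μ with hlam
  have hlam0 : lam ≠ 0 := by
    intro h0; rw [h0, div_zero] at hdim; norm_num at hdim
  have hintegr : Integrable logAbsDerivGauss μ := by
    by_contra hc
    exact hlam0 (integral_undef hc)
  have hpsi0 : ∀ᵐ x ∂μ, 0 ≤ logAbsDerivGauss x := by
    filter_upwards [S.ae_mem] with x hx using logAbsDerivGauss_nonneg hx
  have hlampos : 0 < lam := lt_of_le_of_ne (integral_nonneg_of_ae hpsi0) hlam0.symm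
  obtain ⟨s, hs1, hs2⟩ := exists_between hdim
  have hsh : s * lam < h := (lt_div_iff₀ hlampos).1 hs2
  have hsl : 0 ≤ s * lam := by positivity
  have hent' := S.entropy_le hent
  have hφ0 : ∀ᵐ x ∂μ, 0 ≤ -φ x := by
    filter_upwards [S.ae_mem] with x hx
    have := S.nonpos x hx; linarith
  obtain ⟨B₀, hB₀, hB₀i⟩ := exists_truncation (g := fun x => -φ x) S.meas.neg
    hφ0 hsl
    (((ENNReal.ofReal_lt_ofReal_iff_of_nonneg hsl).2 hsh).trans_le hent')
  refine ⟨lam / 2, by positivity, s, hs1, fun ε hε => ?_⟩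
  have hl : ∀ x : ℝ, 0 ≤ Real.log ((cfDigit1 x : ℝ) + 1) := fun x => Real.log_nonneg (by simp)
  have hθk : ∀ k : ℕ, (1 / 2 : ℝ) ^ k ≤ θ ^ k := fun k => pow_le_pow_left₀ (by norm_num) S.half_le k
  have hpsiH : ∀ k, 0 < k → ∀ x ∈ gaussSet, ∀ y ∈ gaussSet, word k x = word k y →
      |logAbsDerivGauss x - logAbsDerivGauss y| ≤ 8 * θ ^ k := fun k hk x hx y hy hw =>
    (abs_logAbsDerivGauss_sub_le hk hx hy hw).trans
      (mul_le_mul_of_nonneg_left (hθk k) (by norm_num))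
  -- upper bound for the derivative
  obtain ⟨t₁, ht₁, ρ₁, hρ₁, h₁⟩ := S.large_dev hβ hm
    (f := fun x => logAbsDerivGauss x - (lam + 2 * ε)) (A := 2 + lam + 2 * ε) (Bf := 8)
    (measurable_logAbsDerivGauss.sub_const _) (by positivity)
    (fun x hx => by
      have h1 := logAbsDerivGauss_nonneg hx
      have h2 := logAbsDerivGauss_le hx
      have h3 := hl x
      rw [abs_le]
      constructor <;> nlinarith)
    (fun x hx => by
      have h1 := logAbsDerivGauss_nonneg hx
      linarith)
    (by norm_num)
    (fun k hk x hx y hy hw => by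
      simpa using hpsiH k hk x hx y hy hw)
    (by
      rw [integral_sub hintegr (integrable_const _)]
      have : ∫ x, logAbsDerivGauss x ∂μ = lam := rfl
      rw [this]; simp; linarith)
  -- lower bound for the derivative
  obtain ⟨B₁, hB₁, hB₁i⟩ := exists_truncation (c := max 0 (lam - 2 * ε))
    measurable_logAbsDerivGauss hpsi0 (le_max_left _ _) (by
      rw [← ofReal_integral_eq_lintegral_ofReal hintegr hpsi0]
      rw [ENNReal.ofReal_lt_ofReal_iff_of_nonneg (le_max_left _ _)]
      exact max_lt hlampos (by change _ < lam; linarith))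
  have hti : ∀ {g : ℝ → ℝ} {b : ℝ}, Measurable g → (∀ᵐ x ∂μ, 0 ≤ g x) → 0 < b →
      Integrable (fun x => min (g x) b) μ := fun {g b} hg hg0 hb =>
    (integrable_const b).mono' (hg.min measurable_const).aestronglyMeasurable (by
      filter_upwards [hg0] with x hx
      rw [Real.norm_eq_abs, abs_of_nonneg (le_min hx hb.le)]
      exact min_le_right _ _)
  obtain ⟨t₂, ht₂, ρ₂, hρ₂, h₂⟩ := S.large_dev hβ hm
    (f := fun x => (lam - 2 * ε) - min (logAbsDerivGauss x) B₁) (A := lam + 2 * ε + B₁) (Bf := 8)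
    (measurable_const.sub (measurable_logAbsDerivGauss.min measurable_const)) (by positivity)
    (fun x hx => by
      have h1 := le_min (logAbsDerivGauss_nonneg hx) hB₁.le
      have h2 := min_le_right (logAbsDerivGauss x) B₁
      have h3 := mul_nonneg (show 0 ≤ lam + 2 * ε + B₁ by positivity) (hl x)
      rw [abs_le]
      constructor <;> linarith)
    (fun x hx => by
      have h2 := min_le_right (logAbsDerivGauss x) B₁
      linarith)
    (by norm_num)
    (fun k hk x hx y hy hw => by
      refine le_trans ?_ (hpsiH k hk x hx y hy hw)
      rw [sub_sub_sub_cancel_left, abs_sub_comm]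
      refine (abs_min_sub_min_le_max _ _ _ _).trans ?_
      simp)
    (by
      rw [integral_sub (integrable_const _) (hti measurable_logAbsDerivGauss hpsi0 hB₁)]
      have := (le_max_right 0 (lam - 2 * ε)).trans_lt hB₁i
      simp; linarith)
  -- upper bound for the potential
  obtain ⟨t₃, ht₃, ρ₃, hρ₃, h₃⟩ := S.large_dev hβ hm
    (f := fun x => s * lam - min (-φ x) B₀) (A := s * lam + B₀) (Bf := B)
    (measurable_const.sub (S.meas.neg.min measurable_const)) (by positivity)
    (fun x hx => by
      have h1 := le_min (show 0 ≤ -φ x by linarith [S.nonpos x hx]) hB₀.le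
      have h2 := min_le_right (-φ x) B₀
      have h3 := mul_nonneg (show 0 ≤ s * lam + B₀ by positivity) (hl x)
      rw [abs_le]
      constructor <;> linarith)
    (fun x hx => by
      have h2 := min_le_right (-φ x) B₀
      linarith)
    S.B_pos
    (fun k hk x hx y hy hw => by
      refine le_trans ?_ (S.holder k hk x hx y hy hw)
      rw [sub_sub_sub_cancel_left, abs_sub_comm]
      refine (abs_min_sub_min_le_max _ _ _ _).trans ?_
      rw [neg_sub_neg, abs_sub_comm]; simp)
    (by
      rw [integral_sub (integrable_const _) (hti (g := fun x => -φ x) S.meas.neg hφ0 hB₀)]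
      simp; linarith)
  set ρ := max ρ₁ (max ρ₂ ρ₃) with hρ
  have hρpos : 0 < ρ := hρ₁.1.trans_le (le_max_left _ _)
  refine ⟨6, by norm_num, ρ, ⟨hρpos, max_lt hρ₁.2 (max_lt hρ₂.2 hρ₃.2)⟩, fun n => ?_⟩
  have hsub : {x | x ∈ gaussSet ∧ ¬ RegWord μ C (lam / 2) s ε (word n x)} ⊆
      {x | x ∈ gaussSet ∧ -0 ≤ birkhoff (fun x => logAbsDerivGauss x - (lam + 2 * ε)) n x} ∪
      ({x | x ∈ gaussSet ∧
          -0 ≤ birkhoff (fun x => (lam - 2 * ε) - min (logAbsDerivGauss x) B₁) n x} ∪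
        {x | x ∈ gaussSet ∧ -0 ≤ birkhoff (fun x => s * lam - min (-φ x) B₀) n x}) := by
    rintro x ⟨hx, hr⟩
    by_contra hc
    simp only [mem_union, mem_ofPred_eq, hx, true_and, neg_zero, not_or, not_le] at hc
    obtain ⟨c1, c2, c3⟩ := hc
    refine hr (S.regWord_of hx ?_ ?_ ?_)
    · have : birkhoff (fun x => logAbsDerivGauss x - (lam + 2 * ε)) n x =
          birkhoff logAbsDerivGauss n x - n * (lam + 2 * ε) := by
        simp [birkhoff, Finset.sum_sub_distrib]
        ring
      rw [this] at c1
      linarith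
    · have : n * (lam - 2 * ε) - birkhoff logAbsDerivGauss n x ≤
          birkhoff (fun x => (lam - 2 * ε) - min (logAbsDerivGauss x) B₁) n x := by
        simp only [birkhoff, Finset.sum_sub_distrib, Finset.sum_const, Finset.card_range,
          nsmul_eq_mul]
        have := Finset.sum_le_sum (s := Finset.range n)
          fun k _ => min_le_left (logAbsDerivGauss (gaussMap^[k] x)) B₁
        linarith
      linarith
    · have : n * (s * lam) + birkhoff φ n x ≤
          birkhoff (fun x => s * lam - min (-φ x) B₀) n x := by
        simp only [birkhoff, Finset.sum_sub_distrib, Finset.sum_const, Finset.card_range,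
          nsmul_eq_mul]
        rw [sub_eq_add_neg, ← Finset.sum_neg_distrib]
        refine add_le_add le_rfl (Finset.sum_le_sum fun k _ => ?_)
        have := min_le_left (-φ (gaussMap^[k] x)) B₀
        linarith
      linarith
  refine (measureReal_mono hsub).trans ((measureReal_union_le _ _).trans
    ((add_le_add le_rfl (measureReal_union_le _ _)).trans ?_))
  have e1 := h₁ n 0
  have e2 := h₂ n 0
  have e3 := h₃ n 0
  rw [mul_zero, Real.exp_zero, mul_one] at e1 e2 e3
  have r1 : ρ₁ ^ n ≤ ρ ^ n := pow_le_pow_left₀ hρ₁.1.le (le_max_left _ _) n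
  have r2 : ρ₂ ^ n ≤ ρ ^ n :=
    pow_le_pow_left₀ hρ₂.1.le ((le_max_left _ _).trans (le_max_right _ _)) n
  have r3 : ρ₃ ^ n ≤ ρ ^ n :=
    pow_le_pow_left₀ hρ₃.1.le ((le_max_right _ _).trans (le_max_right _ _)) n
  linarith

end

/-! ### Oscillatory integrals -/

lemma integral_inv_one_add_sq_affine_le {α β H : ℝ} (hH : 0 < H) (hmax : max |α| |β| = 1) :
    ∫ x in (0:ℝ)..2, 1 / (1 + H * (α * x + β) ^ 2) ≤ 4 * π / Real.sqrt H := by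
  have hs : 0 < Real.sqrt H := Real.sqrt_pos.2 hH
  have hs2 : Real.sqrt H ^ 2 = H := Real.sq_sqrt hH.le
  have hpos : ∀ x : ℝ, 0 < 1 + H * (α * x + β) ^ 2 := fun x => by positivity
  have hcont : Continuous fun x : ℝ => 1 / (1 + H * (α * x + β) ^ 2) :=
    continuous_const.div (by fun_prop) fun x => (hpos x).ne'
  rcases le_or_gt (1 / 4) |α| with hα | hα
  · have hα0 : α ≠ 0 := by
      rintro rfl; norm_num at hα
    have hd : ∀ x : ℝ, HasDerivAt
        (fun x => Real.arctan (Real.sqrt H * (α * x + β)) / (Real.sqrt H * α))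
        (1 / (1 + H * (α * x + β) ^ 2)) x := by
      intro x
      have h1 : HasDerivAt (fun x => Real.sqrt H * (α * x + β)) (Real.sqrt H * (α * 1)) x :=
        (((hasDerivAt_id x).const_mul α).add_const β).const_mul _
      have h2 := (h1.arctan).div_const (Real.sqrt H * α)
      refine h2.congr_deriv ?_
      rw [mul_pow, hs2]
      have := (hpos x).ne'
      field_simp
    rw [intervalIntegral.integral_eq_sub_of_hasDerivAt (fun x _ => hd x)
      (hcont.intervalIntegrable _ _)]
    rw [← sub_div]
    refine (le_abs_self _).trans ?_
    rw [abs_div, abs_mul, abs_of_pos hs]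
    have hat : |Real.arctan (Real.sqrt H * (α * 2 + β)) -
        Real.arctan (Real.sqrt H * (α * 0 + β))| ≤ π := by
      rw [abs_le]
      have a1 := Real.arctan_lt_pi_div_two (Real.sqrt H * (α * 2 + β))
      have a2 := Real.neg_pi_div_two_lt_arctan (Real.sqrt H * (α * 2 + β))
      have a3 := Real.arctan_lt_pi_div_two (Real.sqrt H * (α * 0 + β))
      have a4 := Real.neg_pi_div_two_lt_arctan (Real.sqrt H * (α * 0 + β))
      constructor <;> linarith
    rw [div_le_div_iff₀ (by positivity) hs]
    calc _ ≤ π * Real.sqrt H := mul_le_mul_of_nonneg_right hat hs.le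
      _ ≤ 4 * π * (Real.sqrt H * |α|) := by nlinarith [mul_pos Real.pi_pos hs]
  · have hβ : |β| = 1 := by
      rcases max_cases |α| |β| with h | h <;> linarith
    have hl : ∀ x ∈ Icc (0:ℝ) 2, 1 / (1 + H * (α * x + β) ^ 2) ≤ 1 / (1 + H / 4) := by
      intro x hx
      apply one_div_le_one_div_of_le (by positivity)
      have h1 : 1 / 2 ≤ |α * x + β| := by
        have h2 : |β| ≤ |α * x + β| + |α * x| := by
          have := abs_sub (α * x + β) (α * x)
          rwa [add_sub_cancel_left] at this
        have h3 : |α * x| ≤ 1 / 2 := by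
          rw [abs_mul, abs_of_nonneg hx.1]
          nlinarith [hx.2, abs_nonneg α, hx.1]
        linarith
      have h4 : 1 / 4 ≤ (α * x + β) ^ 2 := by
        rw [← sq_abs]; nlinarith
      nlinarith
    have h1 : ∫ x in (0:ℝ)..2, 1 / (1 + H * (α * x + β) ^ 2) ≤ ∫ _ in (0:ℝ)..2, 1 / (1 + H / 4) :=
      intervalIntegral.integral_mono_on (by norm_num) (hcont.intervalIntegrable _ _)
        (by simp) hl
    refine h1.trans ?_
    simp only [intervalIntegral.integral_const, sub_zero, smul_eq_mul]
    rw [mul_one_div, div_le_div_iff₀ (by positivity) hs]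
    have := Real.pi_gt_three
    nlinarith [sq_nonneg (Real.sqrt H - 2)]

/-- Van der Corput type estimate for a phase whose derivative is bounded below by a multiple of
an affine function. -/
lemma norm_integral_exp_le {g h h' : ℝ → ℝ} {α β H P : ℝ} (hH : 0 < H) (hP : 1 ≤ P)
    (hmax : max |α| |β| = 1) (hg : ∀ x ∈ Icc (0:ℝ) 2, HasDerivAt g (h x) x)
    (hh : ∀ x ∈ Icc (0:ℝ) 2, HasDerivAt h (h' x) x) (hc : ContinuousOn h' (Icc 0 2))
    (hlow : ∀ x ∈ Icc (0:ℝ) 2, H * |α * x + β| ≤ |h x|)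
    (hup : ∀ x ∈ Icc (0:ℝ) 2, |h' x| ≤ P * H) :
    ‖∫ x in (0:ℝ)..2, Complex.exp ((g x : ℂ) * Complex.I)‖ ≤ 27 * P / Real.sqrt H := by
  have hs : 0 < Real.sqrt H := Real.sqrt_pos.2 hH
  have hs2 : Real.sqrt H ^ 2 = H := Real.sq_sqrt hH.le
  have hu : uIcc (0:ℝ) 2 = Icc 0 2 := uIcc_of_le (by norm_num)
  set w : ℝ → ℝ := fun x => h x ^ 2 + H with hw
  have hwpos : ∀ x, 0 < w x := fun x => by simp only [hw]; positivity
  set r : ℝ → ℝ := fun x => h x / w x with hr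
  set r' : ℝ → ℝ := fun x => (h' x * w x - h x * (2 * h x * h' x)) / w x ^ 2 with hr'
  have hrd : ∀ x ∈ Icc (0:ℝ) 2, HasDerivAt r (r' x) x := by
    intro x hx
    have h1 : HasDerivAt w (2 * h x * h' x) x := by
      have := ((hh x hx).pow 2).add_const H
      simpa [hw] using this
    exact (hh x hx).div h1 (hwpos x).ne'
  set e : ℝ → ℂ := fun x => Complex.exp ((g x : ℂ) * Complex.I) with he
  have hen : ∀ x, ‖e x‖ = 1 := fun x => Complex.norm_exp_ofReal_mul_I (g x)
  have hed : ∀ x ∈ Icc (0:ℝ) 2, HasDerivAt e (e x * ((h x : ℂ) * Complex.I)) x := by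
    intro x hx
    exact (((hg x hx).ofReal_comp).mul_const Complex.I).cexp
  set Φ : ℝ → ℂ := fun x => -Complex.I * (e x * (r x : ℂ)) with hΦ
  set Φ' : ℝ → ℂ := fun x =>
    -Complex.I * (e x * ((h x : ℂ) * Complex.I) * (r x : ℂ) + e x * (r' x : ℂ)) with hΦ'
  have hΦd : ∀ x ∈ Icc (0:ℝ) 2, HasDerivAt Φ (Φ' x) x := fun x hx =>
    ((hed x hx).mul ((hrd x hx).ofReal_comp)).const_mul _
  have hgc : ContinuousOn g (Icc 0 2) := fun x hx => (hg x hx).continuousAt.continuousWithinAt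
  have hhc : ContinuousOn h (Icc 0 2) := fun x hx => (hh x hx).continuousAt.continuousWithinAt
  have hwc : ContinuousOn w (Icc 0 2) := (hhc.pow 2).add continuousOn_const
  have hec : ContinuousOn e (Icc 0 2) := fun x hx => (hed x hx).continuousAt.continuousWithinAt
  have hrc : ContinuousOn r (Icc 0 2) := fun x hx => (hrd x hx).continuousAt.continuousWithinAt
  have hrc' : ContinuousOn r' (Icc 0 2) :=
    ((hc.mul hwc).sub (hhc.mul ((continuousOn_const.mul hhc).mul hc))).div (hwc.pow 2)
      fun x _ => (pow_pos (hwpos x) 2).ne'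
  have hofR : ∀ {u : ℝ → ℝ}, ContinuousOn u (Icc 0 2) →
      ContinuousOn (fun x => (u x : ℂ)) (Icc 0 2) := fun hu =>
    Complex.continuous_ofReal.comp_continuousOn hu
  have hΦc' : ContinuousOn Φ' (Icc 0 2) :=
    continuousOn_const.mul (((hec.mul ((hofR hhc).mul continuousOn_const)).mul (hofR hrc)).add
      (hec.mul (hofR hrc')))
  have hΦi : IntervalIntegrable Φ' volume 0 2 := (hu ▸ hΦc').intervalIntegrable
  have hei : IntervalIntegrable e volume 0 2 := (hu ▸ hec).intervalIntegrable
  have hft : ∫ x in (0:ℝ)..2, Φ' x = Φ 2 - Φ 0 :=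
    intervalIntegral.integral_eq_sub_of_hasDerivAt (fun x hx => hΦd x (hu ▸ hx)) hΦi
  have hrb : ∀ x, |r x| ≤ 1 / (2 * Real.sqrt H) := by
    intro x
    simp only [hr]
    rw [abs_div, abs_of_pos (hwpos x), div_le_div_iff₀ (hwpos x) (by positivity)]
    simp only [hw]
    rw [← sq_abs (h x)]
    nlinarith [sq_nonneg (|h x| - Real.sqrt H)]
  have hΦb : ∀ x, ‖Φ x‖ ≤ 1 / (2 * Real.sqrt H) := by
    intro x
    simp only [hΦ]
    rw [norm_mul, norm_mul, hen, norm_neg, Complex.norm_I, Complex.norm_real, one_mul, one_mul]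
    exact hrb x
  have hpt : ∀ x ∈ Icc (0:ℝ) 2, ‖e x - Φ' x‖ ≤ (P + 1) * (1 / (1 + H * (α * x + β) ^ 2)) := by
    intro x hx
    have hwx := hwpos x
    have hwl : H * (1 + H * (α * x + β) ^ 2) ≤ w x := by
      have h1 := pow_le_pow_left₀ (by positivity) (hlow x hx) 2
      rw [mul_pow, sq_abs, sq_abs] at h1
      simp only [hw]; linarith
    have hq : 0 < 1 + H * (α * x + β) ^ 2 := by positivity
    have e1 : e x - Φ' x = e x * ((H / w x : ℝ) + (r' x : ℝ) * Complex.I) := by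
      have h2 : (1:ℂ) - (h x : ℂ) * (r x : ℂ) = ((H / w x : ℝ) : ℂ) := by
        norm_cast
        simp only [hr]
        field_simp
        simp only [hw]; ring
      rw [← h2]
      simp only [hΦ']
      linear_combination (e x * h x * r x) * Complex.I_sq
    rw [e1, norm_mul, hen, one_mul]
    have n1 : ‖((H / w x : ℝ) : ℂ)‖ ≤ 1 / (1 + H * (α * x + β) ^ 2) := by
      rw [Complex.norm_real, Real.norm_eq_abs, abs_of_pos (by positivity),
        div_le_div_iff₀ hwx hq]
      linarith
    have n2 : |r' x| ≤ P * (1 / (1 + H * (α * x + β) ^ 2)) := by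
      have e2 : r' x = h' x * (H - h x ^ 2) / w x ^ 2 := by
        simp only [hr', hw]; ring
      have h3 : |H - h x ^ 2| ≤ w x := by
        simp only [hw]
        rw [abs_le]; constructor <;> nlinarith [sq_nonneg (h x)]
      rw [e2, abs_div, abs_mul, abs_of_pos (pow_pos hwx 2), mul_one_div,
        div_le_div_iff₀ (by positivity) hq]
      calc |h' x| * |H - h x ^ 2| * (1 + H * (α * x + β) ^ 2)
          ≤ (P * H) * w x * (1 + H * (α * x + β) ^ 2) := by
            apply mul_le_mul_of_nonneg_right _ hq.le
            exact mul_le_mul (hup x hx) h3 (abs_nonneg _) (by positivity)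
        _ = P * w x * (H * (1 + H * (α * x + β) ^ 2)) := by ring
        _ ≤ P * w x * w x := mul_le_mul_of_nonneg_left hwl (by positivity)
        _ = _ := by ring
    calc _ ≤ ‖((H / w x : ℝ) : ℂ)‖ + ‖((r' x : ℝ) : ℂ) * Complex.I‖ := norm_add_le _ _
      _ ≤ 1 / (1 + H * (α * x + β) ^ 2) + P * (1 / (1 + H * (α * x + β) ^ 2)) := by
          apply add_le_add n1
          rw [norm_mul, Complex.norm_I, mul_one, Complex.norm_real]; exact n2
      _ = _ := by ring
  have hcont : Continuous fun x : ℝ => (P + 1) * (1 / (1 + H * (α * x + β) ^ 2)) :=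
    continuous_const.mul (continuous_const.div (by fun_prop) fun x => by positivity)
  have hb : ‖∫ x in (0:ℝ)..2, (e x - Φ' x)‖ ≤
      ∫ x in (0:ℝ)..2, (P + 1) * (1 / (1 + H * (α * x + β) ^ 2)) :=
    intervalIntegral.norm_integral_le_of_norm_le (by norm_num)
      (ae_of_all _ fun x hx => hpt x ⟨hx.1.le, hx.2⟩) (hcont.intervalIntegrable _ _)
  rw [intervalIntegral.integral_const_mul] at hb
  have hI := integral_inv_one_add_sq_affine_le hH hmax
  have e3 : ∫ x in (0:ℝ)..2, e x = (Φ 2 - Φ 0) + ∫ x in (0:ℝ)..2, (e x - Φ' x) := by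
    rw [intervalIntegral.integral_sub hei hΦi, hft]; ring
  rw [e3]
  have h5 : ‖Φ 2 - Φ 0‖ ≤ 1 / Real.sqrt H := by
    refine (norm_sub_le _ _).trans ((add_le_add (hΦb 2) (hΦb 0)).trans (le_of_eq ?_))
    field_simp; norm_num
  refine (norm_add_le _ _).trans ?_
  have h6 : (P + 1) * ∫ x in (0:ℝ)..2, 1 / (1 + H * (α * x + β) ^ 2) ≤
      (P + 1) * (4 * π / Real.sqrt H) := mul_le_mul_of_nonneg_left hI (by linarith)
  have h7 : 1 / Real.sqrt H + (P + 1) * (4 * π / Real.sqrt H) ≤ 27 * P / Real.sqrt H := by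
    rw [← mul_div_assoc, ← add_div]
    apply div_le_div_of_nonneg_right _ hs.le
    have := Real.pi_lt_d2
    nlinarith
  linarith

/-- The derivative of an inverse branch, written as an explicit Möbius map. -/
lemma hasDerivAt_mobius {l : List ℕ} (hl : PosWord l) {x : ℝ} (hx : 0 ≤ x) :
    HasDerivAt (fun x => x / (den l x * qden l)) (1 / den l x ^ 2) x := by
  have hd := (den_pos hl hx).ne'
  have hq : (qden l : ℝ) ≠ 0 := by exact_mod_cast (qprev_le_and_pos hl).2.ne'
  have h1 : HasDerivAt (fun x => den l x * qden l) (qprev l * 1 * qden l) x :=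
    (((hasDerivAt_id x).const_mul (qprev l : ℝ)).add_const (qden l : ℝ)).mul_const _
  refine ((hasDerivAt_id x).div h1 (mul_ne_zero hd hq)).congr_deriv ?_
  have e : den l x = qprev l * x + qden l := rfl
  simp only [id]
  field_simp
  rw [e]; ring

lemma hasDerivAt_inv_den_sq {l : List ℕ} (hl : PosWord l) {x : ℝ} (hx : 0 ≤ x) :
    HasDerivAt (fun x => 1 / den l x ^ 2) (-(2 * qprev l / den l x ^ 3)) x := by
  have hd := (den_pos hl hx).ne'
  have h1 : HasDerivAt (fun x => den l x) (qprev l * 1) x :=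
    ((hasDerivAt_id x).const_mul (qprev l : ℝ)).add_const (qden l : ℝ)
  have h2 : HasDerivAt (fun x => den l x ^ 2) (2 * den l x ^ (2 - 1) * (qprev l * 1)) x := by
    simpa using h1.fun_pow 2
  refine ((hasDerivAt_const x (1:ℝ)).div h2 (pow_ne_zero 2 hd)).congr_deriv ?_
  field_simp
  ring

/-- The ratio of consecutive continuants. -/
noncomputable def ratio (l : List ℕ) : ℝ := qprev l / qden l

set_option maxHeartbeats 1600000 in
lemma norm_integral_phase_le {a b : List ℕ} (ha : PosWord a) (hb : PosWord b)
    (hlen : a.length = b.length) {q₀ q₁ ξ : ℝ} (hq₀ : 0 < q₀) (ha0 : q₀ ≤ qden a)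
    (hb0 : q₀ ≤ qden b) (ha1 : qden a ≤ q₁) (hb1 : qden b ≤ q₁) (hξ : 0 < ξ)
    (hne : ratio a ≠ ratio b) :
    ‖∫ x in (0:ℝ)..2, Complex.exp (((2 * π * ξ * (invBranch a x - invBranch b x) : ℝ) : ℂ) *
      Complex.I)‖ ≤ 27 * (8748 * (q₁ / q₀) ^ 7) /
        Real.sqrt (ξ * q₀ ^ 2 / (81 * q₁ ^ 4) * |ratio a - ratio b|) := by
  have hq₁ : 0 < q₁ := hq₀.trans_le (ha0.trans ha1)
  have hqa : 0 < (qden a : ℝ) := hq₀.trans_le ha0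
  have hqb : 0 < (qden b : ℝ) := hq₀.trans_le hb0
  have hpa : (qprev a : ℝ) ≤ qden a := by exact_mod_cast (qprev_le_and_pos ha).1
  have hpb : (qprev b : ℝ) ≤ qden b := by exact_mod_cast (qprev_le_and_pos hb).1
  have hpa0 : (0:ℝ) ≤ qprev a := Nat.cast_nonneg _
  have hpb0 : (0:ℝ) ≤ qprev b := Nat.cast_nonneg _
  set Δ₁ : ℝ := qprev b - qprev a with hΔ₁
  set Δ₂ : ℝ := qden b - qden a with hΔ₂
  set D : ℝ := max |Δ₁| |Δ₂| with hD
  have hδ : 0 < |ratio a - ratio b| := abs_pos.2 (sub_ne_zero.2 hne)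
  have hDδ : q₀ * |ratio a - ratio b| / 2 ≤ D := by
    have e : ratio a - ratio b = (-Δ₁ * qden b + qprev b * Δ₂) / (qden a * qden b) := by
      unfold ratio
      rw [hΔ₁, hΔ₂]
      field_simp; ring
    have h1 : |(-Δ₁ * qden b + qprev b * Δ₂)| ≤ 2 * D * qden b := by
      refine (abs_add_le _ _).trans ?_
      rw [abs_mul, abs_mul, abs_neg, abs_of_pos hqb, abs_of_nonneg hpb0]
      have := le_max_left |Δ₁| |Δ₂|
      have := le_max_right |Δ₁| |Δ₂|
      have h0 := abs_nonneg Δ₂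
      have := mul_le_mul hpb (le_max_right |Δ₁| |Δ₂|) h0 hqb.le
      nlinarith
    have h2 : |ratio a - ratio b| * (qden a * qden b) ≤ 2 * D * qden b := by
      rw [e, abs_div, abs_of_pos (mul_pos hqa hqb), div_mul_cancel₀ _ (mul_pos hqa hqb).ne']
      exact h1
    have h3 : |ratio a - ratio b| * qden a ≤ 2 * D := by
      apply le_of_mul_le_mul_right _ hqb
      linarith
    nlinarith
  have hD0 : 0 < D := lt_of_lt_of_le (by positivity) hDδ
  have hD1 : |Δ₁| ≤ D := le_max_left _ _
  have hD2 : |Δ₂| ≤ D := le_max_right _ _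
  set H : ℝ := 2 * π * ξ * D * (2 * q₀) / (81 * q₁ ^ 4) with hHdef
  have hH : 0 < H := by positivity
  set P : ℝ := 8748 * (q₁ / q₀) ^ 7 with hPdef
  have hP : 1 ≤ P := by
    have : 1 ≤ (q₁ / q₀) ^ 7 := one_le_pow₀ ((one_le_div hq₀).2 (ha0.trans ha1))
    linarith
  have hPH : P * H = 2 * π * ξ * (216 * D * q₁ ^ 3 / q₀ ^ 6) := by
    rw [hPdef, hHdef]
    field_simp; norm_num
  set sg : ℝ := (-1) ^ a.length with hsg
  have hsga : |sg| = 1 := by rw [hsg, abs_pow, abs_neg, abs_one, one_pow]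
  have key := norm_integral_exp_le (α := Δ₁ / D) (β := Δ₂ / D) (H := H) (P := P)
    (g := fun x => 2 * π * ξ * ((invBranch a 0 - invBranch b 0) +
      sg * (x / (den a x * qden a) - x / (den b x * qden b))))
    (h := fun x => 2 * π * ξ * (sg * (1 / den a x ^ 2 - 1 / den b x ^ 2)))
    (h' := fun x => 2 * π * ξ *
      (sg * (-(2 * qprev a / den a x ^ 3) - -(2 * qprev b / den b x ^ 3))))
    hH hP ?_ ?_ ?_ ?_ ?_ ?_
  · refine le_trans (le_of_eq ?_) (key.trans ?_)
    · congr 1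
      apply intervalIntegral.integral_congr
      intro x hx
      rw [uIcc_of_le (by norm_num)] at hx
      have e1 := invBranch_sub ha hx.1 le_rfl
      have e2 := invBranch_sub hb hx.1 le_rfl
      have d1 : den a 0 = qden a := by simp [den]
      have d2 : den b 0 = qden b := by simp [den]
      beta_reduce
      congr 4
      rw [d1, sub_zero] at e1
      rw [d2, sub_zero, ← hlen] at e2
      rw [mul_div_assoc] at e1 e2
      linear_combination e1 - e2
    · apply div_le_div_of_nonneg_left (by positivity) (by positivity)
      apply Real.sqrt_le_sqrt
      rw [hHdef, div_mul_eq_mul_div]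
      apply div_le_div_of_nonneg_right _ (by positivity)
      have h3 := Real.pi_gt_three
      calc ξ * q₀ ^ 2 * |ratio a - ratio b| = ξ * 2 * q₀ * (q₀ * |ratio a - ratio b| / 2) := by ring
        _ ≤ ξ * 2 * q₀ * D := by gcongr
        _ ≤ (2 * π) * (ξ * 2 * q₀ * D) := by
            have : 0 ≤ ξ * 2 * q₀ * D := by positivity
            nlinarith
        _ = _ := by ring
  · rw [abs_div, abs_div, abs_of_pos hD0]
    rw [max_div_div_right hD0.le]
    exact div_self hD0.ne'
  · intro x hx
    exact ((((hasDerivAt_mobius ha hx.1).sub (hasDerivAt_mobius hb hx.1)).const_mul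
      sg).const_add _).const_mul _
  · intro x hx
    exact (((hasDerivAt_inv_den_sq ha hx.1).sub (hasDerivAt_inv_den_sq hb hx.1)).const_mul
      sg).const_mul _
  · have ca : ContinuousOn (fun x => den a x) (Icc 0 2) := by unfold den; fun_prop
    have cb : ContinuousOn (fun x => den b x) (Icc 0 2) := by unfold den; fun_prop
    refine continuousOn_const.mul (continuousOn_const.mul (ContinuousOn.sub ?_ ?_))
    · exact (continuousOn_const.div (ca.pow 3) fun x hx => (pow_pos (den_pos ha hx.1) 3).ne').neg
    · exact (continuousOn_const.div (cb.pow 3) fun x hx => (pow_pos (den_pos hb hx.1) 3).ne').neg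
  all_goals
    intro x hx
    have la := ha0.trans (qden_le_den a hx.1)
    have lb := hb0.trans (qden_le_den b hx.1)
    have pa := den_pos ha hx.1
    have pb := den_pos hb hx.1
    have ua : den a x ≤ 3 * q₁ := (den_le ha hx.1).trans (by nlinarith [hx.2])
    have ub : den b x ≤ 3 * q₁ := (den_le hb hx.1).trans (by nlinarith [hx.2])
    have hdiff : den b x - den a x = Δ₁ * x + Δ₂ := by
      simp only [den, hΔ₁, hΔ₂]; ring
    have h2 : |2 * π * ξ| = 2 * π * ξ := abs_of_pos (by positivity)
    rw [abs_mul (2 * π * ξ), abs_mul sg, h2, hsga, one_mul]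
  · have e : 1 / den a x ^ 2 - 1 / den b x ^ 2 =
        (Δ₁ * x + Δ₂) * (den a x + den b x) / (den a x ^ 2 * den b x ^ 2) := by
      rw [← hdiff]; field_simp; ring
    rw [e, abs_div, abs_mul, abs_of_pos (add_pos pa pb),
      abs_of_pos (show 0 < den a x ^ 2 * den b x ^ 2 by positivity)]
    have e2 : H * |Δ₁ / D * x + Δ₂ / D| = 2 * π * ξ * (|Δ₁ * x + Δ₂| * (2 * q₀) / (81 * q₁ ^ 4)) := by
      rw [show Δ₁ / D * x + Δ₂ / D = (Δ₁ * x + Δ₂) / D by ring, abs_div, abs_of_pos hD0, hHdef]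
      field_simp
    rw [e2]
    apply mul_le_mul_of_nonneg_left _ (by positivity)
    apply div_le_div₀ (by positivity) _ (by positivity)
    · calc den a x ^ 2 * den b x ^ 2 ≤ (3 * q₁) ^ 2 * (3 * q₁) ^ 2 := by gcongr
        _ = _ := by ring
    · exact mul_le_mul_of_nonneg_left (by linarith) (abs_nonneg _)
  · rw [hPH]
    apply mul_le_mul_of_nonneg_left _ (by positivity)
    have e : -(2 * (qprev a:ℝ) / den a x ^ 3) - -(2 * qprev b / den b x ^ 3) =
        2 * (Δ₁ * den a x ^ 3 - qprev a * ((Δ₁ * x + Δ₂) *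
          (den a x ^ 2 + den a x * den b x + den b x ^ 2))) / (den a x ^ 3 * den b x ^ 3) := by
      rw [← hdiff, hΔ₁]; field_simp; ring
    rw [e, abs_div, abs_of_pos (show 0 < den a x ^ 3 * den b x ^ 3 by positivity)]
    apply div_le_div₀ (by positivity)
    · rw [abs_mul, abs_two]
      have k1 : |Δ₁ * den a x ^ 3| ≤ D * (3 * q₁) ^ 3 := by
        rw [abs_mul, abs_of_pos (pow_pos pa 3)]; gcongr
      have k2 : |Δ₁ * x + Δ₂| ≤ 3 * D := by
        refine (abs_add_le _ _).trans ?_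
        rw [abs_mul, abs_of_nonneg hx.1]
        nlinarith [hx.2, hx.1, abs_nonneg Δ₁]
      have k3 : den a x ^ 2 + den a x * den b x + den b x ^ 2 ≤ 27 * q₁ ^ 2 := by
        have := mul_le_mul ua ub pb.le (by positivity)
        nlinarith
      have k4 : |qprev a * ((Δ₁ * x + Δ₂) * (den a x ^ 2 + den a x * den b x + den b x ^ 2))| ≤
          q₁ * (3 * D * (27 * q₁ ^ 2)) := by
        rw [abs_mul, abs_mul, abs_of_nonneg hpa0,
          abs_of_pos (show 0 < den a x ^ 2 + den a x * den b x + den b x ^ 2 by positivity)]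
        exact mul_le_mul (hpa.trans ha1) (mul_le_mul k2 k3 (by positivity) (by positivity))
          (by positivity) hq₁.le
      have k5 := abs_sub (Δ₁ * den a x ^ 3)
        (qprev a * ((Δ₁ * x + Δ₂) * (den a x ^ 2 + den a x * den b x + den b x ^ 2)))
      nlinarith
    · positivity
    · calc q₀ ^ 6 = q₀ ^ 3 * q₀ ^ 3 := by ring
        _ ≤ _ := by gcongr

section

/-! ### Counting cylinders -/

lemma volume_real_le_cylinder_inter {w : List ℕ} (hw : PosWord w) {Q : ℝ} (hQ : 0 < Q)
    (hq : (qden w : ℝ) ≤ Q) {u v t : ℝ} (ht : t ∈ Icc (0:ℝ) 1)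
    (hm : invBranch w t ∈ Icc u v) :
    1 / (4 * Q ^ 2) ≤
      volume.real (_root_.cylinder w ∩ Icc (u - 1 / (4 * Q ^ 2)) (v + 1 / (4 * Q ^ 2))) := by
  set r : ℝ := 1 / (4 * Q ^ 2) with hr
  have hr0 : 0 < r := by positivity
  have hsub : Icc (0:ℝ) 1 ⊆ Ici 0 := fun x hx => hx.1
  have hord : OrdConnected (invBranch w '' Icc 0 1) :=
    (isPreconnected_Icc.image _ ((continuousOn_invBranch hw).mono hsub)).ordConnected
  have hlen : 2 * r ≤ |invBranch w 1 - invBranch w 0| := by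
    have h1 := den_pos hw (zero_le_one (α := ℝ))
    have h0 := den_pos hw (le_refl (0:ℝ))
    rw [invBranch_sub hw zero_le_one le_rfl, abs_div, abs_mul, abs_pow, abs_neg, abs_one, one_pow,
      sub_zero, abs_one, mul_one, abs_of_pos (mul_pos h1 h0), hr]
    have e1 := den_le hw (zero_le_one (α := ℝ))
    have e0 := den_le hw (le_refl (0:ℝ))
    rw [mul_one_div, div_le_div_iff₀ (by positivity) (mul_pos h1 h0)]
    have : den w 1 * den w 0 ≤ (2 * Q) * Q :=
      mul_le_mul (by linarith) (by linarith) h0.le (by linarith)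
    nlinarith
  obtain ⟨z, hz, hzr⟩ : ∃ z ∈ Icc (0:ℝ) 1, r ≤ |invBranch w z - invBranch w t| := by
    by_contra! hcon
    have h1 := hcon 1 ⟨zero_le_one, le_rfl⟩
    have h2 := hcon 0 ⟨le_rfl, zero_le_one⟩
    have := abs_sub_le (invBranch w 1) (invBranch w t) (invBranch w 0)
    rw [abs_sub_comm (invBranch w t)] at this
    linarith
  set p := invBranch w t with hp
  obtain ⟨c, hc⟩ : ∃ c, Icc c (c + r) ⊆ (invBranch w '' Icc 0 1) ∩ Icc (u - r) (v + r) := by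
    have hpi : p ∈ invBranch w '' Icc 0 1 := ⟨t, ht, rfl⟩
    have hzi : invBranch w z ∈ invBranch w '' Icc 0 1 := ⟨z, hz, rfl⟩
    rcases le_abs.1 hzr with h | h
    · refine ⟨p, fun y hy => ⟨hord.out hpi hzi ⟨hy.1, by linarith [hy.2]⟩, ?_⟩⟩
      exact ⟨by linarith [hy.1, hm.1], by linarith [hy.2, hm.2]⟩
    · refine ⟨p - r, fun y hy => ⟨hord.out hzi hpi ⟨by linarith [hy.1], by linarith [hy.2]⟩, ?_⟩⟩
      exact ⟨by linarith [hy.1, hm.1], by linarith [hy.2, hm.2]⟩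
  have hnull : volume ((invBranch w '' Icc 0 1) \ _root_.cylinder w) = 0 := by
    have hcount : (invBranch w '' (range ((↑) : ℚ → ℝ))).Countable := (countable_range _).image _
    refine measure_mono_null ?_ (hcount.measure_zero volume)
    rintro y ⟨⟨x, hx, rfl⟩, hy⟩
    refine ⟨x, ?_, rfl⟩
    by_contra hirr
    exact hy (invBranch_mem_cylinder hw ⟨hx, hirr⟩)
  have hfin : volume (_root_.cylinder w ∩ Icc (u - r) (v + r)) ≠ ⊤ :=
    ((measure_mono inter_subset_right).trans_lt measure_Icc_lt_top).ne
  have hle : volume (Icc c (c + r)) ≤ volume (_root_.cylinder w ∩ Icc (u - r) (v + r)) := by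
    calc volume (Icc c (c + r)) ≤ volume ((_root_.cylinder w ∩ Icc (u - r) (v + r)) ∪
          ((invBranch w '' Icc 0 1) \ _root_.cylinder w)) := by
          apply measure_mono
          intro y hy
          by_cases hyc : y ∈ _root_.cylinder w
          · exact Or.inl ⟨hyc, (hc hy).2⟩
          · exact Or.inr ⟨(hc hy).1, hyc⟩
      _ ≤ _ := (measure_union_le _ _).trans (by rw [hnull, add_zero])
  rw [Real.volume_Icc, add_sub_cancel_left] at hle
  rw [measureReal_def]
  exact (ENNReal.ofReal_le_iff_le_toReal hfin).1 hle

/-- Cylinders of bounded denominator are long, so few of them meet a short interval. -/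
lemma card_le_of_meets {S : Finset (List ℕ)} {m : ℕ} {Q u v : ℝ} (hQ : 0 < Q) (huv : u ≤ v)
    (hS : ∀ w ∈ S, PosWord w ∧ w.length = m ∧ (qden w : ℝ) ≤ Q)
    (hm : ∀ w ∈ S, ∃ t ∈ Icc (0:ℝ) 1, invBranch w t ∈ Icc u v) :
    (S.card : ℝ) ≤ 4 * Q ^ 2 * (v - u) + 2 := by
  set r : ℝ := 1 / (4 * Q ^ 2) with hr
  have hr0 : 0 < r := by positivity
  have h1 : (S.card : ℝ) * r ≤
      ∑ w ∈ S, volume.real (_root_.cylinder w ∩ Icc (u - r) (v + r)) := by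
    rw [← nsmul_eq_mul]
    apply Finset.card_nsmul_le_sum
    intro w hw
    obtain ⟨t, ht, htm⟩ := hm w hw
    exact volume_real_le_cylinder_inter (hS w hw).1 hQ (hS w hw).2.2 ht htm
  have h2 : ∑ w ∈ S, volume.real (_root_.cylinder w ∩ Icc (u - r) (v + r)) ≤
      volume.real (Icc (u - r) (v + r)) := by
    rw [← measureReal_biUnion_finset (h := fun w _ =>
      ((measure_mono inter_subset_right).trans_lt measure_Icc_lt_top).ne)]
    · exact measureReal_mono (iUnion₂_subset fun w _ => inter_subset_right)
        measure_Icc_lt_top.ne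
    · intro a ha b hb hab
      exact (cylinder_disjoint ((hS a ha).2.1.trans (hS b hb).2.1.symm) hab).mono
        inter_subset_left inter_subset_left
    · exact fun w _ => (measurableSet_cylinder w).inter measurableSet_Icc
  rw [Real.volume_real_Icc_of_le (by linarith)] at h2
  have h3 : (S.card : ℝ) * r ≤ (4 * Q ^ 2 * (v - u) + 2) * r := by
    have : 4 * Q ^ 2 * r = 1 := by rw [hr]; field_simp
    calc _ ≤ _ := h1.trans h2
      _ = (v - u) * 1 + 2 * r := by ring
      _ = _ := by rw [← this]; ring
  exact le_of_mul_le_mul_right h3 hr0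

/-! ### Reversed words -/

lemma ratio_mem {l : List ℕ} (hl : PosWord l) : ratio l ∈ Icc (0:ℝ) 1 := by
  have h := qprev_le_and_pos hl
  refine ⟨by unfold ratio; positivity, ?_⟩
  unfold ratio
  exact div_le_one_of_le₀ (by exact_mod_cast h.1) (Nat.cast_nonneg _)

lemma ratio_append {l : List ℕ} (hl : PosWord l) (w : List ℕ) (hw : PosWord w) :
    ratio (l ++ w) = invBranch w.reverse (ratio l) := by
  induction w using List.reverseRecOn with
  | nil => simp [invBranch]
  | append_singleton w c ih =>
    rw [← List.append_assoc, List.reverse_append, List.reverse_singleton, List.singleton_append,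
      invBranch_cons, ← ih hw.left]
    unfold ratio invBranch1
    have hq : (0:ℝ) < qden (l ++ w) := by
      exact_mod_cast (qprev_le_and_pos (hl.append hw.left)).2
    rw [qden_append_singleton, qprev_append_singleton]
    push_cast
    rw [div_add' _ _ _ hq.ne', inv_div]
    ring

variable {φ : ℝ → ℝ} {μ : Measure ℝ} {B θ C : ℝ}

lemma sum_measure_le_of_drop [IsProbabilityMeasure μ] (hinv : MeasurePreserving gaussMap μ μ)
    {G : Finset (List ℕ)} {n m : ℕ}
    (hG : ∀ a ∈ G, a.length = n) {w : List ℕ}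
    (hw : ∀ a ∈ G, a.drop (n - m) = w) :
    ∑ a ∈ G, μ.real (_root_.cylinder a) ≤ μ.real (_root_.cylinder w) := by
  rw [← measureReal_biUnion_finset]
  · have h1 : μ.real (gaussMap^[n - m] ⁻¹' _root_.cylinder w) = μ.real (_root_.cylinder w) := by
      rw [measureReal_def, measureReal_def,
        (hinv.iterate (n - m)).measure_preimage (measurableSet_cylinder w).nullMeasurableSet]
    rw [← h1]
    refine measureReal_mono ?_ (measure_ne_top _ _)
    apply iUnion₂_subset
    intro a ha x hx
    rw [← List.take_append_drop (n - m) a, mem_cylinder_append, List.length_take, hG a ha,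
      min_eq_left (Nat.sub_le n m), hw a ha] at hx
    exact hx.2
  · intro a ha b hb hab
    exact cylinder_disjoint ((hG a ha).trans (hG b hb).symm) hab
  · exact fun w _ => measurableSet_cylinder w

variable {Λ s ε : ℝ}

lemma card_regWord_meets {S : Finset (List ℕ)} {m : ℕ} {u v : ℝ} (huv : u ≤ v)
    (hS : ∀ w ∈ S, RegWord μ C Λ s ε w ∧ w.length = m)
    (hm : ∀ w ∈ S, ∃ t ∈ Icc (0:ℝ) 1, invBranch w t ∈ Icc u v) :
    (S.card : ℝ) ≤ 4 * Real.exp (2 * (Λ + ε) * m) * (v - u) + 2 := by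
  have := card_le_of_meets (m := m) (Real.exp_pos ((Λ + ε) * m)) huv
    (fun w hw => ⟨(hS w hw).1.pos, (hS w hw).2, by
      have := (hS w hw).1.upper
      rwa [(hS w hw).2] at this⟩) hm
  rwa [← Real.exp_nat_mul, show ((2:ℕ):ℝ) * ((Λ + ε) * m) = 2 * (Λ + ε) * m by push_cast; ring]
    at this

lemma finite_regWord (μ : Measure ℝ) (C Λ s ε : ℝ) (m : ℕ) :
    {w | RegWord μ C Λ s ε w ∧ w.length = m}.Finite := by
  by_contra hinf
  obtain ⟨N, hN⟩ := exists_nat_gt (4 * Real.exp (2 * (Λ + ε) * m) * (1 - 0) + 2)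
  obtain ⟨S, hS, hc⟩ := Set.Infinite.exists_subset_card_eq hinf N
  have := card_regWord_meets (S := S) (u := 0) (v := 1) zero_le_one (fun w hw => hS hw)
    (fun w hw => ⟨0, ⟨le_rfl, zero_le_one⟩, invBranch_nonneg w le_rfl,
      invBranch_le_one (hS hw).1.pos le_rfl zero_le_one⟩)
  rw [hc] at this
  linarith

/-- The finite set of regular words of a given length. -/
noncomputable def regFinset (μ : Measure ℝ) (C Λ s ε : ℝ) (m : ℕ) : Finset (List ℕ) :=
  (finite_regWord μ C Λ s ε m).toFinset

lemma mem_regFinset {m : ℕ} {w : List ℕ} :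
    w ∈ regFinset μ C Λ s ε m ↔ RegWord μ C Λ s ε w ∧ w.length = m := by
  simp [regFinset]

lemma card_regFinset_le (m : ℕ) :
    ((regFinset μ C Λ s ε m).card : ℝ) ≤ 4 * Real.exp (2 * (Λ + ε) * m) + 2 := by
  have := card_regWord_meets (S := regFinset μ C Λ s ε m) (u := 0) (v := 1) zero_le_one
    (fun w hw => mem_regFinset.1 hw)
    (fun w hw => ⟨0, ⟨le_rfl, zero_le_one⟩, invBranch_nonneg w le_rfl,
      invBranch_le_one (mem_regFinset.1 hw).1.pos le_rfl zero_le_one⟩)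
  linarith

/-- Frostman-type bound for the part of `μ` carried by regular cylinders. -/
lemma measure_interval_regular_le [IsProbabilityMeasure μ] (hC : 0 ≤ C) (n : ℕ) {u v : ℝ}
    (huv : u ≤ v) :
    μ.real {x | x ∈ Icc u v ∧ x ∈ gaussSet ∧ RegWord μ C Λ s ε (word n x)} ≤
      (4 * Real.exp (2 * (Λ + ε) * n) * (v - u) + 2) * (C * Real.exp (-(2 * s * Λ * n))) := by
  set S := (regFinset μ C Λ s ε n).filter
    (fun w => ∃ t ∈ Icc (0:ℝ) 1, invBranch w t ∈ Icc u v) with hS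
  have hc := card_regWord_meets (S := S) huv
    (fun w hw => mem_regFinset.1 (Finset.mem_filter.1 hw).1) (fun w hw => (Finset.mem_filter.1 hw).2)
  have hsub : {x | x ∈ Icc u v ∧ x ∈ gaussSet ∧ RegWord μ C Λ s ε (word n x)} ⊆
      ⋃ w ∈ S, _root_.cylinder w := by
    rintro x ⟨hxi, hx, hreg⟩
    have hxc := mem_cylinder_word n hx
    refine mem_iUnion₂.2 ⟨word n x, ?_, hxc⟩
    refine Finset.mem_filter.2 ⟨mem_regFinset.2 ⟨hreg, length_word n x⟩, gaussMap^[n] x,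
      (iterate_mem hx n).1, ?_⟩
    have := invBranch_iterate hxc
    rw [length_word] at this
    rwa [this]
  calc _ ≤ μ.real (⋃ w ∈ S, _root_.cylinder w) := measureReal_mono hsub (measure_ne_top _ _)
    _ ≤ ∑ w ∈ S, μ.real (_root_.cylinder w) := measureReal_biUnion_finset_le _ _
    _ ≤ S.card • (C * Real.exp (-(2 * s * Λ * n))) := by
        apply Finset.sum_le_card_nsmul
        intro w hw
        have h := mem_regFinset.1 (Finset.mem_filter.1 hw).1
        have := h.1.meas
        rwa [h.2] at this
    _ ≤ _ := by
        rw [nsmul_eq_mul]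
        exact mul_le_mul_of_nonneg_right hc (by positivity)

/-- Few words (in measure) have their reversed expansion close to a given point. -/
lemma sum_measure_ratio_le [IsProbabilityMeasure μ] (hinv : MeasurePreserving gaussMap μ μ)
    (hC : 0 ≤ C) (hε : 0 ≤ ε) {G : Finset (List ℕ)} {n m : ℕ}
    (hmn : m ≤ n) (hpos : ∀ a ∈ G, PosWord a) (hG : ∀ a ∈ G, a.length = n)
    (hreg : ∀ a ∈ G, RegWord μ C Λ s ε (a.drop (n - m))) (y : ℝ)
    (hy : ∀ a ∈ G, |ratio a - y| ≤ Real.exp (-(2 * Λ * m))) :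
    ∑ a ∈ G, μ.real (_root_.cylinder a) ≤ 10 * C * Real.exp ((2 * ε - 2 * s * Λ) * m) := by
  set r := Real.exp (-(2 * Λ * m)) with hr
  set W := G.image (fun a => a.drop (n - m)) with hW
  have hlenw : ∀ a ∈ G, (a.drop (n - m)).length = m := fun a ha => by
    rw [List.length_drop, hG a ha]; omega
  have hinj : Function.Injective (List.reverse : List ℕ → List ℕ) := List.reverse_injective
  have hcard : (W.card : ℝ) ≤ 4 * Real.exp ((Λ + ε) * m) ^ 2 * ((y + r) - (y - r)) + 2 := by
    rw [← Finset.card_image_of_injective W hinj]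
    apply card_le_of_meets (m := m) (Real.exp_pos _) (by linarith [Real.exp_pos (-(2 * Λ * m))])
    · intro w hw
      simp only [hW, Finset.mem_image] at hw
      obtain ⟨_, ⟨a, ha, rfl⟩, rfl⟩ := hw
      refine ⟨(hreg a ha).pos.reverse, by rw [List.length_reverse, hlenw a ha], ?_⟩
      rw [qden_reverse]
      have := (hreg a ha).upper
      rwa [hlenw a ha] at this
    · intro w hw
      simp only [hW, Finset.mem_image] at hw
      obtain ⟨_, ⟨a, ha, rfl⟩, rfl⟩ := hw
      have hpa := hpos a ha
      rw [← List.take_append_drop (n - m) a] at hpa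
      refine ⟨ratio (a.take (n - m)), ratio_mem hpa.left, ?_⟩
      rw [← ratio_append hpa.left _ hpa.right, List.take_append_drop]
      have := abs_le.1 (hy a ha)
      exact ⟨by linarith, by linarith⟩
  have hcard' : (W.card : ℝ) ≤ 10 * Real.exp (2 * ε * m) := by
    have e1 : Real.exp ((Λ + ε) * m) ^ 2 * r = Real.exp (2 * ε * m) := by
      rw [← Real.exp_nat_mul, hr, ← Real.exp_add]
      congr 1; push_cast; ring
    have e2 : 1 ≤ Real.exp (2 * ε * m) := Real.one_le_exp (by positivity)
    calc (W.card : ℝ) ≤ 8 * (Real.exp ((Λ + ε) * m) ^ 2 * r) + 2 := by linarith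
      _ ≤ _ := by rw [e1]; linarith
  calc ∑ a ∈ G, μ.real (_root_.cylinder a)
      = ∑ w ∈ W, ∑ a ∈ G with a.drop (n - m) = w, μ.real (_root_.cylinder a) :=
        (Finset.sum_fiberwise_of_maps_to (fun a ha => Finset.mem_image_of_mem _ ha) _).symm
    _ ≤ ∑ w ∈ W, μ.real (_root_.cylinder w) := by
        apply Finset.sum_le_sum
        intro w _
        exact sum_measure_le_of_drop hinv (fun a ha => hG a (Finset.mem_filter.1 ha).1)
          (fun a ha => (Finset.mem_filter.1 ha).2)
    _ ≤ W.card • (C * Real.exp (-(2 * s * Λ * m))) := by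
        apply Finset.sum_le_card_nsmul
        intro w hw
        simp only [hW, Finset.mem_image] at hw
        obtain ⟨a, ha, rfl⟩ := hw
        have := (hreg a ha).meas
        rwa [hlenw a ha] at this
    _ ≤ (10 * Real.exp (2 * ε * m)) * (C * Real.exp (-(2 * s * Λ * m))) := by
        rw [nsmul_eq_mul]
        exact mul_le_mul_of_nonneg_right hcard' (by positivity)
    _ = _ := by
        rw [show (2 * ε - 2 * s * Λ) * m = 2 * ε * m + -(2 * s * Λ * m) by ring, Real.exp_add]
        ring

end

/-! ### Exponential sums over words -/

/-- The character `x ↦ e^{-2πiξx}`. -/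
noncomputable def eF (ξ x : ℝ) : ℂ := Complex.exp (-(2 * Real.pi * ξ * x : ℝ) * Complex.I)

lemma muFourier_eq (μ : Measure ℝ) (ξ : ℝ) : muFourier μ ξ = ∫ x, eF ξ x ∂μ := rfl

lemma norm_eF (ξ x : ℝ) : ‖eF ξ x‖ = 1 := by
  unfold eF
  rw [← Complex.ofReal_neg]
  exact Complex.norm_exp_ofReal_mul_I _

lemma continuous_eF (ξ : ℝ) : Continuous (eF ξ) := by
  unfold eF; fun_prop

lemma eF_mul_conj (ξ x y : ℝ) : eF ξ x * (starRingEnd ℂ) (eF ξ y) =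
    Complex.exp (((2 * π * ξ * (y - x) : ℝ) : ℂ) * Complex.I) := by
  unfold eF
  rw [← Complex.exp_conj, ← Complex.exp_add]
  congr 1
  simp only [map_mul, map_neg, Complex.conj_ofReal, Complex.conj_I]
  push_cast; ring

lemma norm_eF_sub_le (ξ x y : ℝ) : ‖eF ξ x - eF ξ y‖ ≤ 2 * π * |ξ| * |x - y| := by
  have h1 : eF ξ x - eF ξ y =
      eF ξ y * (Complex.exp (Complex.I * ((2 * π * ξ * (y - x) : ℝ) : ℂ)) - 1) := by
    unfold eF
    rw [mul_sub, mul_one, ← Complex.exp_add]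
    congr 2
    push_cast; ring
  rw [h1, norm_mul, norm_eF, one_mul]
  refine (Real.norm_exp_I_mul_ofReal_sub_one_le).trans (le_of_eq ?_)
  rw [Real.norm_eq_abs, abs_mul, abs_mul, abs_of_pos Real.two_pi_pos, abs_sub_comm]

/-- Transfer of `L²` bounds from Lebesgue measure to a measure with few points in short
intervals. -/
lemma integral_sq_le_of_interval_bound {ν : Measure ℝ} [IsFiniteMeasure ν]
    (hν : ∀ᵐ x ∂ν, x ∈ Icc (0:ℝ) 1) {F : ℝ → ℂ} (hF : Measurable F) {M A κ V : ℝ}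
    (hA : ∀ x ∈ Icc (0:ℝ) 2, ‖F x‖ ≤ A)
    (hL : ∀ x ∈ Icc (0:ℝ) 2, ∀ y ∈ Icc (0:ℝ) 2, ‖F x - F y‖ ≤ M * |x - y|)
    (hκ : 0 < κ) (hκ1 : κ ≤ 1) (hV0 : 0 ≤ V) (hM : 0 ≤ M)
    (hV : ∀ y, ν.real (Icc (y - κ) y) ≤ V) :
    ∫ x, ‖F x‖ ^ 2 ∂ν ≤
      2 * (κ * M) ^ 2 * ν.real univ + 2 / κ * V * ∫ x in (0:ℝ)..2, ‖F x‖ ^ 2 := by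
  set f : ℝ → ℝ≥0∞ := fun x => ENNReal.ofReal (‖F x‖ ^ 2) with hf
  have hfm : Measurable f := (hF.norm.pow_const 2).ennreal_ofReal
  set c : ℝ≥0∞ := ENNReal.ofReal (2 * (κ * M) ^ 2) with hc
  have hA0 : 0 ≤ A := (norm_nonneg _).trans (hA 0 ⟨le_rfl, by norm_num⟩)
  have hpt : ∀ x ∈ Icc (0:ℝ) 1, f x * ENNReal.ofReal κ ≤
      (∫⁻ y in Icc (0:ℝ) 2, (Icc x (x + κ)).indicator (fun y => 2 * f y) y) +
        c * ENNReal.ofReal κ := by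
    intro x hx
    have hsub : Icc x (x + κ) ⊆ Icc (0:ℝ) 2 := Icc_subset_Icc hx.1 (by linarith [hx.2])
    have e1 : f x * ENNReal.ofReal κ = ∫⁻ _ in Icc x (x + κ), f x := by
      rw [setLIntegral_const, Real.volume_Icc, add_sub_cancel_left]
    have e2 : c * ENNReal.ofReal κ = ∫⁻ _ in Icc x (x + κ), c := by
      rw [setLIntegral_const, Real.volume_Icc, add_sub_cancel_left]
    rw [lintegral_indicator measurableSet_Icc, Measure.restrict_restrict measurableSet_Icc,
      inter_eq_left.2 hsub, e1, e2, ← lintegral_add_right _ measurable_const]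
    apply setLIntegral_mono' measurableSet_Icc
    intro y hy
    have h1 : ‖F x‖ ^ 2 ≤ 2 * ‖F y‖ ^ 2 + 2 * (κ * M) ^ 2 := by
      have h2 := hL x (hsub ⟨le_rfl, by linarith⟩) y (hsub hy)
      have h3 : |x - y| ≤ κ := by
        rw [abs_le]; constructor <;> linarith [hy.1, hy.2]
      have h4 : ‖F x‖ ≤ ‖F y‖ + κ * M := by
        have := norm_sub_norm_le (F x) (F y)
        nlinarith
      have h5 : 0 ≤ κ * M := by positivity
      nlinarith [norm_nonneg (F x), norm_nonneg (F y), sq_nonneg (‖F y‖ - κ * M)]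
    calc f x ≤ ENNReal.ofReal (2 * ‖F y‖ ^ 2 + 2 * (κ * M) ^ 2) := ENNReal.ofReal_le_ofReal h1
      _ = 2 * f y + c := by
        rw [ENNReal.ofReal_add (by positivity) (by positivity),
          ENNReal.ofReal_mul (by norm_num), ENNReal.ofReal_ofNat]
  have hswap : ∫⁻ x, (∫⁻ y in Icc (0:ℝ) 2, (Icc x (x + κ)).indicator (fun y => 2 * f y) y) ∂ν ≤
      2 * ENNReal.ofReal V * ∫⁻ y in Icc (0:ℝ) 2, f y := by
    have hset : MeasurableSet {p : ℝ × ℝ | p.2 ∈ Icc p.1 (p.1 + κ)} := by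
      have h1 : MeasurableSet {p : ℝ × ℝ | p.1 ≤ p.2} := measurableSet_le measurable_fst measurable_snd
      have h2 : MeasurableSet {p : ℝ × ℝ | p.2 ≤ p.1 + κ} :=
        measurableSet_le measurable_snd (measurable_fst.add_const κ)
      exact h1.inter h2
    rw [lintegral_lintegral_swap]
    · rw [← lintegral_const_mul _ hfm]
      apply lintegral_mono
      intro y
      have e : ∀ x, (Icc x (x + κ)).indicator (fun y => 2 * f y) y =
          (Icc (y - κ) y).indicator (fun _ => 2 * f y) x := by
        intro x
        by_cases h : y ∈ Icc x (x + κ)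
        · rw [indicator_of_mem h, indicator_of_mem]
          exact ⟨by linarith [h.2], h.1⟩
        · rw [indicator_of_notMem h, indicator_of_notMem]
          intro h'
          exact h ⟨h'.2, by linarith [h'.1]⟩
      simp only [e]
      rw [lintegral_indicator measurableSet_Icc, setLIntegral_const]
      have : ν (Icc (y - κ) y) ≤ ENNReal.ofReal V := by
        rw [← ofReal_measureReal]
        exact ENNReal.ofReal_le_ofReal (hV y)
      calc 2 * f y * ν (Icc (y - κ) y) ≤ 2 * f y * ENNReal.ofReal V := by gcongr
        _ = _ := by ring
    · have : Function.uncurry (fun x y => (Icc x (x + κ)).indicator (fun y => 2 * f y) y) =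
          {p : ℝ × ℝ | p.2 ∈ Icc p.1 (p.1 + κ)}.indicator (fun p => 2 * f p.2) := by
        ext ⟨x, y⟩
        simp only [Function.uncurry, indicator, mem_ofPred_eq]
      rw [this]
      exact (((hfm.comp measurable_snd).const_mul 2).indicator hset).aemeasurable
  have hfin : ∫⁻ y in Icc (0:ℝ) 2, f y = ENNReal.ofReal (∫ x in (0:ℝ)..2, ‖F x‖ ^ 2) := by
    rw [intervalIntegral.integral_of_le (by norm_num), ← integral_Icc_eq_integral_Ioc,
      ofReal_integral_eq_lintegral_ofReal]
    · refine Measure.integrableOn_of_bounded (M := A ^ 2) measure_Icc_lt_top.ne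
        (hF.norm.pow_const 2).aestronglyMeasurable ?_
      filter_upwards [ae_restrict_mem measurableSet_Icc] with x hx
      rw [Real.norm_of_nonneg (by positivity)]
      exact pow_le_pow_left₀ (norm_nonneg _) (hA x hx) 2
    · exact ae_of_all _ fun x => by positivity
  have hI0 : 0 ≤ ∫ x in (0:ℝ)..2, ‖F x‖ ^ 2 :=
    intervalIntegral.integral_nonneg (by norm_num) fun x _ => by positivity
  have hmain : (∫⁻ x, f x ∂ν) * ENNReal.ofReal κ ≤
      2 * ENNReal.ofReal V * ENNReal.ofReal (∫ x in (0:ℝ)..2, ‖F x‖ ^ 2) +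
        c * ENNReal.ofReal κ * ν univ := by
    rw [← lintegral_mul_const _ hfm, ← hfin]
    calc _ ≤ ∫⁻ x, ((∫⁻ y in Icc (0:ℝ) 2, (Icc x (x + κ)).indicator (fun y => 2 * f y) y) +
          c * ENNReal.ofReal κ) ∂ν := by
          apply lintegral_mono_ae
          filter_upwards [hν] with x hx using hpt x hx
      _ ≤ _ := by
          rw [lintegral_add_right _ measurable_const, lintegral_const]
          gcongr
  rw [integral_eq_lintegral_of_nonneg_ae (ae_of_all _ fun x => by positivity)
    (hF.norm.pow_const 2).aestronglyMeasurable]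
  have hRHS : 2 * ENNReal.ofReal V * ENNReal.ofReal (∫ x in (0:ℝ)..2, ‖F x‖ ^ 2) +
        c * ENNReal.ofReal κ * ν univ = ENNReal.ofReal
      (2 * V * (∫ x in (0:ℝ)..2, ‖F x‖ ^ 2) + 2 * (κ * M) ^ 2 * κ * ν.real univ) := by
    rw [ENNReal.ofReal_add (by positivity) (by positivity), ENNReal.ofReal_mul (by positivity),
      ENNReal.ofReal_mul (by positivity), ENNReal.ofReal_mul (by positivity),
      ENNReal.ofReal_mul (by positivity), ofReal_measureReal, ENNReal.ofReal_ofNat]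
  rw [hRHS] at hmain
  have h3 := ENNReal.toReal_mono ENNReal.ofReal_ne_top hmain
  rw [ENNReal.toReal_mul, ENNReal.toReal_ofReal hκ.le, ENNReal.toReal_ofReal (by positivity)] at h3
  have h4 : 2 * (κ * M) ^ 2 * ν.real univ + 2 / κ * V * (∫ x in (0:ℝ)..2, ‖F x‖ ^ 2) =
      (2 * V * (∫ x in (0:ℝ)..2, ‖F x‖ ^ 2) + 2 * (κ * M) ^ 2 * κ * ν.real univ) / κ := by
    field_simp; ring
  rw [h4, le_div_iff₀ hκ]
  exact h3

/-- The exponential sum over words with coefficients `c`. -/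
noncomputable def expSum (ξ : ℝ) (G : Finset (List ℕ)) (c : List ℕ → ℝ) (x : ℝ) : ℂ :=
  ∑ a ∈ G, (c a : ℂ) * eF ξ (invBranch a x)

lemma measurable_expSum (ξ : ℝ) (G : Finset (List ℕ)) (c : List ℕ → ℝ) :
    Measurable (expSum ξ G c) := by
  unfold expSum
  exact Finset.measurable_sum _ fun a _ =>
    ((continuous_eF ξ).measurable.comp (measurable_invBranch a)).const_mul _

lemma norm_expSum_le {ξ : ℝ} {G : Finset (List ℕ)} {c : List ℕ → ℝ} (hc : ∀ a ∈ G, 0 ≤ c a)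
    (x : ℝ) : ‖expSum ξ G c x‖ ≤ ∑ a ∈ G, c a := by
  refine (norm_sum_le _ _).trans (Finset.sum_le_sum fun a ha => ?_)
  rw [norm_mul, norm_eF, mul_one, Complex.norm_real, Real.norm_of_nonneg (hc a ha)]

lemma norm_expSum_sub_le {ξ q₀ : ℝ} {G : Finset (List ℕ)} {c : List ℕ → ℝ}
    (hc : ∀ a ∈ G, 0 ≤ c a) (hpos : ∀ a ∈ G, PosWord a) (hq₀ : 0 < q₀)
    (hq : ∀ a ∈ G, q₀ ≤ qden a) {x y : ℝ} (hx : 0 ≤ x) (hy : 0 ≤ y) :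
    ‖expSum ξ G c x - expSum ξ G c y‖ ≤
      (2 * π * |ξ| / q₀ ^ 2 * ∑ a ∈ G, c a) * |x - y| := by
  unfold expSum
  rw [← Finset.sum_sub_distrib, Finset.mul_sum, Finset.sum_mul]
  refine (norm_sum_le _ _).trans (Finset.sum_le_sum fun a ha => ?_)
  rw [← mul_sub, norm_mul, Complex.norm_real, Real.norm_of_nonneg (hc a ha)]
  have h1 := abs_invBranch_sub_le (hpos a ha) hx hy
  have h2 : |x - y| / (qden a : ℝ) ^ 2 ≤ |x - y| / q₀ ^ 2 := by
    have := hq a ha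
    gcongr
  calc c a * ‖eF ξ (invBranch a x) - eF ξ (invBranch a y)‖
      ≤ c a * (2 * π * |ξ| * (|x - y| / q₀ ^ 2)) := by
        apply mul_le_mul_of_nonneg_left _ (hc a ha)
        refine (norm_eF_sub_le _ _ _).trans ?_
        exact mul_le_mul_of_nonneg_left (h1.trans h2) (by positivity)
    _ = _ := by ring

lemma integral_norm_expSum_sq_le {ξ : ℝ} {G : Finset (List ℕ)} {c : List ℕ → ℝ}
    (hc : ∀ a ∈ G, 0 ≤ c a) (hpos : ∀ a ∈ G, PosWord a) :
    ∫ x in (0:ℝ)..2, ‖expSum ξ G c x‖ ^ 2 ≤ ∑ b ∈ G, c b * ∑ a ∈ G, c a *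
      ‖∫ x in (0:ℝ)..2, Complex.exp (((2 * π * ξ * (invBranch b x - invBranch a x) : ℝ) : ℂ) *
        Complex.I)‖ := by
  have hcont : ∀ a ∈ G, ContinuousOn (invBranch a) (uIcc 0 2) := fun a ha =>
    (continuousOn_invBranch (hpos a ha)).mono fun x hx => by
      rw [uIcc_of_le (by norm_num)] at hx; exact hx.1
  have hintegr : ∀ a ∈ G, ∀ b ∈ G, IntervalIntegrable (fun x =>
      Complex.exp (((2 * π * ξ * (invBranch b x - invBranch a x) : ℝ) : ℂ) * Complex.I))
      volume 0 2 := by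
    intro a ha b hb
    apply ContinuousOn.intervalIntegrable
    have := hcont a ha
    have := hcont b hb
    fun_prop
  have hsq : ∀ x, ((‖expSum ξ G c x‖ ^ 2 : ℝ) : ℂ) = ∑ b ∈ G, ∑ a ∈ G, ((c b * c a : ℝ) : ℂ) *
      Complex.exp (((2 * π * ξ * (invBranch b x - invBranch a x) : ℝ) : ℂ) * Complex.I) := by
    intro x
    rw [← Complex.normSq_eq_norm_sq, ← Complex.mul_conj]
    unfold expSum
    rw [map_sum, Finset.sum_mul_sum, Finset.sum_comm]
    refine Finset.sum_congr rfl fun b _ => Finset.sum_congr rfl fun a _ => ?_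
    rw [← eF_mul_conj, map_mul, Complex.conj_ofReal]
    push_cast; ring
  have h1 : ((∫ x in (0:ℝ)..2, ‖expSum ξ G c x‖ ^ 2 : ℝ) : ℂ) =
      ∑ b ∈ G, ∑ a ∈ G, ((c b * c a : ℝ) : ℂ) * ∫ x in (0:ℝ)..2,
        Complex.exp (((2 * π * ξ * (invBranch b x - invBranch a x) : ℝ) : ℂ) * Complex.I) := by
    rw [← intervalIntegral.integral_ofReal]
    simp only [hsq]
    rw [intervalIntegral.integral_finsetSum]
    · refine Finset.sum_congr rfl fun b hb => ?_
      rw [intervalIntegral.integral_finsetSum]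
      · refine Finset.sum_congr rfl fun a ha => ?_
        rw [intervalIntegral.integral_const_mul]
      · exact fun a ha => (hintegr a ha b hb).const_mul _
    · intro b hb
      have := IntervalIntegrable.sum G
        (fun a ha => (hintegr a ha b hb).const_mul ((c b * c a : ℝ) : ℂ))
      rwa [Finset.sum_fn] at this
  refine (le_abs_self _).trans ?_
  rw [← Real.norm_eq_abs, ← Complex.norm_real, h1]
  refine (norm_sum_le _ _).trans (Finset.sum_le_sum fun b hb => ?_)
  rw [Finset.mul_sum]
  refine (norm_sum_le _ _).trans (Finset.sum_le_sum fun a ha => ?_)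
  rw [norm_mul, Complex.norm_real, Real.norm_of_nonneg (mul_nonneg (hc b hb) (hc a ha)), mul_assoc]

section

lemma le_layer_sum {Λ A δ J : ℝ} (hA : 0 ≤ A) (hJ2 : J ≤ 2)
    (hJ : 0 < δ → J ≤ A / Real.sqrt δ) {m₀ n : ℕ} (hmn : m₀ ≤ n) :
    J ≤ A * Real.exp (Λ * m₀) +
      (∑ m ∈ Finset.Ico m₀ n,
        if δ ≤ Real.exp (-(2 * Λ * m)) then A * Real.exp (Λ * (m + 1)) else 0) +
      if δ ≤ Real.exp (-(2 * Λ * n)) then 2 else 0 := by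
  have hlarge : ∀ m : ℕ, ¬ δ ≤ Real.exp (-(2 * Λ * m)) → J ≤ A * Real.exp (Λ * m) := by
    intro m hm
    push Not at hm
    have hδ : 0 < δ := (Real.exp_pos _).trans hm
    refine (hJ hδ).trans ?_
    rw [div_le_iff₀ (Real.sqrt_pos.2 hδ), mul_assoc]
    have h1 : Real.exp (-(Λ * m)) ≤ Real.sqrt δ := by
      apply Real.le_sqrt_of_sq_le
      rw [← Real.exp_nat_mul]
      refine le_trans (le_of_eq ?_) hm.le
      congr 1; push_cast; ring
    have h2 : 1 ≤ Real.exp (Λ * m) * Real.sqrt δ := by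
      calc (1:ℝ) = Real.exp (Λ * m) * Real.exp (-(Λ * m)) := by rw [← Real.exp_add]; simp
        _ ≤ _ := by gcongr
    nlinarith
  induction n, hmn using Nat.le_induction with
  | base =>
    simp only [Finset.Ico_self, Finset.sum_empty, add_zero]
    have := Real.exp_pos (Λ * m₀)
    split_ifs with h
    · nlinarith [mul_nonneg hA this.le]
    · linarith [hlarge m₀ h]
  | succ n hmn ih =>
    rw [Finset.sum_Ico_succ_top hmn]
    have h0 : 0 ≤ ∑ m ∈ Finset.Ico m₀ n,
        if δ ≤ Real.exp (-(2 * Λ * m)) then A * Real.exp (Λ * (m + 1)) else 0 :=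
      Finset.sum_nonneg fun m _ => by split_ifs <;> positivity
    have h1 : 0 ≤ A * Real.exp (Λ * m₀) := by positivity
    have h2 : 0 ≤ A * Real.exp (Λ * (n + 1)) := by positivity
    by_cases hb : δ ≤ Real.exp (-(2 * Λ * (n + 1 : ℕ)))
    · rw [if_pos hb]
      split_ifs <;> linarith
    · rw [if_neg hb]
      by_cases hc : δ ≤ Real.exp (-(2 * Λ * n))
      · rw [if_pos hc]
        have := hlarge _ hb
        push_cast at this
        linarith
      · rw [if_neg hc] at ih ⊢
        linarith

variable {φ : ℝ → ℝ} {μ : Measure ℝ} {B θ C Λ s ε : ℝ}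

/-- The constant coming from the oscillatory integral estimate. -/
noncomputable def oscC : ℝ := 18 * 27 * 8748 * 128

lemma norm_phase_regular_le {n : ℕ} {ξ : ℝ}
    (hξ : Real.exp (4 * Λ * n) ≤ ξ) {a b : List ℕ} (ha : RegWord μ C Λ s ε a)
    (hb : RegWord μ C Λ s ε b) (hla : a.length = n) (hlb : b.length = n)
    (hne : 0 < |ratio a - ratio b|) :
    ‖∫ x in (0:ℝ)..2, Complex.exp (((2 * π * ξ * (invBranch a x - invBranch b x) : ℝ) : ℂ) *
      Complex.I)‖ ≤ oscC * Real.exp ((17 * ε - Λ) * n) / Real.sqrt |ratio a - ratio b| := by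
  have hξ0 : 0 < ξ := (Real.exp_pos _).trans_le hξ
  have la := ha.lower
  have ua := ha.upper
  have lb := hb.lower
  have ub := hb.upper
  rw [hla] at la ua
  rw [hlb] at lb ub
  set q₀ := Real.exp ((Λ - ε) * n) / 2 with hq₀
  set q₁ := Real.exp ((Λ + ε) * n) with hq₁
  have hq₀0 : 0 < q₀ := by positivity
  have hq₁0 : 0 < q₁ := by positivity
  have key := norm_integral_phase_le ha.pos hb.pos (hla.trans hlb.symm) hq₀0 la lb ua ub hξ0
    (fun h => by rw [h, sub_self, abs_zero] at hne; exact lt_irrefl _ hne)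
  refine key.trans ?_
  have hη : (Real.exp ((Λ - 3 * ε) * n) / 18) ^ 2 ≤ ξ * q₀ ^ 2 / (81 * q₁ ^ 4) := by
    have e : (Real.exp ((Λ - 3 * ε) * n) / 18) ^ 2 =
        Real.exp (4 * Λ * n) * q₀ ^ 2 / (81 * q₁ ^ 4) := by
      rw [eq_div_iff (by positivity), hq₀, hq₁, div_pow, div_pow, ← Real.exp_nat_mul,
        ← Real.exp_nat_mul, ← Real.exp_nat_mul]
      rw [show Real.exp ((2:ℕ) * ((Λ - 3 * ε) * n)) / 18 ^ 2 *
        (81 * Real.exp ((4:ℕ) * ((Λ + ε) * n))) =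
        (Real.exp ((2:ℕ) * ((Λ - 3 * ε) * n)) * Real.exp ((4:ℕ) * ((Λ + ε) * n))) / 4 by ring,
        ← mul_div_assoc, ← Real.exp_add, ← Real.exp_add]
      norm_num
      ring
    rw [e]
    gcongr
  rw [Real.sqrt_mul (by positivity), ← div_div]
  apply div_le_div_of_nonneg_right _ (Real.sqrt_nonneg _)
  have h1 : Real.exp ((Λ - 3 * ε) * n) / 18 ≤ Real.sqrt (ξ * q₀ ^ 2 / (81 * q₁ ^ 4)) :=
    Real.le_sqrt_of_sq_le hη
  have hr : q₁ / q₀ = 2 * Real.exp (2 * ε * n) := by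
    rw [div_eq_iff hq₀0.ne', hq₀, hq₁, show (Λ + ε) * n = (Λ - ε) * n + 2 * ε * n by ring, Real.exp_add]
    ring
  calc _ ≤ 27 * (8748 * (q₁ / q₀) ^ 7) / (Real.exp ((Λ - 3 * ε) * n) / 18) := by
        apply div_le_div_of_nonneg_left (by positivity) (by positivity) h1
    _ = _ := by
        rw [hr, mul_pow, ← Real.exp_nat_mul, div_eq_iff (by positivity), oscC]
        rw [show 18 * 27 * 8748 * 128 * Real.exp ((17 * ε - Λ) * n) *
          (Real.exp ((Λ - 3 * ε) * n) / 18) = 27 * 8748 * 128 *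
          (Real.exp ((17 * ε - Λ) * n) * Real.exp ((Λ - 3 * ε) * n)) by ring, ← Real.exp_add,
          show (17 * ε - Λ) * n + (Λ - 3 * ε) * n = (7:ℕ) * (2 * ε * n) by push_cast; ring]
        ring

lemma sum_phase_le [IsProbabilityMeasure μ] (hinv : MeasurePreserving gaussMap μ μ)
    (hC : 0 ≤ C) (hΛ : 0 < Λ) (hε : 0 ≤ ε) (hεs : 2 * ε ≤ (2 * s - 1) * Λ)
    {G : Finset (List ℕ)} {m₀ n : ℕ} (hmn : m₀ ≤ n) (hlen : ∀ a ∈ G, a.length = n)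
    (hreg : ∀ a ∈ G, ∀ m, m₀ ≤ m → m ≤ n → RegWord μ C Λ s ε (a.drop (n - m)))
    {ξ : ℝ} (hξ : Real.exp (4 * Λ * n) ≤ ξ) {b : List ℕ} (hb : b ∈ G) :
    ∑ a ∈ G, μ.real (_root_.cylinder a) *
      ‖∫ x in (0:ℝ)..2, Complex.exp (((2 * π * ξ * (invBranch b x - invBranch a x) : ℝ) : ℂ) *
        Complex.I)‖ ≤
      (oscC * (1 + 10 * C * Real.exp Λ) + 20 * C) * (n + 1) * Real.exp (Λ * m₀) *
        Real.exp ((17 * ε - Λ) * n) := by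
  have hra : ∀ a ∈ G, RegWord μ C Λ s ε a := fun a ha => by
    simpa using hreg a ha n hmn le_rfl
  have hosc : 0 < oscC := by unfold oscC; norm_num
  set A := oscC * Real.exp ((17 * ε - Λ) * n) with hA
  have hA0 : 0 ≤ A := by positivity
  set J : List ℕ → ℝ := fun a => ‖∫ x in (0:ℝ)..2,
    Complex.exp (((2 * π * ξ * (invBranch b x - invBranch a x) : ℝ) : ℂ) * Complex.I)‖ with hJ
  have hJ2 : ∀ a, J a ≤ 2 := by
    intro a
    have := intervalIntegral.norm_integral_le_of_norm_le_const (a := (0:ℝ)) (b := 2) (C := 1)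
      (f := fun x => Complex.exp (((2 * π * ξ * (invBranch b x - invBranch a x) : ℝ) : ℂ) *
        Complex.I)) (fun x _ => (Complex.norm_exp_ofReal_mul_I _).le)
    rwa [sub_zero, abs_two, one_mul] at this
  have hlay : ∀ a ∈ G, J a ≤ A * Real.exp (Λ * m₀) +
      (∑ m ∈ Finset.Ico m₀ n, if |ratio a - ratio b| ≤ Real.exp (-(2 * Λ * m)) then
        A * Real.exp (Λ * (m + 1)) else 0) +
      if |ratio a - ratio b| ≤ Real.exp (-(2 * Λ * n)) then 2 else 0 := by
    intro a ha
    apply le_layer_sum hA0 (hJ2 a) _ hmn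
    intro hne
    rw [abs_sub_comm] at hne ⊢
    exact norm_phase_regular_le hξ (hra b hb) (hra a ha) (hlen b hb) (hlen a ha) hne
  have hdisj : ∑ a ∈ G, μ.real (_root_.cylinder a) ≤ 1 := by
    rw [← measureReal_biUnion_finset]
    · exact measureReal_le_one
    · intro a ha b hb hab
      exact cylinder_disjoint ((hlen a ha).trans (hlen b hb).symm) hab
    · exact fun w _ => measurableSet_cylinder w
  have hnear : ∀ m, m₀ ≤ m → m ≤ n → ∀ t : ℝ, 0 ≤ t → ∑ a ∈ G, μ.real (_root_.cylinder a) *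
      (if |ratio a - ratio b| ≤ Real.exp (-(2 * Λ * m)) then t else 0) ≤
      t * (10 * C * Real.exp ((2 * ε - 2 * s * Λ) * m)) := by
    intro m hm hm' t ht
    have h1 := sum_measure_ratio_le (G := G.filter fun a =>
      |ratio a - ratio b| ≤ Real.exp (-(2 * Λ * m))) hinv hC hε hm'
      (fun a ha => (hra a (Finset.mem_filter.1 ha).1).pos)
      (fun a ha => hlen a (Finset.mem_filter.1 ha).1)
      (fun a ha => hreg a (Finset.mem_filter.1 ha).1 m hm hm') (ratio b)
      (fun a ha => (Finset.mem_filter.1 ha).2)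
    simp only [mul_ite, mul_zero]
    rw [← Finset.sum_filter, ← Finset.sum_mul, mul_comm]
    exact mul_le_mul_of_nonneg_left h1 ht
  have hexp1 : ∀ m : ℕ, Real.exp (Λ * (m + 1)) * Real.exp ((2 * ε - 2 * s * Λ) * m) ≤
      Real.exp Λ := by
    intro m
    rw [← Real.exp_add]
    apply Real.exp_le_exp.2
    have : 0 ≤ ((2 * s - 1) * Λ - 2 * ε) * m :=
      mul_nonneg (by linarith) (Nat.cast_nonneg _)
    nlinarith
  have hexp2 : Real.exp ((2 * ε - 2 * s * Λ) * n) ≤ Real.exp ((17 * ε - Λ) * n) := by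
    apply Real.exp_le_exp.2
    apply mul_le_mul_of_nonneg_right _ (Nat.cast_nonneg _)
    nlinarith
  have hn1 : (1:ℝ) ≤ n + 1 := by linarith [(Nat.cast_nonneg n : (0:ℝ) ≤ n)]
  have hm1 : 1 ≤ Real.exp (Λ * m₀) := Real.one_le_exp (by positivity)
  calc ∑ a ∈ G, μ.real (_root_.cylinder a) * J a
      ≤ ∑ a ∈ G, μ.real (_root_.cylinder a) * (A * Real.exp (Λ * m₀) +
      (∑ m ∈ Finset.Ico m₀ n, if |ratio a - ratio b| ≤ Real.exp (-(2 * Λ * m)) then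
        A * Real.exp (Λ * (m + 1)) else 0) +
      if |ratio a - ratio b| ≤ Real.exp (-(2 * Λ * n)) then 2 else 0) :=
        Finset.sum_le_sum fun a ha =>
          mul_le_mul_of_nonneg_left (hlay a ha) measureReal_nonneg
    _ = (∑ a ∈ G, μ.real (_root_.cylinder a)) * (A * Real.exp (Λ * m₀)) +
        (∑ m ∈ Finset.Ico m₀ n, ∑ a ∈ G, μ.real (_root_.cylinder a) *
          (if |ratio a - ratio b| ≤ Real.exp (-(2 * Λ * m)) then
            A * Real.exp (Λ * (m + 1)) else 0)) +
        ∑ a ∈ G, μ.real (_root_.cylinder a) *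
          (if |ratio a - ratio b| ≤ Real.exp (-(2 * Λ * n)) then 2 else 0) := by
        simp only [mul_add, Finset.sum_add_distrib, Finset.mul_sum, Finset.sum_mul]
        rw [Finset.sum_comm (s := G)]
    _ ≤ 1 * (A * Real.exp (Λ * m₀)) + (∑ m ∈ Finset.Ico m₀ n, A * (10 * C * Real.exp Λ)) +
        2 * (10 * C * Real.exp ((17 * ε - Λ) * n)) := by
        refine add_le_add (add_le_add ?_ ?_) ?_
        · exact mul_le_mul_of_nonneg_right hdisj (by positivity)
        · refine Finset.sum_le_sum fun m hm => ?_
          rw [Finset.mem_Ico] at hm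
          refine (hnear m hm.1 hm.2.le _ (by positivity)).trans ?_
          calc _ = A * (10 * C * (Real.exp (Λ * (m + 1)) *
                Real.exp ((2 * ε - 2 * s * Λ) * m))) := by ring
            _ ≤ _ := by
                apply mul_le_mul_of_nonneg_left _ hA0
                exact mul_le_mul_of_nonneg_left (hexp1 m) (by positivity)
        · refine (hnear n hmn le_rfl 2 (by norm_num)).trans ?_
          apply mul_le_mul_of_nonneg_left _ (by norm_num)
          exact mul_le_mul_of_nonneg_left hexp2 (by positivity)
    _ ≤ _ := by
        rw [Finset.sum_const, Nat.card_Ico, nsmul_eq_mul]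
        have hc : ((n - m₀ : ℕ) : ℝ) ≤ n := by exact_mod_cast Nat.sub_le n m₀
        have hX : 1 ≤ (n + 1) * Real.exp (Λ * m₀) := by nlinarith
        have hX2 : (n:ℝ) ≤ (n + 1) * Real.exp (Λ * m₀) := by nlinarith
        have hX3 : Real.exp (Λ * m₀) ≤ (n + 1) * Real.exp (Λ * m₀) := by nlinarith
        set X := (n + 1) * Real.exp (Λ * m₀) with hXdef
        set Y := Real.exp ((17 * ε - Λ) * n) with hY
        have hY0 : 0 < Y := Real.exp_pos _
        have t1 : A * Real.exp (Λ * m₀) ≤ A * X := mul_le_mul_of_nonneg_left hX3 hA0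
        have t2 : ((n - m₀ : ℕ) : ℝ) * (A * (10 * C * Real.exp Λ)) ≤
            X * (A * (10 * C * Real.exp Λ)) :=
          mul_le_mul_of_nonneg_right (hc.trans hX2) (by positivity)
        have t3 : 2 * (10 * C * Y) ≤ X * (2 * (10 * C * Y)) := le_mul_of_one_le_left (by positivity) hX
        calc _ ≤ A * X + X * (A * (10 * C * Real.exp Λ)) + X * (2 * (10 * C * Y)) := by linarith
          _ = _ := by rw [hA, hXdef]; ring

end

section RegularPart

variable {μ : Measure ℝ} {C Λ s ε : ℝ}

/-- The points whose first `n` digits form a regular word. -/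
def regPart (μ : Measure ℝ) (C Λ s ε : ℝ) (n : ℕ) : Set ℝ :=
  {x | x ∈ gaussSet ∧ RegWord μ C Λ s ε (word n x)}

lemma regPart_eq (n : ℕ) :
    regPart μ C Λ s ε n = ⋃ w ∈ regFinset μ C Λ s ε n, _root_.cylinder w := by
  ext x
  simp only [regPart, mem_ofPred_eq, mem_iUnion, exists_prop, mem_regFinset]
  constructor
  · rintro ⟨hx, hr⟩
    exact ⟨word n x, ⟨hr, length_word n x⟩, mem_cylinder_word n hx⟩
  · rintro ⟨w, ⟨hr, rfl⟩, hx⟩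
    have h := mem_cylinder_iff.1 hx
    exact ⟨h.1, by rw [h.2]; exact hr⟩

lemma measurableSet_regPart (n : ℕ) : MeasurableSet (regPart μ C Λ s ε n) := by
  rw [regPart_eq]
  exact Finset.measurableSet_biUnion _ fun w _ => measurableSet_cylinder w

lemma sum_measure_cylinder_le_one [IsProbabilityMeasure μ] {G : Finset (List ℕ)} {n : ℕ}
    (hG : ∀ a ∈ G, a.length = n) : ∑ a ∈ G, μ.real (_root_.cylinder a) ≤ 1 := by
  rw [← measureReal_biUnion_finset (h := fun _ _ => measure_ne_top _ _)
    (fun a ha b hb hab => cylinder_disjoint ((hG a ha).trans (hG b hb).symm) hab)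
    (fun a _ => measurableSet_cylinder a)]
  exact measureReal_le_one

/-- The constant in the mean square bound for the exponential sums. -/
noncomputable def meanSqC (C Λ : ℝ) : ℝ :=
  2 * (8 * π * C * Real.exp (4 * Λ)) ^ 2 +
    12 * C ^ 3 * (oscC * (1 + 10 * C * Real.exp Λ) + 20 * C)

lemma meanSqC_nonneg (hC : 0 ≤ C) : 0 ≤ meanSqC C Λ := by
  have : 0 < oscC := by unfold oscC; norm_num
  unfold meanSqC
  positivity

lemma integral_norm_expSum_sq_regPart_le [IsProbabilityMeasure μ]
    (hinv : MeasurePreserving gaussMap μ μ)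
    (hC : 0 ≤ C) (hΛ : 0 < Λ) (hε : 0 ≤ ε) (hεs : 22 * ε ≤ (2 * s - 1) * Λ)
    {G : Finset (List ℕ)} {m₀ n : ℕ} (hmn : m₀ ≤ n) (hlen : ∀ a ∈ G, a.length = n)
    (hreg : ∀ a ∈ G, ∀ m, m₀ ≤ m → m ≤ n → RegWord μ C Λ s ε (a.drop (n - m)))
    {ξ : ℝ} (hξ : Real.exp (4 * Λ * n) ≤ ξ) (hξ' : ξ ≤ Real.exp (4 * Λ * (n + 1)))
    {c : List ℕ → ℝ} (hc : ∀ a ∈ G, 0 ≤ c a)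
    (hcC : ∀ a ∈ G, c a ≤ C * μ.real (_root_.cylinder a)) :
    ∫ x in regPart μ C Λ s ε n, ‖expSum ξ G c x‖ ^ 2 ∂μ ≤
      meanSqC C Λ * (n + 1) * Real.exp (Λ * m₀) * Real.exp (-(2 * ε * n)) := by
  have hosc : 0 < oscC := by unfold oscC; norm_num
  have hξ0 : 0 < ξ := (Real.exp_pos _).trans_le hξ
  have hregG : ∀ a ∈ G, RegWord μ C Λ s ε a := fun a ha => by
    simpa using hreg a ha n hmn le_rfl
  have hpos : ∀ a ∈ G, PosWord a := fun a ha => (hregG a ha).pos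
  have hsumμ := sum_measure_cylinder_le_one (μ := μ) hlen
  have hsumc : ∑ a ∈ G, c a ≤ C := by
    calc ∑ a ∈ G, c a ≤ ∑ a ∈ G, C * μ.real (_root_.cylinder a) := Finset.sum_le_sum hcC
      _ = C * ∑ a ∈ G, μ.real (_root_.cylinder a) := by rw [Finset.mul_sum]
      _ ≤ C * 1 := by gcongr
      _ = C := mul_one C
  have hsumc0 : 0 ≤ ∑ a ∈ G, c a := Finset.sum_nonneg hc
  set q₀ : ℝ := Real.exp ((Λ - ε) * n) / 2 with hq₀
  have hq₀pos : 0 < q₀ := by positivity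
  have hq : ∀ a ∈ G, q₀ ≤ qden a := fun a ha => by
    have := (hregG a ha).lower
    rwa [hlen a ha] at this
  set κ : ℝ := Real.exp (-((2 * Λ + 3 * ε) * n)) with hκ
  have hκpos : 0 < κ := Real.exp_pos _
  have hκ1 : κ ≤ 1 := Real.exp_le_one_iff.2 (by
    have : (0:ℝ) ≤ (2 * Λ + 3 * ε) * n := by positivity
    linarith)
  set M : ℝ := 2 * π * |ξ| / q₀ ^ 2 * ∑ a ∈ G, c a with hM
  have hM0 : 0 ≤ M := by positivity
  have hκM : κ * M ≤ 8 * π * C * Real.exp (4 * Λ) * Real.exp (-(ε * n)) := by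
    have h1 : M ≤ 2 * π * Real.exp (4 * Λ * (n + 1)) / q₀ ^ 2 * C := by
      rw [hM, abs_of_pos hξ0]; gcongr
    refine (mul_le_mul_of_nonneg_left h1 hκpos.le).trans (le_of_eq ?_)
    have e1 : q₀ ^ 2 = Real.exp (2 * ((Λ - ε) * n)) / 4 := by
      rw [hq₀, div_pow, ← Real.exp_nat_mul]; norm_num
    rw [e1, hκ]
    have e2 : Real.exp (-((2 * Λ + 3 * ε) * n)) * Real.exp (4 * Λ * (n + 1)) =
        Real.exp (4 * Λ) * Real.exp (-(ε * n)) * Real.exp (2 * ((Λ - ε) * n)) := by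
      simp only [← Real.exp_add]; congr 1; ring
    have e3 := Real.exp_pos (2 * ((Λ - ε) * n))
    calc _ = 8 * π * C * (Real.exp (-((2 * Λ + 3 * ε) * n)) * Real.exp (4 * Λ * (n + 1))) /
          Real.exp (2 * ((Λ - ε) * n)) := by
          generalize Real.exp (2 * ((Λ - ε) * n)) = Y at e3
          generalize Real.exp (4 * Λ * (n + 1)) = Z
          field_simp
          ring
      _ = _ := by
          rw [e2]
          generalize Real.exp (2 * ((Λ - ε) * n)) = Y at e3
          field_simp
  set V : ℝ := 6 * C * Real.exp (-(2 * s * Λ * n)) with hV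
  have hV0 : 0 ≤ V := by positivity
  set ν := μ.restrict (regPart μ C Λ s ε n) with hν
  have hmE := measurableSet_regPart (μ := μ) (C := C) (Λ := Λ) (s := s) (ε := ε) n
  have hνV : ∀ y, ν.real (Icc (y - κ) y) ≤ V := fun y => by
    have h1 := measure_interval_regular_le (μ := μ) (Λ := Λ) (s := s) (ε := ε) hC n
      (u := y - κ) (v := y) (by linarith)
    have h2 : ν.real (Icc (y - κ) y) =
        μ.real {x | x ∈ Icc (y - κ) y ∧ x ∈ gaussSet ∧ RegWord μ C Λ s ε (word n x)} := by
      rw [hν, measureReal_restrict_apply measurableSet_Icc]; rfl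
    rw [h2]
    refine h1.trans ?_
    have h3 : Real.exp (2 * (Λ + ε) * n) * κ ≤ 1 := by
      rw [hκ, ← Real.exp_add]
      refine Real.exp_le_one_iff.2 ?_
      have : (0:ℝ) ≤ ε * n := by positivity
      nlinarith
    have h4 : 4 * Real.exp (2 * (Λ + ε) * n) * (y - (y - κ)) + 2 ≤ 6 := by
      rw [sub_sub_cancel]; linarith
    calc _ ≤ 6 * (C * Real.exp (-(2 * s * Λ * n))) :=
          mul_le_mul_of_nonneg_right h4 (by positivity)
      _ = V := by rw [hV]; ring
  have hν01 : ∀ᵐ x ∂ν, x ∈ Icc (0:ℝ) 1 :=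
    (ae_restrict_mem hmE).mono fun x hx => hx.1.1
  have key := integral_sq_le_of_interval_bound (ν := ν) hν01 (measurable_expSum ξ G c)
    (M := M) (A := ∑ a ∈ G, c a) (κ := κ) (V := V)
    (fun x _ => norm_expSum_le hc x)
    (fun x hx y hy => norm_expSum_sub_le hc hpos hq₀pos hq hx.1 hy.1)
    hκpos hκ1 hV0 hM0 hνV
  refine key.trans ?_
  set K₁ : ℝ := oscC * (1 + 10 * C * Real.exp Λ) + 20 * C with hK₁
  have hK₁0 : 0 ≤ K₁ := by positivity
  set R : ℝ := (n + 1) * Real.exp (Λ * m₀) with hR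
  have hR0 : 0 ≤ R := by positivity
  have hR1 : 1 ≤ R := by
    have h1 : (1:ℝ) ≤ n + 1 := by linarith [n.cast_nonneg (α := ℝ)]
    have h2 : 1 ≤ Real.exp (Λ * m₀) := Real.one_le_exp (by positivity)
    nlinarith
  have hJ : ∫ x in (0:ℝ)..2, ‖expSum ξ G c x‖ ^ 2 ≤
      C ^ 2 * (K₁ * R * Real.exp ((17 * ε - Λ) * n)) := by
    refine (integral_norm_expSum_sq_le hc hpos).trans ?_
    have h1 : ∀ b ∈ G, c b * ∑ a ∈ G, c a *
      ‖∫ x in (0:ℝ)..2, Complex.exp (((2 * π * ξ * (invBranch b x - invBranch a x) : ℝ) : ℂ) *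
        Complex.I)‖ ≤ c b * (C * (K₁ * R * Real.exp ((17 * ε - Λ) * n))) := fun b hb => by
      refine mul_le_mul_of_nonneg_left ?_ (hc b hb)
      have h2 := sum_phase_le hinv hC hΛ hε (by linarith : 2 * ε ≤ (2 * s - 1) * Λ) hmn hlen hreg
        hξ hb
      calc _ ≤ ∑ a ∈ G, C * (μ.real (_root_.cylinder a) *
            ‖∫ x in (0:ℝ)..2, Complex.exp
              (((2 * π * ξ * (invBranch b x - invBranch a x) : ℝ) : ℂ) * Complex.I)‖) := by
            refine Finset.sum_le_sum fun a ha => ?_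
            rw [← mul_assoc]
            exact mul_le_mul_of_nonneg_right (hcC a ha) (norm_nonneg _)
        _ = C * ∑ a ∈ G, μ.real (_root_.cylinder a) *
            ‖∫ x in (0:ℝ)..2, Complex.exp
              (((2 * π * ξ * (invBranch b x - invBranch a x) : ℝ) : ℂ) * Complex.I)‖ := by
            rw [Finset.mul_sum]
        _ ≤ C * (K₁ * R * Real.exp ((17 * ε - Λ) * n)) := by
            refine mul_le_mul_of_nonneg_left (h2.trans (le_of_eq ?_)) hC
            rw [hR, hK₁]; ring
    refine (Finset.sum_le_sum h1).trans ?_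
    rw [← Finset.sum_mul]
    calc _ ≤ C * (C * (K₁ * R * Real.exp ((17 * ε - Λ) * n))) :=
          mul_le_mul_of_nonneg_right hsumc (by positivity)
      _ = _ := by ring
  have hexp2 : Real.exp (-(ε * n)) ^ 2 = Real.exp (-(2 * ε * n)) := by
    rw [← Real.exp_nat_mul]; congr 1; push_cast; ring
  have hT1 : 2 * (κ * M) ^ 2 * ν.real univ ≤
      2 * (8 * π * C * Real.exp (4 * Λ)) ^ 2 * R * Real.exp (-(2 * ε * n)) := by
    have h1 : ν.real univ ≤ 1 := by
      rw [hν, measureReal_restrict_apply_univ]; exact measureReal_le_one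
    have h2 : (κ * M) ^ 2 ≤ (8 * π * C * Real.exp (4 * Λ) * Real.exp (-(ε * n))) ^ 2 :=
      pow_le_pow_left₀ (by positivity) hκM 2
    rw [mul_pow (8 * π * C * Real.exp (4 * Λ)), hexp2] at h2
    calc 2 * (κ * M) ^ 2 * ν.real univ ≤ 2 * (κ * M) ^ 2 * 1 :=
          mul_le_mul_of_nonneg_left h1 (by positivity)
      _ ≤ 2 * ((8 * π * C * Real.exp (4 * Λ)) ^ 2 * Real.exp (-(2 * ε * n))) * R := by
          have : 0 ≤ 2 * ((8 * π * C * Real.exp (4 * Λ)) ^ 2 * Real.exp (-(2 * ε * n))) := by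
            positivity
          nlinarith
      _ = _ := by ring
  have hT2 : 2 / κ * V * ∫ x in (0:ℝ)..2, ‖expSum ξ G c x‖ ^ 2 ≤
      12 * C ^ 3 * K₁ * R * Real.exp (-(2 * ε * n)) := by
    have e1 : 1 / κ * Real.exp (-(2 * s * Λ * n)) * Real.exp ((17 * ε - Λ) * n) ≤
        Real.exp (-(2 * ε * n)) := by
      rw [hκ, one_div, ← Real.exp_neg, ← Real.exp_add, ← Real.exp_add]
      refine Real.exp_le_exp.2 ?_
      have : 0 ≤ ((2 * s - 1) * Λ - 22 * ε) * n :=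
        mul_nonneg (by linarith) n.cast_nonneg
      linarith
    calc _ ≤ 2 / κ * V * (C ^ 2 * (K₁ * R * Real.exp ((17 * ε - Λ) * n))) :=
          mul_le_mul_of_nonneg_left hJ (by positivity)
      _ = 12 * C ^ 3 * K₁ * R *
          (1 / κ * Real.exp (-(2 * s * Λ * n)) * Real.exp ((17 * ε - Λ) * n)) := by
          rw [hV]; ring
      _ ≤ _ := mul_le_mul_of_nonneg_left e1 (by positivity)
  calc _ ≤ _ := add_le_add hT1 hT2
    _ = _ := by rw [meanSqC, hR, ← hK₁]; ring

/-- Words all of whose suffixes of length at least `m₀` are regular. -/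
noncomputable def goodWords (μ : Measure ℝ) (C Λ s ε : ℝ) (m₀ n : ℕ) : Finset (List ℕ) :=
  (regFinset μ C Λ s ε n).filter
    fun a => ∀ m, m₀ ≤ m → m ≤ n → RegWord μ C Λ s ε (a.drop (n - m))

lemma drop_word {m n : ℕ} (hmn : m ≤ n) (x : ℝ) :
    (word n x).drop (n - m) = word m (gaussMap^[n - m] x) := by
  have h := word_add (n - m) m x
  rw [Nat.sub_add_cancel hmn] at h
  rw [h, List.drop_append_of_le_length (by rw [length_word]),
    List.drop_of_length_le (by rw [length_word]), List.nil_append]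

lemma word_mem_goodWords {m₀ n : ℕ} (hmn : m₀ ≤ n) {x : ℝ} :
    word n x ∈ goodWords μ C Λ s ε m₀ n ↔
      ∀ m, m₀ ≤ m → m ≤ n → RegWord μ C Λ s ε (word m (gaussMap^[n - m] x)) := by
  rw [goodWords, Finset.mem_filter, mem_regFinset]
  constructor
  · intro h m h1 h2
    rw [← drop_word h2]; exact h.2 m h1 h2
  · intro h
    refine ⟨⟨by simpa using h n hmn le_rfl, length_word n x⟩, fun m h1 h2 => ?_⟩
    rw [drop_word h2]; exact h m h1 h2

lemma measure_not_goodWords_le [IsProbabilityMeasure μ]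
    (hinv : MeasurePreserving gaussMap μ μ) {K ρ : ℝ} (hK : 0 ≤ K) (hρ : ρ ∈ Ioo (0:ℝ) 1)
    (h : ∀ n, μ.real {x | x ∈ gaussSet ∧ ¬ RegWord μ C Λ s ε (word n x)} ≤ K * ρ ^ n)
    {m₀ n : ℕ} (hmn : m₀ ≤ n) :
    μ.real {x | x ∈ gaussSet ∧ word n x ∉ goodWords μ C Λ s ε m₀ n} ≤
      K * (ρ ^ m₀ / (1 - ρ)) := by
  have hms : ∀ m, MeasurableSet {x | x ∈ gaussSet ∧ ¬ RegWord μ C Λ s ε (word m x)} := fun m => by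
    have : {x | x ∈ gaussSet ∧ ¬ RegWord μ C Λ s ε (word m x)} =
        gaussSet \ regPart μ C Λ s ε m := by
      ext x; simp only [regPart, mem_ofPred_eq, Set.mem_sdiff]; tauto
    rw [this]
    exact measurableSet_gaussSet.diff (measurableSet_regPart m)
  have hsub : {x | x ∈ gaussSet ∧ word n x ∉ goodWords μ C Λ s ε m₀ n} ⊆
      ⋃ m ∈ Finset.Ico m₀ (n + 1), (gaussMap^[n - m]) ⁻¹'
        {x | x ∈ gaussSet ∧ ¬ RegWord μ C Λ s ε (word m x)} := by
    rintro x ⟨hx, hn⟩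
    rw [word_mem_goodWords hmn] at hn
    push Not at hn
    obtain ⟨m, h1, h2, h3⟩ := hn
    simp only [mem_iUnion]
    exact ⟨m, Finset.mem_Ico.2 ⟨h1, by omega⟩, iterate_mem hx _, h3⟩
  refine (measureReal_mono hsub (measure_ne_top _ _)).trans ?_
  refine (measureReal_biUnion_finset_le _ _).trans ?_
  have h1 : ∀ m ∈ Finset.Ico m₀ (n + 1), μ.real ((gaussMap^[n - m]) ⁻¹'
        {x | x ∈ gaussSet ∧ ¬ RegWord μ C Λ s ε (word m x)}) ≤ K * ρ ^ m := fun m _ => by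
    rw [measureReal_def, (hinv.iterate (n - m)).measure_preimage (hms m).nullMeasurableSet]
    exact h m
  refine (Finset.sum_le_sum h1).trans ?_
  rw [← Finset.mul_sum]
  exact mul_le_mul_of_nonneg_left (geom_sum_Ico_le_of_lt_one hρ.1.le hρ.2) hK

end RegularPart

section Decay

variable {μ : Measure ℝ} {φ : ℝ → ℝ} {B θ C Λ s ε : ℝ}

lemma GibbsSys.setIntegral_cylinder_eF [IsProbabilityMeasure μ] (S : GibbsSys φ μ B θ C) {l : List ℕ} (hl : PosWord l)
    (ξ : ℝ) : ∫ x in _root_.cylinder l, eF ξ x ∂μ =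
      ∫ x, (wt φ l x : ℂ) * eF ξ (invBranch l x) ∂μ := by
  rw [S.restrict_cylinder hl, integral_map (measurable_invBranch l).aemeasurable
    (continuous_eF ξ).aestronglyMeasurable,
    integral_withDensity_eq_integral_toReal_smul (f := fun x => ENNReal.ofReal (wt φ l x))
      (ENNReal.measurable_ofReal.comp (measurable_wt S.meas l))
      (ae_of_all _ fun x => ENNReal.ofReal_lt_top)]
  refine integral_congr_ae (ae_of_all _ fun x => ?_)
  simp only [ENNReal.toReal_ofReal (wt_pos φ l x).le, Complex.real_smul]

lemma GibbsSys.wt_le (S : GibbsSys φ μ B θ C) {l : List ℕ} (hl : PosWord l) {x : ℝ}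
    (hx : x ∈ gaussSet) : wt φ l x ≤ C * μ.real (_root_.cylinder l) :=
  (S.gibbs l hl x hx).1

lemma GibbsSys.integrable_wt_eF [IsProbabilityMeasure μ] (S : GibbsSys φ μ B θ C) {l : List ℕ}
    (hl : PosWord l) (ξ : ℝ) :
    Integrable (fun x => (wt φ l x : ℂ) * eF ξ (invBranch l x)) μ := by
  refine Integrable.of_bound (C := C * μ.real (_root_.cylinder l)) ?_ ?_
  · exact ((Complex.measurable_ofReal.comp (measurable_wt S.meas l)).mul
      ((continuous_eF ξ).measurable.comp (measurable_invBranch l))).aestronglyMeasurable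
  · filter_upwards [S.ae_mem] with x hx
    rw [norm_mul, norm_eF, mul_one, Complex.norm_real, Real.norm_of_nonneg (wt_pos φ l x).le]
    exact S.wt_le hl hx

lemma GibbsSys.norm_muFourier_le [IsProbabilityMeasure μ] (S : GibbsSys φ μ B θ C)
    {G : Finset (List ℕ)} {n : ℕ} (hpos : ∀ a ∈ G, PosWord a) (hlen : ∀ a ∈ G, a.length = n)
    (ξ : ℝ) : ‖muFourier μ ξ‖ ≤ μ.real {x | x ∈ gaussSet ∧ word n x ∉ G} +
      ∫ x, ‖expSum ξ G (fun a => wt φ a x) x‖ ∂μ := by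
  have hintegr : Integrable (eF ξ) μ := Integrable.of_bound (C := 1)
    (continuous_eF ξ).aestronglyMeasurable (ae_of_all _ fun x => (norm_eF ξ x).le)
  set U : Set ℝ := ⋃ a ∈ G, _root_.cylinder a with hU
  have hUm : MeasurableSet U := Finset.measurableSet_biUnion _ fun a _ => measurableSet_cylinder a
  rw [muFourier_eq, ← integral_add_compl hUm hintegr, add_comm]
  refine (norm_add_le _ _).trans (add_le_add ?_ ?_)
  · refine (norm_setIntegral_le_of_norm_le_const (measure_lt_top _ _)
      fun x _ => (norm_eF ξ x).le).trans ?_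
    rw [one_mul]
    refine ENNReal.toReal_mono (measure_ne_top _ _) (measure_mono_ae ?_)
    filter_upwards [S.ae_mem] with x hx hxU
    refine ⟨hx, fun hG => hxU ?_⟩
    exact mem_biUnion (x := word n x) hG (mem_cylinder_word n hx)
  · rw [hU, integral_biUnion_finset G (fun a _ => measurableSet_cylinder a)
      (fun a ha b hb hab => cylinder_disjoint ((hlen a ha).trans (hlen b hb).symm) hab)
      (fun a _ => hintegr.integrableOn),
      Finset.sum_congr rfl fun a ha => S.setIntegral_cylinder_eF (hpos a ha) ξ,
      ← integral_finsetSum _ fun a ha => S.integrable_wt_eF (hpos a ha) ξ]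
    exact norm_integral_le_integral_norm _

lemma GibbsSys.norm_expSum_wt_le (S : GibbsSys φ μ B θ C) [IsProbabilityMeasure μ]
    {G : Finset (List ℕ)} {n : ℕ} (hpos : ∀ a ∈ G, PosWord a) (hlen : ∀ a ∈ G, a.length = n)
    (ξ : ℝ) {x : ℝ} (hx : x ∈ gaussSet) (y : ℝ) :
    ‖expSum ξ G (fun a => wt φ a x) y‖ ≤ C := by
  refine (norm_expSum_le (fun a _ => (wt_pos φ a x).le) y).trans ?_
  calc ∑ a ∈ G, wt φ a x ≤ ∑ a ∈ G, C * μ.real (_root_.cylinder a) :=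
        Finset.sum_le_sum fun a ha => S.wt_le (hpos a ha) hx
    _ = C * ∑ a ∈ G, μ.real (_root_.cylinder a) := by rw [Finset.mul_sum]
    _ ≤ C * 1 := mul_le_mul_of_nonneg_left (sum_measure_cylinder_le_one hlen) S.C_pos.le
    _ = C := mul_one C

/-- The distortion constant for the weights. -/
noncomputable def wtC (B θ : ℝ) : ℝ := distC B θ * Real.exp (2 * distC B θ)

lemma GibbsSys.norm_expSum_wt_sub_le (S : GibbsSys φ μ B θ C) [IsProbabilityMeasure μ]
    {G : Finset (List ℕ)} {n k : ℕ} (hpos : ∀ a ∈ G, PosWord a) (hlen : ∀ a ∈ G, a.length = n)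
    (ξ : ℝ) {x y : ℝ} (hx : x ∈ gaussSet) (hy : y ∈ gaussSet) (h : word k x = word k y) (z : ℝ) :
    ‖expSum ξ G (fun a => wt φ a x) z - expSum ξ G (fun a => wt φ a y) z‖ ≤
      C * wtC B θ * θ ^ k := by
  have hD : 0 < wtC B θ := mul_pos S.distC_pos (Real.exp_pos _)
  have e : expSum ξ G (fun a => wt φ a x) z - expSum ξ G (fun a => wt φ a y) z =
      ∑ a ∈ G, ((wt φ a x - wt φ a y : ℝ) : ℂ) * eF ξ (invBranch a z) := by
    simp only [expSum, ← Finset.sum_sub_distrib, Complex.ofReal_sub, sub_mul]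
  rw [e]
  refine (norm_sum_le _ _).trans ?_
  have h1 : ∀ a ∈ G, ‖((wt φ a x - wt φ a y : ℝ) : ℂ) * eF ξ (invBranch a z)‖ ≤
      wtC B θ * θ ^ k * (C * μ.real (_root_.cylinder a)) := fun a ha => by
    rw [norm_mul, norm_eF, mul_one, Complex.norm_real, Real.norm_eq_abs]
    refine (S.abs_wt_sub_le (hpos a ha) hx hy h).trans ?_
    exact mul_le_mul_of_nonneg_left (S.wt_le (hpos a ha) hx)
      (mul_nonneg hD.le (pow_nonneg S.θ_pos.le _))
  refine (Finset.sum_le_sum h1).trans ?_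
  rw [← Finset.mul_sum, ← Finset.mul_sum]
  have h2 := sum_measure_cylinder_le_one (μ := μ) hlen
  calc _ ≤ wtC B θ * θ ^ k * (C * 1) := by
        refine mul_le_mul_of_nonneg_left (mul_le_mul_of_nonneg_left h2 S.C_pos.le)
          (mul_nonneg hD.le (pow_nonneg S.θ_pos.le _))
    _ = _ := by ring

lemma integrable_norm_expSum [IsProbabilityMeasure μ] (ξ : ℝ) (G : Finset (List ℕ))
    {c : List ℕ → ℝ} (hc : ∀ a ∈ G, 0 ≤ c a) : Integrable (fun x => ‖expSum ξ G c x‖) μ :=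
  Integrable.of_bound (C := ∑ a ∈ G, c a) (measurable_expSum ξ G c).norm.aestronglyMeasurable
    (ae_of_all _ fun x => by rw [norm_norm]; exact norm_expSum_le hc x)

lemma integral_norm_expSum_regPart_le [IsProbabilityMeasure μ]
    (hinv : MeasurePreserving gaussMap μ μ)
    (hC : 0 ≤ C) (hΛ : 0 < Λ) (hε : 0 ≤ ε) (hεs : 22 * ε ≤ (2 * s - 1) * Λ)
    {G : Finset (List ℕ)} {m₀ n : ℕ} (hmn : m₀ ≤ n) (hlen : ∀ a ∈ G, a.length = n)
    (hreg : ∀ a ∈ G, ∀ m, m₀ ≤ m → m ≤ n → RegWord μ C Λ s ε (a.drop (n - m)))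
    {ξ : ℝ} (hξ : Real.exp (4 * Λ * n) ≤ ξ) (hξ' : ξ ≤ Real.exp (4 * Λ * (n + 1)))
    {c : List ℕ → ℝ} (hc : ∀ a ∈ G, 0 ≤ c a)
    (hcC : ∀ a ∈ G, c a ≤ C * μ.real (_root_.cylinder a)) :
    ∫ x in regPart μ C Λ s ε n, ‖expSum ξ G c x‖ ∂μ ≤
      (1 + meanSqC C Λ) * (n + 1) * Real.exp (Λ * m₀) * Real.exp (-(ε * n)) := by
  have h := integral_norm_expSum_sq_regPart_le hinv hC hΛ hε hεs hmn hlen hreg hξ hξ' hc hcC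
  set t := Real.exp (-(ε * n)) with ht
  have ht0 : 0 < t := Real.exp_pos _
  have ht2 : Real.exp (-(2 * ε * n)) = t * t := by rw [ht, ← Real.exp_add]; congr 1; ring
  rw [ht2] at h
  have hI1 : IntegrableOn (fun x => ‖expSum ξ G c x‖) (regPart μ C Λ s ε n) μ :=
    (integrable_norm_expSum ξ G hc).integrableOn
  have hI2 : IntegrableOn (fun x => ‖expSum ξ G c x‖ ^ 2) (regPart μ C Λ s ε n) μ := by
    refine (Integrable.of_bound (C := (∑ a ∈ G, c a) ^ 2)
      ((measurable_expSum ξ G c).norm.pow_const 2).aestronglyMeasurable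
      (ae_of_all _ fun x => ?_)).integrableOn
    rw [norm_pow, norm_norm]
    exact pow_le_pow_left₀ (norm_nonneg _) (norm_expSum_le hc x) 2
  have hcst : IntegrableOn (fun _ => t) (regPart μ C Λ s ε n) μ := by simp
  have h1 : ∫ x in regPart μ C Λ s ε n, ‖expSum ξ G c x‖ ∂μ ≤
      ∫ x in regPart μ C Λ s ε n, (t + t⁻¹ * ‖expSum ξ G c x‖ ^ 2) ∂μ := by
    refine setIntegral_mono hI1 (hcst.add (hI2.const_mul _)) fun x => ?_
    generalize ‖expSum ξ G c x‖ = r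
    have : t + t⁻¹ * r ^ 2 - r = t⁻¹ * ((r - t / 2) ^ 2 + 3 / 4 * t ^ 2) := by field_simp; ring
    have h2 : 0 ≤ t⁻¹ * ((r - t / 2) ^ 2 + 3 / 4 * t ^ 2) := by positivity
    linarith
  rw [integral_add hcst (hI2.const_mul _), integral_const_mul, setIntegral_const,
    smul_eq_mul] at h1
  have h3 : μ.real (regPart μ C Λ s ε n) * t ≤ 1 * t :=
    mul_le_mul_of_nonneg_right measureReal_le_one ht0.le
  have h4 := mul_le_mul_of_nonneg_left h (inv_pos.2 ht0).le
  have h5 : t⁻¹ * (meanSqC C Λ * (n + 1) * Real.exp (Λ * m₀) * (t * t)) =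
      meanSqC C Λ * (n + 1) * Real.exp (Λ * m₀) * t := by field_simp
  have h6 : 1 ≤ ((n:ℝ) + 1) * Real.exp (Λ * m₀) := by
    have h1 : (1:ℝ) ≤ n + 1 := by linarith [n.cast_nonneg (α := ℝ)]
    have h2 : 1 ≤ Real.exp (Λ * m₀) := Real.one_le_exp (by positivity)
    nlinarith
  have h7 : 1 * t ≤ ((n:ℝ) + 1) * Real.exp (Λ * m₀) * t := mul_le_mul_of_nonneg_right h6 ht0.le
  have h8 : (1 + meanSqC C Λ) * (n + 1) * Real.exp (Λ * m₀) * t =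
    ((n:ℝ) + 1) * Real.exp (Λ * m₀) * t + meanSqC C Λ * (n + 1) * Real.exp (Λ * m₀) * t := by ring
  rw [h5] at h4
  linarith

end Decay

section Decay

variable {μ : Measure ℝ} {φ : ℝ → ℝ} {B θ C Λ s ε : ℝ}

lemma GibbsSys.integral_norm_expSum_wt_le [IsProbabilityMeasure μ] (S : GibbsSys φ μ B θ C)
    (hΛ : 0 < Λ) (hε : 0 ≤ ε) (hεs : 22 * ε ≤ (2 * s - 1) * Λ)
    {K ρ : ℝ}
    (h : ∀ n, μ.real {x | x ∈ gaussSet ∧ ¬ RegWord μ C Λ s ε (word n x)} ≤ K * ρ ^ n)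
    {G : Finset (List ℕ)} {m₀ n : ℕ} (hmn : m₀ ≤ n) (hlen : ∀ a ∈ G, a.length = n)
    (hreg : ∀ a ∈ G, ∀ m, m₀ ≤ m → m ≤ n → RegWord μ C Λ s ε (a.drop (n - m)))
    {ξ : ℝ} (hξ : Real.exp (4 * Λ * n) ≤ ξ) (hξ' : ξ ≤ Real.exp (4 * Λ * (n + 1))) :
    ∫ x, ‖expSum ξ G (fun a => wt φ a x) x‖ ∂μ ≤
      C * (K * ρ ^ m₀) + C * (K * ρ ^ n) + C * wtC B θ * θ ^ m₀ +
      (6 * Real.exp (2 * (Λ + ε) * m₀)) *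
        ((1 + meanSqC C Λ) * (n + 1) * Real.exp (Λ * m₀) * Real.exp (-(ε * n))) := by
  obtain ⟨x₀, hx₀⟩ := exists_mem_gaussSet
  have hC := S.C_pos
  have hpos : ∀ a ∈ G, PosWord a := fun a ha => by
    simpa using (hreg a ha n hmn le_rfl).pos
  set R := regFinset μ C Λ s ε m₀ with hR
  have hRpos : ∀ d ∈ R, PosWord d := fun d hd => (mem_regFinset.1 hd).1.pos
  have hRlen : ∀ d ∈ R, d.length = m₀ := fun d hd => (mem_regFinset.1 hd).2
  set E := fun m => regPart μ C Λ s ε m with hE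
  have hEm : ∀ m, MeasurableSet (E m) := fun m => measurableSet_regPart m
  have hEc : ∀ m, μ.real (E m)ᶜ ≤ K * ρ ^ m := fun m => by
    refine le_trans (ENNReal.toReal_mono (measure_ne_top _ _) (measure_mono_ae ?_)) (h m)
    filter_upwards [S.ae_mem] with x hx hxE
    exact ⟨hx, fun hr => hxE ⟨hx, hr⟩⟩
  set F : List ℕ → ℝ → ℂ := fun d => expSum ξ G (fun a => wt φ a (invBranch d x₀)) with hF
  have hmem : ∀ d ∈ R, invBranch d x₀ ∈ gaussSet := fun d hd => invBranch_mem (hRpos d hd) hx₀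
  have hbound : ∀ x ∈ gaussSet, ‖expSum ξ G (fun a => wt φ a x) x‖ ≤
      (E m₀)ᶜ.indicator (fun _ => C) x + (E n)ᶜ.indicator (fun _ => C) x +
        C * wtC B θ * θ ^ m₀ + ∑ d ∈ R, (E n).indicator (fun x => ‖F d x‖) x := by
    intro x hx
    have hD : 0 ≤ C * wtC B θ * θ ^ m₀ :=
      mul_nonneg (mul_nonneg hC.le (mul_pos S.distC_pos (Real.exp_pos _)).le)
        (pow_nonneg S.θ_pos.le _)
    have i1 : 0 ≤ (E m₀)ᶜ.indicator (fun _ => C) x := indicator_nonneg (fun _ _ => hC.le) x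
    have i2 : 0 ≤ (E n)ᶜ.indicator (fun _ => C) x := indicator_nonneg (fun _ _ => hC.le) x
    have i3 : ∀ d ∈ R, 0 ≤ (E n).indicator (fun x => ‖F d x‖) x := fun d _ =>
      indicator_nonneg (fun _ _ => norm_nonneg _) x
    have i4 := Finset.sum_nonneg i3
    have htriv := S.norm_expSum_wt_le hpos hlen ξ hx x
    by_cases h1 : x ∈ E m₀
    · by_cases h2 : x ∈ E n
      · have hd : word m₀ x ∈ R := mem_regFinset.2 ⟨h1.2, length_word _ _⟩
        have hw : word m₀ x = word m₀ (invBranch (word m₀ x) x₀) := by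
          have := (mem_cylinder_iff.1 (invBranch_mem_cylinder (hRpos _ hd) hx₀)).2
          rw [hRlen _ hd] at this
          exact this.symm
        have h3 := S.norm_expSum_wt_sub_le hpos hlen ξ hx (hmem _ hd) hw x
        have h4 := Finset.single_le_sum i3 hd
        rw [indicator_of_mem h2] at h4
        have h5 := norm_le_norm_add_norm_sub' (expSum ξ G (fun a => wt φ a x) x)
          (F (word m₀ x) x)
        linarith
      · rw [indicator_of_mem (show x ∈ (E n)ᶜ from h2)] at i2 ⊢
        linarith
    · rw [indicator_of_mem (show x ∈ (E m₀)ᶜ from h1)] at i1 ⊢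
      linarith
  have hc0 : ∀ d, ∀ a ∈ G, 0 ≤ wt φ a (invBranch d x₀) := fun d a _ => (wt_pos φ a _).le
  have j1 : Integrable ((E m₀)ᶜ.indicator (fun _ => C)) μ :=
    (integrable_const C).indicator (hEm m₀).compl
  have j2 : Integrable ((E n)ᶜ.indicator (fun _ => C)) μ :=
    (integrable_const C).indicator (hEm n).compl
  have j3 : ∀ d ∈ R, Integrable ((E n).indicator (fun x => ‖F d x‖)) μ := fun d _ =>
    (integrable_norm_expSum ξ G (hc0 d)).indicator (hEm n)
  have j4 : Integrable (fun x => ∑ d ∈ R, (E n).indicator (fun x => ‖F d x‖) x) μ :=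
    integrable_finsetSum _ j3
  have j12 : Integrable (fun x => (E m₀)ᶜ.indicator (fun _ => C) x +
      (E n)ᶜ.indicator (fun _ => C) x) μ := j1.add j2
  have j123 : Integrable (fun x => (E m₀)ᶜ.indicator (fun _ => C) x +
      (E n)ᶜ.indicator (fun _ => C) x + C * wtC B θ * θ ^ m₀) μ := j12.add (integrable_const _)
  have hle : ∫ x, ‖expSum ξ G (fun a => wt φ a x) x‖ ∂μ ≤
      ∫ x, ((E m₀)ᶜ.indicator (fun _ => C) x + (E n)ᶜ.indicator (fun _ => C) x +
        C * wtC B θ * θ ^ m₀ + ∑ d ∈ R, (E n).indicator (fun x => ‖F d x‖) x) ∂μ :=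
    integral_mono_of_nonneg (ae_of_all _ fun x => norm_nonneg _)
      (j123.add j4) (S.ae_mem.mono hbound)
  refine hle.trans ?_
  rw [integral_add j123 j4,
    integral_add j12 (integrable_const _), integral_add j1 j2,
    integral_indicator (hEm m₀).compl, integral_indicator (hEm n).compl,
    setIntegral_const, setIntegral_const, integral_const, integral_finsetSum _ j3,
    probReal_univ, one_smul, smul_eq_mul, smul_eq_mul]
  have k1 : μ.real (E m₀)ᶜ * C ≤ C * (K * ρ ^ m₀) := by
    rw [mul_comm]; exact mul_le_mul_of_nonneg_left (hEc m₀) hC.le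
  have k2 : μ.real (E n)ᶜ * C ≤ C * (K * ρ ^ n) := by
    rw [mul_comm]; exact mul_le_mul_of_nonneg_left (hEc n) hC.le
  set W := (1 + meanSqC C Λ) * (n + 1) * Real.exp (Λ * m₀) * Real.exp (-(ε * n)) with hW
  have hW0 : 0 ≤ W := by
    have := meanSqC_nonneg (Λ := Λ) hC.le
    positivity
  have k3 : ∑ d ∈ R, ∫ x, (E n).indicator (fun x => ‖F d x‖) x ∂μ ≤
      (6 * Real.exp (2 * (Λ + ε) * m₀)) * W := by
    have h1 : ∀ d ∈ R, ∫ x, (E n).indicator (fun x => ‖F d x‖) x ∂μ ≤ W := fun d hd => by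
      rw [integral_indicator (hEm n)]
      exact integral_norm_expSum_regPart_le S.inv hC.le hΛ hε hεs hmn hlen hreg hξ hξ' (hc0 d)
        fun a ha => S.wt_le (hpos a ha) (hmem d hd)
    refine (Finset.sum_le_card_nsmul _ _ _ h1).trans ?_
    rw [nsmul_eq_mul]
    refine mul_le_mul_of_nonneg_right ?_ hW0
    have h2 := card_regFinset_le (μ := μ) (C := C) (Λ := Λ) (s := s) (ε := ε) m₀
    have h3 : 1 ≤ Real.exp (2 * (Λ + ε) * m₀) := Real.one_le_exp (by positivity)
    linarith
  linarith

lemma GibbsSys.norm_muFourier_le_of_scales [IsProbabilityMeasure μ] (S : GibbsSys φ μ B θ C)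
    (hΛ : 0 < Λ) (hε : 0 ≤ ε) (hεs : 22 * ε ≤ (2 * s - 1) * Λ)
    {K ρ : ℝ} (hK : 0 ≤ K) (hρ : ρ ∈ Ioo (0:ℝ) 1)
    (h : ∀ n, μ.real {x | x ∈ gaussSet ∧ ¬ RegWord μ C Λ s ε (word n x)} ≤ K * ρ ^ n)
    {m₀ n : ℕ} (hmn : m₀ ≤ n)
    {ξ : ℝ} (hξ : Real.exp (4 * Λ * n) ≤ ξ) (hξ' : ξ ≤ Real.exp (4 * Λ * (n + 1))) :
    ‖muFourier μ ξ‖ ≤ K * (ρ ^ m₀ / (1 - ρ)) +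
      (C * (K * ρ ^ m₀) + C * (K * ρ ^ n) + C * wtC B θ * θ ^ m₀ +
      (6 * Real.exp (2 * (Λ + ε) * m₀)) *
        ((1 + meanSqC C Λ) * (n + 1) * Real.exp (Λ * m₀) * Real.exp (-(ε * n)))) := by
  set G := goodWords μ C Λ s ε m₀ n with hG
  have hlen : ∀ a ∈ G, a.length = n := fun a ha =>
    (mem_regFinset.1 (Finset.mem_filter.1 ha).1).2
  have hpos : ∀ a ∈ G, PosWord a := fun a ha =>
    (mem_regFinset.1 (Finset.mem_filter.1 ha).1).1.pos
  refine (S.norm_muFourier_le hpos hlen ξ).trans (add_le_add ?_ ?_)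
  · exact measure_not_goodWords_le S.inv hK hρ h hmn
  · exact S.integral_norm_expSum_wt_le hΛ hε hεs h hmn hlen
      (fun a ha => (Finset.mem_filter.1 ha).2) hξ hξ'

lemma pow_floor_le {r γ : ℝ} (hr : r ∈ Ioo (0:ℝ) 1) (x : ℝ) :
    r ^ ⌊γ * x⌋₊ ≤ r⁻¹ * Real.exp (-(γ * -Real.log r) * x) := by
  have h := Nat.lt_floor_add_one (γ * x)
  have hl : Real.log r < 0 := Real.log_neg hr.1 hr.2
  have e1 : r ^ ⌊γ * x⌋₊ = Real.exp (Real.log r * ⌊γ * x⌋₊) := by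
    rw [mul_comm (Real.log r), Real.exp_nat_mul, Real.exp_log hr.1]
  have e2 : r⁻¹ = Real.exp (-Real.log r) := by rw [Real.exp_neg, Real.exp_log hr.1]
  rw [e1, e2, ← Real.exp_add]
  refine Real.exp_le_exp.2 ?_
  nlinarith

lemma GibbsSys.exists_muFourier_decay_nat [IsProbabilityMeasure μ] (S : GibbsSys φ μ B θ C)
    (hΛ : 0 < Λ) (hε : 0 < ε) (hεs : 22 * ε ≤ (2 * s - 1) * Λ)
    {K ρ : ℝ} (hK : 0 ≤ K) (hρ : ρ ∈ Ioo (0:ℝ) 1)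
    (h : ∀ n, μ.real {x | x ∈ gaussSet ∧ ¬ RegWord μ C Λ s ε (word n x)} ≤ K * ρ ^ n) :
    ∃ A > 0, ∃ β > 0, ∀ n : ℕ, ∀ ξ, Real.exp (4 * Λ * n) ≤ ξ →
      ξ ≤ Real.exp (4 * Λ * (n + 1)) → ‖muFourier μ ξ‖ ≤ A * Real.exp (-(β * n)) := by
  have hC := S.C_pos
  have hD : 0 < wtC B θ := mul_pos S.distC_pos (Real.exp_pos _)
  have hKW := meanSqC_nonneg (Λ := Λ) hC.le
  set r := max ρ θ with hr
  have hr01 : r ∈ Ioo (0:ℝ) 1 := ⟨lt_max_of_lt_left hρ.1, max_lt hρ.2 S.lt_one⟩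
  have hrl : 0 < -Real.log r := neg_pos.2 (Real.log_neg hr01.1 hr01.2)
  set γ := ε / (2 * (3 * Λ + 2 * ε)) with hγ
  have hγ0 : 0 < γ := by positivity
  have hγ1 : γ ≤ 1 := by
    rw [hγ, div_le_one (by positivity)]; linarith
  set β := min (γ * -Real.log r) (ε / 4) with hβ
  have hβ0 : 0 < β := lt_min (mul_pos hγ0 hrl) (by positivity)
  set A₁ := (K / (1 - ρ) + C * K + C * K + C * wtC B θ) * r⁻¹ with hA₁
  have h1ρ : 0 < 1 - ρ := by linarith [hρ.2]
  have hA₁0 : 0 ≤ A₁ := by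
    have := hr01.1
    positivity
  set A₂ := 6 * (1 + meanSqC C Λ) * (1 + 4 / ε) with hA₂
  have hA₂0 : 0 < A₂ := by positivity
  refine ⟨A₁ + A₂, by positivity, β, hβ0, fun n ξ hξ hξ' => ?_⟩
  set m₀ := ⌊γ * n⌋₊ with hm₀
  have hm₀le : (m₀:ℝ) ≤ γ * n := Nat.floor_le (by positivity)
  have hmn : m₀ ≤ n := by
    have : (m₀:ℝ) ≤ n := hm₀le.trans (mul_le_of_le_one_left n.cast_nonneg hγ1)
    exact_mod_cast this
  refine (S.norm_muFourier_le_of_scales hΛ hε.le hεs hK hρ h hmn hξ hξ').trans ?_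
  have hβn : Real.exp (-(γ * -Real.log r) * n) ≤ Real.exp (-(β * n)) := by
    refine Real.exp_le_exp.2 ?_
    have := mul_le_mul_of_nonneg_right (min_le_left (γ * -Real.log r) (ε / 4))
      (n.cast_nonneg (α := ℝ))
    linarith
  have hrm : r ^ m₀ ≤ r⁻¹ * Real.exp (-(β * n)) :=
    (pow_floor_le hr01 n).trans (mul_le_mul_of_nonneg_left hβn (inv_pos.2 hr01.1).le)
  have hρm : ρ ^ m₀ ≤ r ^ m₀ := pow_le_pow_left₀ hρ.1.le (le_max_left _ _) _
  have hρn : ρ ^ n ≤ r ^ m₀ := (pow_le_pow_of_le_one hρ.1.le hρ.2.le hmn).trans hρm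
  have hθm : θ ^ m₀ ≤ r ^ m₀ := pow_le_pow_left₀ S.θ_pos.le (le_max_right _ _) _
  have hT1 : K * (ρ ^ m₀ / (1 - ρ)) + (C * (K * ρ ^ m₀) + C * (K * ρ ^ n) +
      C * wtC B θ * θ ^ m₀) ≤ A₁ * Real.exp (-(β * n)) := by
    calc _ ≤ K * (r ^ m₀ / (1 - ρ)) + (C * (K * r ^ m₀) + C * (K * r ^ m₀) +
          C * wtC B θ * r ^ m₀) := by gcongr
      _ = (K / (1 - ρ) + C * K + C * K + C * wtC B θ) * r ^ m₀ := by ring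
      _ ≤ (K / (1 - ρ) + C * K + C * K + C * wtC B θ) * (r⁻¹ * Real.exp (-(β * n))) :=
          mul_le_mul_of_nonneg_left hrm (by positivity)
      _ = _ := by rw [hA₁]; ring
  have hexp : Real.exp (2 * (Λ + ε) * m₀) * Real.exp (Λ * m₀) * Real.exp (-(ε * n)) ≤
      Real.exp (-(ε / 2 * n)) := by
    rw [← Real.exp_add, ← Real.exp_add]
    refine Real.exp_le_exp.2 ?_
    have h1 := mul_le_mul_of_nonneg_left hm₀le (by positivity : 0 ≤ 3 * Λ + 2 * ε)
    have h2 : (3 * Λ + 2 * ε) * (γ * n) = ε / 2 * n := by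
      rw [hγ]; field_simp
    linarith
  have hn1 : (n:ℝ) + 1 ≤ (1 + 4 / ε) * Real.exp (ε / 4 * n) := by
    have h1 := Real.add_one_le_exp (ε / 4 * n)
    have h2 : 1 ≤ Real.exp (ε / 4 * n) := Real.one_le_exp (by positivity)
    have h3 : (n:ℝ) ≤ 4 / ε * Real.exp (ε / 4 * n) := by
      rw [div_mul_eq_mul_div, le_div_iff₀ hε]; linarith
    linarith
  have hε4 : Real.exp (-(ε / 4 * n)) ≤ Real.exp (-(β * n)) := by
    refine Real.exp_le_exp.2 ?_
    have := mul_le_mul_of_nonneg_right (min_le_right (γ * -Real.log r) (ε / 4))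
      (n.cast_nonneg (α := ℝ))
    linarith
  have hT2 : (6 * Real.exp (2 * (Λ + ε) * m₀)) *
        ((1 + meanSqC C Λ) * (n + 1) * Real.exp (Λ * m₀) * Real.exp (-(ε * n))) ≤
      A₂ * Real.exp (-(β * n)) := by
    calc _ = 6 * (1 + meanSqC C Λ) * ((n + 1) *
          (Real.exp (2 * (Λ + ε) * m₀) * Real.exp (Λ * m₀) * Real.exp (-(ε * n)))) := by ring
      _ ≤ 6 * (1 + meanSqC C Λ) * (((1 + 4 / ε) * Real.exp (ε / 4 * n)) *
          Real.exp (-(ε / 2 * n))) := by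
          refine mul_le_mul_of_nonneg_left ?_ (by positivity)
          exact mul_le_mul hn1 hexp (by positivity) (by positivity)
      _ = A₂ * Real.exp (-(ε / 4 * n)) := by
          have : Real.exp (ε / 4 * n) * Real.exp (-(ε / 2 * n)) = Real.exp (-(ε / 4 * n)) := by
            rw [← Real.exp_add]; congr 1; ring
          rw [hA₂, ← this]; ring
      _ ≤ _ := mul_le_mul_of_nonneg_left hε4 hA₂0.le
  linarith

/-- Polynomial decay of the Fourier transform. -/
lemma GibbsSys.exists_muFourier_decay [IsProbabilityMeasure μ] (S : GibbsSys φ μ B θ C)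
    (ht : PolyTail μ) {h : ℝ} (hent : HasEntropy μ h) (hdim : 1/2 < h / lyapunov μ) :
    ∃ A > (0:ℝ), ∃ c > (0:ℝ), ∀ ξ : ℝ, 1 ≤ ξ → ‖muFourier μ ξ‖ ≤ A * ξ ^ (-c) := by
  obtain ⟨Λ, hΛ, s, hs, hreg⟩ := S.exists_regular ht hent hdim
  have hs1 : 0 < 2 * s - 1 := by linarith
  obtain ⟨K, hK, ρ, hρ, hb⟩ := hreg ((2 * s - 1) * Λ / 22) (by positivity)
  obtain ⟨A, hA, β, hβ, hdec⟩ := S.exists_muFourier_decay_nat hΛ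
    (ε := (2 * s - 1) * Λ / 22) (by positivity) (by linarith) hK.le hρ hb
  refine ⟨A * Real.exp β, by positivity, β / (4 * Λ), by positivity, fun ξ hξ => ?_⟩
  have hξ0 : 0 < ξ := by linarith
  have hl0 : 0 ≤ Real.log ξ := Real.log_nonneg hξ
  set n := ⌊Real.log ξ / (4 * Λ)⌋₊ with hn
  have h1 : (n:ℝ) ≤ Real.log ξ / (4 * Λ) := Nat.floor_le (by positivity)
  have h2 : Real.log ξ / (4 * Λ) < n + 1 := Nat.lt_floor_add_one _
  have h1' := h1
  have h2' := h2
  rw [le_div_iff₀ (by positivity)] at h1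
  rw [div_lt_iff₀ (by positivity)] at h2
  refine (hdec n ξ ?_ ?_).trans ?_
  · rw [← Real.le_log_iff_exp_le hξ0]; linarith
  · rw [← Real.log_le_iff_le_exp hξ0]; linarith
  · rw [mul_assoc, Real.rpow_def_of_pos hξ0, ← Real.exp_add]
    refine mul_le_mul_of_nonneg_left (Real.exp_le_exp.2 ?_) hA.le
    have : Real.log ξ * -(β / (4 * Λ)) = -(β * (Real.log ξ / (4 * Λ))) := by ring
    rw [this]
    nlinarith

end Decay

lemma integral_fourier_of_ne_zero {m : ℤ} (hm : m ≠ 0) :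
    ∫ x : UnitAddCircle, fourier m x = 0 :=
  integral_eq_zero_of_add_right_eq_neg (μ := (volume : Measure UnitAddCircle))
    (fourier_add_half_inv_index hm one_pos)

/-- Weyl sums tending to zero force convergence of the averages of all continuous functions. -/
lemma tendsto_average_continuousMap {u : ℕ → ℝ}
    (h : ∀ m : ℤ, m ≠ 0 → Tendsto (fun N : ℕ =>
      (∑ k ∈ Finset.range N, fourier m (u k : UnitAddCircle)) / (N : ℂ)) atTop (𝓝 0))
    (f : C(UnitAddCircle, ℂ)) :
    Tendsto (fun N : ℕ => (∑ k ∈ Finset.range (N + 1), f (u k : UnitAddCircle)) / ((N + 1 : ℕ) : ℂ))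
      atTop (𝓝 (∫ x : UnitAddCircle, f x)) := by
  have hprob : IsProbabilityMeasure (volume : Measure UnitAddCircle) :=
    ⟨UnitAddCircle.measure_univ⟩
  have hintegr (g : C(UnitAddCircle, ℂ)) : Integrable (fun x => g x) (volume : Measure UnitAddCircle) :=
    g.continuous.integrable_of_hasCompactSupport (HasCompactSupport.of_compactSpace _)
  have hspan : ∀ g ∈ Submodule.span ℂ (range (@fourier 1)),
      Tendsto (fun N : ℕ => (∑ k ∈ Finset.range (N + 1), g (u k : UnitAddCircle)) /
        ((N + 1 : ℕ) : ℂ)) atTop (𝓝 (∫ x : UnitAddCircle, g x)) := by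
    intro g hg
    induction hg using Submodule.span_induction with
    | mem g hg =>
      obtain ⟨m, rfl⟩ := hg
      by_cases hm : m = 0
      · subst hm
        simp only [fourier_zero, Finset.sum_const, Finset.card_range, nsmul_eq_mul, mul_one,
          integral_const, probReal_univ, one_smul]
        refine tendsto_const_nhds.congr fun N => ?_
        rw [div_self]
        exact_mod_cast N.succ_ne_zero
      · rw [integral_fourier_of_ne_zero hm]
        exact (h m hm).comp (tendsto_add_atTop_nat 1)
    | zero => simp
    | add g₁ g₂ _ _ h₁ h₂ =>
      have := h₁.add h₂
      rw [← integral_add (hintegr g₁) (hintegr g₂)] at this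
      refine this.congr fun N => ?_
      simp only [ContinuousMap.add_apply, Finset.sum_add_distrib, add_div]
    | smul c g _ hg =>
      have := hg.const_mul c
      rw [← integral_const_mul] at this
      refine this.congr fun N => ?_
      simp only [ContinuousMap.smul_apply, smul_eq_mul, ← Finset.mul_sum, mul_div_assoc]
  rw [Metric.tendsto_atTop]
  intro ε hε
  have hf : f ∈ closure (Submodule.span ℂ (range (@fourier 1)) : Set C(UnitAddCircle, ℂ)) := by
    rw [← Submodule.topologicalClosure_coe, span_fourier_closure_eq_top]
    trivial
  obtain ⟨g, hg, hfg⟩ := Metric.mem_closure_iff.1 hf (ε / 3) (by positivity)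
  obtain ⟨N₀, hN₀⟩ := Metric.tendsto_atTop.1 (hspan g hg) (ε / 3) (by positivity)
  have hpt : ∀ x, ‖f x - g x‖ ≤ ε / 3 := fun x => by
    rw [← dist_eq_norm]
    exact (ContinuousMap.dist_apply_le_dist x).trans hfg.le
  refine ⟨N₀, fun N hN => ?_⟩
  have h1 : ‖(∑ k ∈ Finset.range (N + 1), f (u k : UnitAddCircle)) / ((N + 1 : ℕ) : ℂ) -
      (∑ k ∈ Finset.range (N + 1), g (u k : UnitAddCircle)) / ((N + 1 : ℕ) : ℂ)‖ ≤ ε / 3 := by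
    rw [← sub_div, ← Finset.sum_sub_distrib, norm_div, Complex.norm_natCast,
      div_le_iff₀ (by positivity)]
    refine (norm_sum_le_of_le _ fun k _ => hpt _).trans_eq ?_
    simp [mul_comm]
  have h2 : ‖(∫ x : UnitAddCircle, g x) - ∫ x : UnitAddCircle, f x‖ ≤ ε / 3 := by
    rw [← integral_sub (hintegr g) (hintegr f)]
    refine (norm_integral_le_of_norm_le_const (C := ε / 3) (ae_of_all _ fun x => ?_)).trans_eq ?_
    · rw [norm_sub_rev]; exact hpt x
    · simp
  have h3 := hN₀ N hN
  rw [dist_eq_norm] at h3 ⊢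
  calc _ = ‖((∑ k ∈ Finset.range (N + 1), f (u k : UnitAddCircle)) / ((N + 1 : ℕ) : ℂ) -
      (∑ k ∈ Finset.range (N + 1), g (u k : UnitAddCircle)) / ((N + 1 : ℕ) : ℂ)) +
      ((∑ k ∈ Finset.range (N + 1), g (u k : UnitAddCircle)) / ((N + 1 : ℕ) : ℂ) -
        ∫ x : UnitAddCircle, g x) + ((∫ x : UnitAddCircle, g x) - ∫ x : UnitAddCircle, f x)‖ := by
        congr 1; ring
    _ ≤ _ := norm_add₃_le
    _ < ε := by linarith

/-- The arc of the circle corresponding to `[a, b)`. -/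
def arc (a b : ℝ) : Set UnitAddCircle := (fun x : ℝ => (x : UnitAddCircle)) '' Ico a b

lemma coe_mem_arc_iff {a b : ℝ} (ha : 0 ≤ a) (hb : b ≤ 1) (x : ℝ) :
    (x : UnitAddCircle) ∈ arc a b ↔ Int.fract x ∈ Ico a b := by
  constructor
  · rintro ⟨y, hy, hyx⟩
    have hy' : y ∈ Ico (0:ℝ) (0 + 1) := ⟨ha.trans hy.1, by rw [zero_add]; exact hy.2.trans_le hb⟩
    have hx' : Int.fract x ∈ Ico (0:ℝ) (0 + 1) :=
      ⟨Int.fract_nonneg x, by rw [zero_add]; exact Int.fract_lt_one x⟩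
    have : y = Int.fract x := by
      refine (AddCircle.coe_eq_coe_iff_of_mem_Ico (p := (1:ℝ)) hy' hx').1 ?_
      rw [AddCircle.coe_fract]
      exact hyx
    rwa [← this]
  · intro hx
    exact ⟨Int.fract x, hx, AddCircle.coe_fract x⟩

lemma measurableSet_arc (a b : ℝ) : MeasurableSet (arc a b) := by
  rcases le_or_gt b a with h | h
  · rw [arc, Ico_eq_empty_of_le h, image_empty]
    exact MeasurableSet.empty
  · rw [arc, ← Ioo_insert_left h, image_insert_eq]
    exact (QuotientAddGroup.isOpenMap_coe _ isOpen_Ioo).measurableSet.insert _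

lemma volume_arc {a b : ℝ} (ha : 0 ≤ a) (hb : b ≤ 1) :
    volume (arc a b) = ENNReal.ofReal (b - a) := by
  have hmp := UnitAddCircle.measurePreserving_mk 0
  rw [← hmp.measure_preimage (measurableSet_arc a b).nullMeasurableSet]
  have hpre : (QuotientAddGroup.mk : ℝ → UnitAddCircle) ⁻¹' arc a b = {x | Int.fract x ∈ Ico a b} := by
    ext x
    exact coe_mem_arc_iff ha hb x
  have hms : MeasurableSet {x : ℝ | Int.fract x ∈ Ico a b} := measurable_fract measurableSet_Ico
  rw [hpre, Measure.restrict_apply hms, ← Real.volume_Ico]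
  apply measure_congr
  have h0 : ∀ᵐ x : ℝ, x ≠ 0 := by simp [ae_iff]
  have h1 : ∀ᵐ x : ℝ, x ≠ 1 := by simp [ae_iff]
  filter_upwards [h0, h1] with x hx0 hx1
  apply propext
  constructor
  · rintro ⟨hx, hx2⟩
    have : Int.fract x = x := Int.fract_eq_self.2 ⟨hx2.1.le, lt_of_le_of_ne (by linarith [hx2.2]) hx1⟩
    have hx' : Int.fract x ∈ Ico a b := hx
    rwa [this] at hx'
  · intro hx
    have hx' : x ∈ Ico a b := hx
    have : Int.fract x = x := Int.fract_eq_self.2 ⟨ha.trans hx'.1, hx'.2.trans_le hb⟩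
    refine ⟨?_, lt_of_le_of_ne (ha.trans hx'.1) hx0.symm, by linarith [hx'.2]⟩
    change Int.fract x ∈ Ico a b
    rwa [this]

lemma frontier_arc_subset (a b : ℝ) :
    frontier (arc a b) ⊆ {(a : UnitAddCircle), (b : UnitAddCircle)} := by
  have hcont : Continuous (fun x : ℝ => (x : UnitAddCircle)) := continuous_quotient_mk'
  have hcl : closure (arc a b) ⊆ (fun x : ℝ => (x : UnitAddCircle)) '' Icc a b :=
    closure_minimal (image_mono Ico_subset_Icc_self) (isCompact_Icc.image hcont).isClosed
  have hintegr : (fun x : ℝ => (x : UnitAddCircle)) '' Ioo a b ⊆ interior (arc a b) :=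
    interior_maximal (image_mono Ioo_subset_Ico_self)
      (QuotientAddGroup.isOpenMap_coe _ isOpen_Ioo)
  rintro z ⟨hz, hz'⟩
  obtain ⟨x, hx, rfl⟩ := hcl hz
  rcases hx.1.eq_or_lt with rfl | h1
  · exact Or.inl rfl
  rcases hx.2.eq_or_lt with rfl | h2
  · exact Or.inr rfl
  exact absurd (hintegr ⟨x, ⟨h1, h2⟩, rfl⟩) hz'

lemma volume_singleton_circle (z : UnitAddCircle) : volume ({z} : Set UnitAddCircle) = 0 := by
  refine le_antisymm (ENNReal.le_of_forall_pos_le_add fun ε hε _ => ?_) zero_le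
  have hε' : (0:ℝ) < ε := hε
  calc volume ({z} : Set UnitAddCircle) ≤ volume (Metric.closedBall z ((ε:ℝ) / 2)) :=
        measure_mono (singleton_subset_iff.2 (Metric.mem_closedBall_self (by positivity)))
    _ = ENNReal.ofReal (min 1 (2 * ((ε:ℝ) / 2))) := AddCircle.volume_closedBall 1 _
    _ ≤ ENNReal.ofReal (ε:ℝ) := ENNReal.ofReal_le_ofReal ((min_le_right _ _).trans (by linarith))
    _ ≤ 0 + ε := by simp

/-- The empirical measure of the first `N + 1` terms of a sequence. -/
noncomputable def empirical (u : ℕ → UnitAddCircle) (N : ℕ) : Measure UnitAddCircle :=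
  ((N + 1 : ℕ) : ℝ≥0∞)⁻¹ • ∑ k ∈ Finset.range (N + 1), Measure.dirac (u k)

lemma isProbabilityMeasure_empirical (u : ℕ → UnitAddCircle) (N : ℕ) :
    IsProbabilityMeasure (empirical u N) := by
  constructor
  rw [empirical, Measure.smul_apply, Measure.finsetSum_apply]
  simp only [measure_univ, Finset.sum_const, Finset.card_range, nsmul_eq_mul, mul_one, smul_eq_mul]
  exact ENNReal.inv_mul_cancel (by exact_mod_cast N.succ_ne_zero) (ENNReal.natCast_ne_top _)

lemma integral_empirical (u : ℕ → UnitAddCircle) (N : ℕ) (f : C(UnitAddCircle, ℂ)) :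
    ∫ x, f x ∂(empirical u N) =
      (∑ k ∈ Finset.range (N + 1), f (u k)) / ((N + 1 : ℕ) : ℂ) := by
  rw [empirical, integral_smul_measure, integral_finsetSum_measure]
  · simp only [integral_dirac, ENNReal.toReal_inv, ENNReal.toReal_natCast, Complex.real_smul]
    push_cast
    field_simp
  · intro k _
    exact integrable_dirac (by simp)

lemma empirical_apply (u : ℕ → UnitAddCircle) (N : ℕ) {s : Set UnitAddCircle}
    (hs : MeasurableSet s) : (empirical u N s).toReal =
      (((Finset.range (N + 1)).filter fun k => u k ∈ s).card : ℝ) / ((N + 1 : ℕ) : ℝ) := by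
  rw [empirical, Measure.smul_apply, Measure.finsetSum_apply, smul_eq_mul, ENNReal.toReal_mul]
  have : ∀ k, Measure.dirac (u k) s = if u k ∈ s then 1 else 0 := fun k => by
    rw [Measure.dirac_apply' _ hs]
    simp [indicator]
  simp only [this, Finset.sum_boole]
  rw [ENNReal.toReal_inv, ENNReal.toReal_natCast, ENNReal.toReal_natCast, div_eq_inv_mul]

/-- **Weyl's criterion** for equidistribution modulo one. -/
theorem equidistributedMod1_of_weyl {u : ℕ → ℝ}
    (h : ∀ m : ℤ, m ≠ 0 → Tendsto (fun N : ℕ =>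
      (∑ k ∈ Finset.range N, fourier m (u k : UnitAddCircle)) / (N : ℂ)) atTop (𝓝 0)) :
    EquidistributedMod1 u := by
  intro a b ha hab hb
  let lim : ProbabilityMeasure UnitAddCircle := ⟨volume, ⟨UnitAddCircle.measure_univ⟩⟩
  let emp : ℕ → ProbabilityMeasure UnitAddCircle := fun N =>
    ⟨empirical (fun k => (u k : UnitAddCircle)) N, isProbabilityMeasure_empirical _ N⟩
  have hlim : Tendsto emp atTop (𝓝 lim) := by
    rw [ProbabilityMeasure.tendsto_iff_forall_integral_rclike_tendsto ℂ]
    intro f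
    refine (tendsto_average_continuousMap h f.toContinuousMap).congr fun N => ?_
    exact (integral_empirical _ N f.toContinuousMap).symm
  have hnull : (lim : Measure UnitAddCircle) (frontier (arc a b)) = 0 := by
    refine measure_mono_null (frontier_arc_subset a b) ?_
    rw [insert_eq]
    exact measure_union_null (volume_singleton_circle _) (volume_singleton_circle _)
  have hE := ProbabilityMeasure.tendsto_measure_of_null_frontier_of_tendsto' hlim hnull
  have hv : (lim : Measure UnitAddCircle) (arc a b) = ENNReal.ofReal (b - a) :=
    volume_arc ha hb
  rw [hv] at hE
  have hR := (ENNReal.tendsto_toReal ENNReal.ofReal_ne_top).comp hE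
  rw [ENNReal.toReal_ofReal (by linarith)] at hR
  refine (tendsto_add_atTop_iff_nat 1).1 (hR.congr fun N => ?_)
  have := empirical_apply (fun k => (u k : UnitAddCircle)) N (measurableSet_arc a b)
  simp only [coe_mem_arc_iff ha hb] at this
  exact this

lemma tendsto_real_average_of_powers {v : ℕ → ℝ} (hv : ∀ k, |v k| ≤ 1) (p : ℕ)
    (h : Tendsto (fun n : ℕ => (∑ k ∈ Finset.range ((n + 1) ^ p), v k) / ((n + 1) ^ p : ℕ))
      atTop (𝓝 0)) (hp : p ≠ 0) :
    Tendsto (fun N : ℕ => (∑ k ∈ Finset.range N, v k) / (N : ℝ)) atTop (𝓝 0) := by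
  have hmono : Monotone fun N : ℕ => ∑ k ∈ Finset.range N, (1 + v k) := by
    refine monotone_nat_of_le_succ fun N => ?_
    rw [Finset.sum_range_succ]
    linarith [(abs_le.1 (hv N)).1]
  have hsum (N : ℕ) : (∑ k ∈ Finset.range N, (1 + v k)) = N + ∑ k ∈ Finset.range N, v k := by
    rw [Finset.sum_add_distrib]; simp
  have key := tendsto_div_of_monotone_of_exists_subseq_tendsto_div
    (fun N : ℕ => ∑ k ∈ Finset.range N, (1 + v k)) 1 hmono fun a ha => by
      refine ⟨fun n => (n + 1) ^ p, ?_, ?_, ?_⟩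
      · have ht : Tendsto (fun n : ℕ => (1 + 1 / ((n:ℝ) + 1)) ^ p) atTop (𝓝 1) := by
          have := (tendsto_one_div_add_atTop_nhds_zero_nat (𝕜 := ℝ)).const_add 1 |>.pow p
          simpa using this
        filter_upwards [ht.eventually_lt_const ha] with n hn
        push_cast
        have hpos : (0:ℝ) < ((n:ℝ) + 1) ^ p := by positivity
        calc ((n:ℝ) + 1 + 1) ^ p = (1 + 1 / ((n:ℝ) + 1)) ^ p * ((n:ℝ) + 1) ^ p := by
              rw [← mul_pow]; congr 1; field_simp
          _ ≤ a * ((n:ℝ) + 1) ^ p := by gcongr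
      · exact (tendsto_pow_atTop hp).comp (tendsto_add_atTop_nat 1)
      · have := h.const_add 1
        rw [add_zero] at this
        refine this.congr fun n => ?_
        rw [hsum, add_div, div_self]
        exact_mod_cast (pow_pos n.succ_pos p).ne'
  have := key.sub_const 1
  rw [sub_self] at this
  refine this.congr' ?_
  filter_upwards [eventually_gt_atTop 0] with N hN
  rw [hsum, add_div, div_self (by exact_mod_cast hN.ne')]
  ring

lemma tendsto_average_of_powers {z : ℕ → ℂ} (hz : ∀ k, ‖z k‖ ≤ 1) {p : ℕ} (hp : p ≠ 0)
    (h : Tendsto (fun n : ℕ => (∑ k ∈ Finset.range ((n + 1) ^ p), z k) / ((n + 1) ^ p : ℕ))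
      atTop (𝓝 0)) :
    Tendsto (fun N : ℕ => (∑ k ∈ Finset.range N, z k) / (N : ℂ)) atTop (𝓝 0) := by
  have hre := tendsto_real_average_of_powers (v := fun k => (z k).re)
    (fun k => (Complex.abs_re_le_norm _).trans (hz k)) p (by
      have := (Complex.continuous_re.tendsto _).comp h
      refine this.congr fun n => ?_
      simp only [Function.comp_apply, Complex.div_natCast_re, Complex.re_sum]) hp
  have him := tendsto_real_average_of_powers (v := fun k => (z k).im)
    (fun k => (Complex.abs_im_le_norm _).trans (hz k)) p (by
      have := (Complex.continuous_im.tendsto _).comp h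
      refine this.congr fun n => ?_
      simp only [Function.comp_apply, Complex.div_natCast_im, Complex.im_sum]) hp
  have h1 := (Complex.continuous_ofReal.tendsto 0).comp hre
  have h2 := ((Complex.continuous_ofReal.tendsto 0).comp him).mul_const Complex.I
  have h3 := h1.add h2
  simp only [Complex.ofReal_zero, zero_mul, add_zero] at h3
  refine h3.congr fun N => ?_
  simp only [Function.comp_apply]
  rw [← Complex.re_sum, ← Complex.im_sum, ← Complex.div_natCast_re, ← Complex.div_natCast_im,
    Complex.re_add_im]

lemma sum_rpow_neg_le {c : ℝ} (hc0 : 0 < c) (hc : c ≤ 1 / 2) (N : ℕ) :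
    ∑ d ∈ Finset.range N, ((d:ℝ) + 1) ^ (-c) ≤ 2 * (N:ℝ) * (N:ℝ) ^ (-c) := by
  induction N with
  | zero => simp
  | succ N ih =>
    rw [Finset.sum_range_succ]
    push_cast
    have hpos : (0:ℝ) < ((N:ℝ) + 1) ^ (-c) := by positivity
    rcases Nat.eq_zero_or_pos N with rfl | hN
    · simp
    have hN' : (0:ℝ) < N := by exact_mod_cast hN
    have key : 2 * (N:ℝ) * (N:ℝ) ^ (-c) ≤ (2 * N + 1) * ((N:ℝ) + 1) ^ (-c) := by
      have hinv : 0 < 1 / (N:ℝ) := by positivity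
      have hb : (1 + 1 / (N:ℝ)) ^ c ≤ 1 + c * (1 / (N:ℝ)) :=
        rpow_one_add_le_one_add_mul_self (by linarith) hc0.le (by linarith)
      have he : (N:ℝ) ^ (-c) = (1 + 1 / (N:ℝ)) ^ c * ((N:ℝ) + 1) ^ (-c) := by
        have : (N:ℝ) + 1 = (1 + 1 / (N:ℝ)) * N := by field_simp
        rw [this, Real.mul_rpow (by positivity) hN'.le, ← mul_assoc, ← Real.rpow_add (by positivity)]
        simp
      rw [he, ← mul_assoc]
      gcongr
      calc 2 * (N:ℝ) * (1 + 1 / (N:ℝ)) ^ c ≤ 2 * N * (1 + c * (1 / (N:ℝ))) := by gcongr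
        _ = 2 * N + 2 * c := by field_simp
        _ ≤ _ := by linarith
    nlinarith

lemma sum_dist_le {g : ℕ → ℝ} (hg : Antitone g) (hg0 : ∀ d, 0 ≤ g d) {k N : ℕ} (hk : k < N) :
    ∑ l ∈ Finset.range N, g (k - l + (l - k)) ≤ 2 * ∑ d ∈ Finset.range N, g d := by
  obtain ⟨M, rfl⟩ : ∃ M, N = (k + 1) + M := ⟨N - (k + 1), by omega⟩
  rw [Finset.sum_range_add _ (k + 1) M, two_mul]
  gcongr ?_ + ?_
  · calc _ = ∑ l ∈ Finset.range (k + 1), g (k + 1 - 1 - l) := by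
          refine Finset.sum_congr rfl fun l hl => ?_
          rw [Finset.mem_range] at hl
          congr 1; omega
      _ = ∑ l ∈ Finset.range (k + 1), g l := Finset.sum_range_reflect _ _
      _ ≤ _ := Finset.sum_le_sum_of_subset_of_nonneg
          (Finset.range_subset_range.2 (by omega)) fun _ _ _ => hg0 _
  · calc _ ≤ ∑ l ∈ Finset.range M, g l := by
          refine Finset.sum_le_sum fun l _ => hg ?_
          omega
      _ ≤ _ := Finset.sum_le_sum_of_subset_of_nonneg
          (Finset.range_subset_range.2 (by omega)) fun _ _ _ => hg0 _

lemma integrable_eF {μ : Measure ℝ} [IsProbabilityMeasure μ] (ξ : ℝ) :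
    Integrable (fun x => eF ξ x) μ :=
  Integrable.of_bound (continuous_eF ξ).aestronglyMeasurable 1
    (ae_of_all _ fun x => (norm_eF ξ x).le)

lemma eF_mul_conj_same (ξ η x : ℝ) :
    eF ξ x * (starRingEnd ℂ) (eF η x) = eF (ξ - η) x := by
  simp only [eF, ← Complex.exp_conj, map_mul, map_neg, Complex.conj_ofReal, Complex.conj_I,
    ← Complex.exp_add]
  congr 1
  push_cast
  ring

/-- The second moment of an exponential sum is controlled by Fourier coefficients. -/
lemma integral_norm_sq_sum_eF_le {μ : Measure ℝ} [IsProbabilityMeasure μ] (ξ : ℕ → ℝ) (N : ℕ) :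
    ∫ x, ‖∑ k ∈ Finset.range N, eF (ξ k) x‖ ^ 2 ∂μ ≤
      ∑ k ∈ Finset.range N, ∑ l ∈ Finset.range N, ‖muFourier μ (ξ k - ξ l)‖ := by
  have h : ((∫ x, ‖∑ k ∈ Finset.range N, eF (ξ k) x‖ ^ 2 ∂μ : ℝ) : ℂ) =
      ∑ k ∈ Finset.range N, ∑ l ∈ Finset.range N, muFourier μ (ξ k - ξ l) := by
    rw [← integral_complex_ofReal]
    have hpt : ∀ x, (((‖∑ k ∈ Finset.range N, eF (ξ k) x‖ ^ 2 : ℝ)) : ℂ) =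
        ∑ k ∈ Finset.range N, ∑ l ∈ Finset.range N, eF (ξ k - ξ l) x := fun x => by
      push_cast
      rw [← Complex.mul_conj', map_sum, Finset.sum_mul_sum]
      simp only [eF_mul_conj_same]
    refine (integral_congr_ae (ae_of_all _ hpt)).trans ?_
    rw [integral_finsetSum _ fun k _ => integrable_finsetSum _ fun l _ => integrable_eF _]
    refine Finset.sum_congr rfl fun k _ => ?_
    rw [integral_finsetSum _ fun l _ => integrable_eF _]
    simp only [muFourier_eq]
  have h0 : 0 ≤ ∫ x, ‖∑ k ∈ Finset.range N, eF (ξ k) x‖ ^ 2 ∂μ :=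
    integral_nonneg fun x => by positivity
  rw [← Complex.norm_of_nonneg h0, h]
  exact norm_sum_le_of_le _ fun k _ => norm_sum_le _ _

lemma norm_muFourier_neg {μ : Measure ℝ} (ξ : ℝ) : ‖muFourier μ (-ξ)‖ = ‖muFourier μ ξ‖ := by
  have : muFourier μ (-ξ) = (starRingEnd ℂ) (muFourier μ ξ) := by
    rw [muFourier_eq, muFourier_eq, ← integral_conj]
    refine integral_congr_ae (ae_of_all _ fun x => ?_)
    simp only [eF, ← Complex.exp_conj, map_mul, map_neg, Complex.conj_ofReal, Complex.conj_I]
    congr 1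
    push_cast
    ring
  rw [this, RCLike.norm_conj]

lemma norm_muFourier_le_one {μ : Measure ℝ} [IsProbabilityMeasure μ] (ξ : ℝ) :
    ‖muFourier μ ξ‖ ≤ 1 := by
  rw [muFourier_eq]
  refine (norm_integral_le_of_norm_le_const (C := 1) (ae_of_all _ fun x => (norm_eF ξ x).le)).trans ?_
  simp

lemma exists_muFourier_bound {μ : Measure ℝ} [IsProbabilityMeasure μ]
    (h : ∃ A > (0:ℝ), ∃ c > (0:ℝ), ∀ ξ : ℝ, 1 ≤ ξ → ‖muFourier μ ξ‖ ≤ A * ξ ^ (-c)) :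
    ∃ A > (0:ℝ), ∃ c > (0:ℝ), c ≤ 1 / 2 ∧ ∀ ξ : ℝ, ∀ d : ℕ, (d:ℝ) ≤ |ξ| →
      ‖muFourier μ ξ‖ ≤ A * ((d:ℝ) + 1) ^ (-c) := by
  obtain ⟨A, hA, c, hc, hdec⟩ := h
  have hc' : 0 < min c (1 / 2) := lt_min hc (by norm_num)
  refine ⟨max A 1 * 2, by positivity, min c (1 / 2), hc', min_le_right _ _, fun ξ d hd => ?_⟩
  have habs : ‖muFourier μ ξ‖ = ‖muFourier μ |ξ|‖ := by
    rcases abs_choice ξ with h | h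
    · rw [h]
    · rw [h, norm_muFourier_neg]
  rw [habs]
  rcases Nat.eq_zero_or_pos d with rfl | hd0
  · refine (norm_muFourier_le_one _).trans ?_
    simp only [Nat.cast_zero, zero_add, Real.one_rpow, mul_one]
    linarith [le_max_right A 1]
  have hd1 : (1:ℝ) ≤ d := by exact_mod_cast hd0
  have hξ : 1 ≤ |ξ| := hd1.trans hd
  calc ‖muFourier μ |ξ|‖ ≤ A * |ξ| ^ (-c) := hdec _ hξ
    _ ≤ max A 1 * |ξ| ^ (-min c (1 / 2)) := by
        gcongr
        · exact le_max_left _ _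
        exact min_le_left _ _
    _ ≤ max A 1 * (d:ℝ) ^ (-min c (1 / 2)) := by
        gcongr ?_ * ?_
        exact Real.rpow_le_rpow_of_nonpos (by linarith) hd (by linarith)
    _ ≤ max A 1 * (2 * ((d:ℝ) + 1) ^ (-min c (1 / 2))) := by
        gcongr ?_ * ?_
        calc (d:ℝ) ^ (-min c (1 / 2)) ≤ (((d:ℝ) + 1) / 2) ^ (-min c (1 / 2)) :=
              Real.rpow_le_rpow_of_nonpos (by positivity) (by linarith) (by linarith)
          _ = 2 ^ (min c (1 / 2)) * ((d:ℝ) + 1) ^ (-min c (1 / 2)) := by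
              rw [Real.div_rpow (by positivity) (by norm_num), Real.rpow_neg (by norm_num : (0:ℝ) ≤ 2),
                div_inv_eq_mul, mul_comm]
          _ ≤ 2 * ((d:ℝ) + 1) ^ (-min c (1 / 2)) := by
              gcongr
              calc (2:ℝ) ^ (min c (1 / 2)) ≤ 2 ^ (1:ℝ) :=
                    Real.rpow_le_rpow_of_exponent_le (by norm_num)
                      ((min_le_right _ _).trans (by norm_num))
                _ = 2 := Real.rpow_one 2
    _ = _ := by ring

lemma integral_norm_sq_sum_eF_le_rpow {μ : Measure ℝ} [IsProbabilityMeasure μ] {A c : ℝ}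
    (hA : 0 < A) (hc0 : 0 < c) (hc : c ≤ 1 / 2)
    (hdec : ∀ ξ : ℝ, ∀ d : ℕ, (d:ℝ) ≤ |ξ| → ‖muFourier μ ξ‖ ≤ A * ((d:ℝ) + 1) ^ (-c))
    {ξ : ℕ → ℝ} (hξ : ∀ k l, ((k - l + (l - k) : ℕ) : ℝ) ≤ |ξ k - ξ l|) (N : ℕ) :
    ∫ x, ‖∑ k ∈ Finset.range N, eF (ξ k) x‖ ^ 2 ∂μ ≤ 4 * A * (N:ℝ) ^ 2 * (N:ℝ) ^ (-c) := by
  have hanti : Antitone fun d : ℕ => A * ((d:ℝ) + 1) ^ (-c) := fun d e hde => by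
    have : (d:ℝ) ≤ e := by exact_mod_cast hde
    refine mul_le_mul_of_nonneg_left ?_ hA.le
    exact Real.rpow_le_rpow_of_nonpos (by positivity) (by linarith) (by linarith)
  calc _ ≤ ∑ k ∈ Finset.range N, ∑ l ∈ Finset.range N, ‖muFourier μ (ξ k - ξ l)‖ :=
        integral_norm_sq_sum_eF_le ξ N
    _ ≤ ∑ k ∈ Finset.range N, 2 * ∑ d ∈ Finset.range N, A * ((d:ℝ) + 1) ^ (-c) := by
        refine Finset.sum_le_sum fun k hk => ?_
        refine (Finset.sum_le_sum fun l _ => hdec _ _ (hξ k l)).trans ?_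
        exact sum_dist_le hanti (fun d => by positivity) (Finset.mem_range.1 hk)
    _ = N * (2 * (A * ∑ d ∈ Finset.range N, ((d:ℝ) + 1) ^ (-c))) := by
        rw [Finset.sum_const, Finset.card_range, nsmul_eq_mul, ← Finset.mul_sum]
    _ ≤ N * (2 * (A * (2 * (N:ℝ) * (N:ℝ) ^ (-c)))) := by
        gcongr
        exact sum_rpow_neg_le hc0 hc N
    _ = _ := by ring

lemma ae_tendsto_average_eF {μ : Measure ℝ} [IsProbabilityMeasure μ] {A c : ℝ}
    (hA : 0 < A) (hc0 : 0 < c) (hc : c ≤ 1 / 2)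
    (hdec : ∀ ξ : ℝ, ∀ d : ℕ, (d:ℝ) ≤ |ξ| → ‖muFourier μ ξ‖ ≤ A * ((d:ℝ) + 1) ^ (-c))
    {ξ : ℕ → ℝ} (hξ : ∀ k l, ((k - l + (l - k) : ℕ) : ℝ) ≤ |ξ k - ξ l|) :
    ∀ᵐ x ∂μ, Tendsto (fun N : ℕ => (∑ k ∈ Finset.range N, eF (ξ k) x) / (N : ℂ))
      atTop (𝓝 0) := by
  obtain ⟨p, hp⟩ := exists_nat_ge (2 / c)
  have hpc : 2 ≤ p * c := by rwa [div_le_iff₀ hc0] at hp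
  have hp0 : p ≠ 0 := by rintro rfl; norm_num at hpc
  let F : ℕ → ℝ → ℝ := fun n x =>
    ‖(∑ k ∈ Finset.range ((n + 1) ^ p), eF (ξ k) x) / (((n + 1) ^ p : ℕ) : ℂ)‖ ^ 2
  have hFcont : ∀ n, Continuous (F n) := fun n =>
    (((continuous_finsetSum _ fun k _ => continuous_eF (ξ k)).div_const _).norm).pow 2
  have hFeq : ∀ n x, F n x = ‖∑ k ∈ Finset.range ((n + 1) ^ p), eF (ξ k) x‖ ^ 2 /
      (((n + 1) ^ p : ℕ) : ℝ) ^ 2 := fun n x => by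
    simp only [F, norm_div, Complex.norm_natCast, div_pow]
  have hFint : ∀ n, Integrable (F n) μ := fun n => by
    refine Integrable.of_bound (hFcont n).aestronglyMeasurable 1 (ae_of_all _ fun x => ?_)
    have hpos : (0:ℝ) < ((n + 1) ^ p : ℕ) := by positivity
    rw [Real.norm_of_nonneg (by simp only [F]; positivity), hFeq, div_le_one (by positivity)]
    gcongr
    refine (norm_sum_le_of_le _ fun k _ => (norm_eF (ξ k) x).le).trans ?_
    simp
  have hbound : ∀ n, ∫ x, F n x ∂μ ≤ 4 * A * (1 / ((n:ℝ) + 1) ^ 2) := fun n => by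
    have hpos : (0:ℝ) < ((n + 1) ^ p : ℕ) := by positivity
    simp only [hFeq]
    rw [integral_div, div_le_iff₀ (by positivity)]
    refine (integral_norm_sq_sum_eF_le_rpow hA hc0 hc hdec hξ _).trans ?_
    have : (((n + 1) ^ p : ℕ) : ℝ) ^ (-c) ≤ 1 / ((n:ℝ) + 1) ^ 2 := by
      push_cast
      rw [← Real.rpow_natCast, ← Real.rpow_mul (by positivity), one_div, ← Real.rpow_natCast _ 2,
        ← Real.rpow_neg (by positivity)]
      refine Real.rpow_le_rpow_of_exponent_le (by linarith [n.cast_nonneg (α := ℝ)]) ?_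
      push_cast
      linarith
    calc _ ≤ 4 * A * (((n + 1) ^ p : ℕ) : ℝ) ^ 2 * (1 / ((n:ℝ) + 1) ^ 2) := by gcongr
      _ = _ := by ring
  have hsum : Summable fun n : ℕ => 4 * A * (1 / ((n:ℝ) + 1) ^ 2) := by
    refine Summable.mul_left _ ?_
    have := (summable_nat_add_iff (f := fun n : ℕ => 1 / (n:ℝ) ^ 2) 1).2
      (Real.summable_one_div_nat_pow.2 (by norm_num))
    simpa using this
  have hlint : ∫⁻ x, ∑' n, ENNReal.ofReal (F n x) ∂μ ≠ ⊤ := by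
    rw [lintegral_tsum fun n => (hFcont n).measurable.ennreal_ofReal.aemeasurable]
    refine ((ENNReal.tsum_le_tsum fun n => ?_).trans_lt hsum.tsum_ofReal_lt_top).ne
    rw [← ofReal_integral_eq_lintegral_ofReal (hFint n) (ae_of_all _ fun x => by
      simp only [F, Pi.zero_apply]; positivity)]
    exact ENNReal.ofReal_le_ofReal (hbound n)
  have hae := ae_lt_top (Measurable.tsum fun n => (hFcont n).measurable.ennreal_ofReal) hlint
  filter_upwards [hae] with x hx
  refine tendsto_average_of_powers (z := fun k => eF (ξ k) x) (fun k => (norm_eF _ _).le) hp0 ?_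
  have h1 := ENNReal.tendsto_atTop_zero_of_tsum_ne_top hx.ne
  have h2 := (ENNReal.tendsto_toReal ENNReal.zero_ne_top).comp h1
  have h3 : Tendsto (fun n => Real.sqrt (F n x)) atTop (𝓝 0) := by
    have := (Real.continuous_sqrt.tendsto _).comp h2
    simp only [ENNReal.toReal_zero, Real.sqrt_zero] at this
    refine this.congr fun n => ?_
    simp only [Function.comp_apply]
    rw [ENNReal.toReal_ofReal (by simp only [F]; positivity)]
  rw [tendsto_zero_iff_norm_tendsto_zero]
  refine h3.congr fun n => ?_
  simp only [F]
  rw [Real.sqrt_sq (norm_nonneg _)]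

theorem ae_equidistributedMod1_of_decay {μ : Measure ℝ} [IsProbabilityMeasure μ]
    (h : ∃ A > (0:ℝ), ∃ c > (0:ℝ), ∀ ξ : ℝ, 1 ≤ ξ → ‖muFourier μ ξ‖ ≤ A * ξ ^ (-c))
    {s : ℕ → ℕ} (hs : StrictMono s) :
    ∀ᵐ x ∂μ, EquidistributedMod1 fun k => (s k : ℝ) * x := by
  obtain ⟨A, hA, c, hc0, hc, hdec⟩ := exists_muFourier_bound h
  have hdist : ∀ k l : ℕ, ((k - l + (l - k) : ℕ) : ℝ) ≤ |(s k : ℝ) - s l| := by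
    have hmono : ∀ k l : ℕ, k ≤ l → ((k - l + (l - k) : ℕ) : ℝ) ≤ (s l : ℝ) - s k := by
      intro k l hkl
      have h1 : s k + (l - k) ≤ s l := by
        have := hs.add_le_nat (l - k) k
        have h2 : l - k + k = l := by omega
        rw [h2] at this
        omega
      have h3 : k - l + (l - k) = l - k := by omega
      have h4 : ((s k + (l - k) : ℕ) : ℝ) ≤ s l := by exact_mod_cast h1
      rw [h3]
      rw [Nat.cast_add] at h4
      linarith
    intro k l
    rcases le_total k l with hkl | hkl
    · rw [abs_sub_comm]
      exact (hmono k l hkl).trans (le_abs_self _)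
    · rw [add_comm]
      exact (hmono l k hkl).trans (le_abs_self _)
  have hall : ∀ᵐ x ∂μ, ∀ m : ℤ, m ≠ 0 → Tendsto (fun N : ℕ =>
      (∑ k ∈ Finset.range N, eF (-(m * s k)) x) / (N : ℂ)) atTop (𝓝 0) := by
    rw [ae_all_iff]
    intro m
    by_cases hm : m = 0
    · exact ae_of_all _ fun x hm' => absurd hm hm'
    refine (ae_tendsto_average_eF hA hc0 hc hdec (ξ := fun k => -((m:ℝ) * s k)) ?_).mono
      fun x hx _ => hx
    intro k l
    have hm1 : (1:ℝ) ≤ |(m:ℝ)| := by exact_mod_cast Int.one_le_abs hm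
    calc _ ≤ |(s k : ℝ) - s l| := hdist k l
      _ ≤ |(m:ℝ)| * |(s k : ℝ) - s l| := le_mul_of_one_le_left (abs_nonneg _) hm1
      _ = _ := by
        rw [← abs_mul, ← abs_neg]
        congr 1
        ring
  filter_upwards [hall] with x hx
  refine equidistributedMod1_of_weyl fun m hm => (hx m hm).congr fun N => ?_
  congr 1
  refine Finset.sum_congr rfl fun k _ => ?_
  rw [fourier_coe_apply, eF]
  congr 1
  push_cast
  ring

lemma measurable_indicator_comp_word (n : ℕ) (g : List ℕ → ℝ) :
    Measurable (gaussSet.indicator fun x => g (word n x)) := by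
  intro s hs
  have hpre : (gaussSet.indicator fun x => g (word n x)) ⁻¹' s =
      (⋃ l ∈ {l : List ℕ | l.length = n ∧ g l ∈ s}, _root_.cylinder l) ∪
        (gaussSetᶜ ∩ {_x | (0:ℝ) ∈ s}) := by
    ext x
    by_cases hx : x ∈ gaussSet
    · simp only [mem_preimage, Set.indicator_of_mem hx, mem_union, mem_iUnion, mem_inter_iff,
        mem_compl_iff, hx, not_true_eq_false, false_and, or_false, mem_ofPred_eq, exists_prop]
      constructor
      · intro h
        exact ⟨word n x, ⟨length_word n x, h⟩, mem_cylinder_word n hx⟩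
      · rintro ⟨l, ⟨rfl, hg⟩, hl⟩
        rwa [(mem_cylinder_iff.1 hl).2]
    · have : ∀ l, x ∉ _root_.cylinder l := fun l hl => hx (cylinder_subset l hl)
      simp [hx, this]
  rw [hpre]
  exact (MeasurableSet.biUnion (Set.to_countable _) fun l _ => measurableSet_cylinder l).union
    (measurableSet_gaussSet.compl.inter (MeasurableSet.const _))

lemma LocHolder.holder_word {φ : ℝ → ℝ} (h : LocHolder φ) :
    ∃ B > (0:ℝ), ∃ θ : ℝ, 1 / 2 ≤ θ ∧ θ < 1 ∧ ∀ k, 0 < k → ∀ x ∈ gaussSet, ∀ y ∈ gaussSet,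
      word k x = word k y → |φ x - φ y| ≤ B * θ ^ k := by
  obtain ⟨B, hB, θ, hθ, hφ⟩ := h
  refine ⟨B, hB, max θ (1 / 2), le_max_right _ _, max_lt hθ.2 (by norm_num),
    fun k hk x hx y hy hxy => ?_⟩
  have hne : word k x ≠ [] := fun h0 => by
    have := length_word k x
    rw [h0] at this
    simp at this
    omega
  have hyc : y ∈ _root_.cylinder (word k x) := by
    rw [hxy]
    exact mem_cylinder_word k hy
  have := hφ (word k x) hne (posWord_word k hx) x (mem_cylinder_word k hx) y hyc
  rw [length_word] at this
  refine this.trans ?_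
  have hθ0 := hθ.1.le
  gcongr
  exact le_max_left _ _

lemma measurable_indicator_of_holder {φ : ℝ → ℝ} {B θ : ℝ} (hθ0 : 0 ≤ θ) (hθ : θ < 1)
    (h : ∀ k, 0 < k → ∀ x ∈ gaussSet, ∀ y ∈ gaussSet,
      word k x = word k y → |φ x - φ y| ≤ B * θ ^ k) :
    Measurable (gaussSet.indicator φ) := by
  by_cases hX : gaussSet.Nonempty
  swap
  · rw [Set.not_nonempty_iff_eq_empty.1 hX, Set.indicator_empty]
    exact measurable_const
  obtain ⟨x₀, hx₀⟩ := hX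
  refine measurable_of_tendsto_metrizable
    (fun n => measurable_indicator_comp_word n fun l => φ (invBranch l x₀)) ?_
  rw [tendsto_pi_nhds]
  intro x
  by_cases hx : x ∈ gaussSet
  swap
  · simp [hx]
  simp only [Set.indicator_of_mem hx]
  rw [tendsto_iff_dist_tendsto_zero]
  have hlim : Tendsto (fun n : ℕ => B * θ ^ n) atTop (𝓝 0) := by
    simpa using (tendsto_pow_atTop_nhds_zero_of_lt_one hθ0 hθ).const_mul B
  refine squeeze_zero' (Eventually.of_forall fun n => dist_nonneg) ?_ hlim
  filter_upwards [eventually_gt_atTop 0] with n hn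
  have hc := invBranch_mem_cylinder (posWord_word n hx) hx₀
  have hw := (mem_cylinder_iff.1 hc).2
  rw [length_word] at hw
  exact h n hn _ (cylinder_subset _ hc) _ hx hw

lemma wt_indicator (φ : ℝ → ℝ) {l : List ℕ} (hl : PosWord l) {x : ℝ} (hx : x ∈ gaussSet) :
    wt (gaussSet.indicator φ) l x = wt φ l x := by
  unfold wt birkhoff
  congr 1
  refine Finset.sum_congr rfl fun k _ => ?_
  rw [Set.indicator_of_mem (iterate_mem (invBranch_mem hl hx) k)]

/-- The Gibbs systems considered here satisfy the explicit quantitative hypotheses. -/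
lemma exists_gibbsSys {φ : ℝ → ℝ} {μ : Measure ℝ} [IsProbabilityMeasure μ]
    (hμX : μ gaussSet = 1) (hinv : GaussInvariant μ) (hφH : LocHolder φ)
    (hφ0 : ∀ x ∈ gaussSet, φ x ≤ 0) (hL : TransferNormalized φ) (hGibbs : IsGibbs φ μ) :
    ∃ B θ C, GibbsSys (gaussSet.indicator φ) μ B θ C := by
  obtain ⟨B, hB, θ, hθ2, hθ1, hhol⟩ := LocHolder.holder_word hφH
  obtain ⟨C, hC, hG⟩ := hGibbs
  have hC0 : 0 < C := by linarith
  refine ⟨B, θ, C, ?_⟩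
  constructor
  · exact measurable_indicator_of_holder (by linarith) hθ1 hhol
  · rw [prob_compl_eq_zero_iff measurableSet_gaussSet]
    exact hμX
  · refine ⟨measurable_gaussMap, Measure.ext fun s hs => ?_⟩
    rw [Measure.map_apply measurable_gaussMap hs]
    exact hinv s hs
  · exact hB
  · exact hθ2
  · exact hθ1
  · exact hC
  · intro k hk x hx y hy hxy
    rw [Set.indicator_of_mem hx, Set.indicator_of_mem hy]
    exact hhol k hk x hx y hy hxy
  · intro x hx
    rw [Set.indicator_of_mem hx]
    exact hφ0 x hx
  · intro x hx
    have hmem : ∀ a : ℕ+, invBranch1 (a : ℕ) x ∈ gaussSet := fun a => invBranch1_mem a.pos hx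
    simp only [Set.indicator_of_mem (hmem _)]
    have hs : Summable fun a : ℕ+ => Real.exp (φ (invBranch1 (a : ℕ) x)) := by
      by_contra hs
      have := hL x hx
      rw [tsum_eq_zero_of_not_summable hs] at this
      exact zero_ne_one this
    rw [← hL x hx]
    exact hs.hasSum
  · intro l hl x hx
    rw [wt_indicator φ hl hx]
    by_cases hne : l = []
    · subst hne
      have h1 : μ.real (_root_.cylinder []) = 1 := by
        rw [cylinder_nil, measureReal_def, hμX, ENNReal.toReal_one]
      rw [wt_nil, h1, mul_one]
      exact ⟨hC, hC⟩
    · obtain ⟨h1, h2⟩ := hG l hne hl x hx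
      refine ⟨?_, h2⟩
      rw [inv_mul_le_iff₀ hC0] at h1
      exact h1

end GaussFourier

/-- For a Gibbs measure as in the main theorem (tail condition and
dimension `> 1/2`), for every strictly increasing sequence `(s_k)` of naturals the
sequence `(s_k x)` equidistributes mod 1 for `μ`-a.e. `x`; in particular `μ`-a.e. `x`
is `n`-normal for every `n ≥ 2`. -/
theorem gibbs_equidistribution
    (φ : ℝ → ℝ) (μ : MeasureTheory.Measure ℝ) [MeasureTheory.IsProbabilityMeasure μ]
    (hμX : μ gaussSet = 1) (hinv : GaussInvariant μ)
    (hφH : LocHolder φ) (hφ0 : ∀ x ∈ gaussSet, φ x ≤ 0)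
    (hP : HasPressure φ 0) (hL : TransferNormalized φ)
    (hGibbs : IsGibbs φ μ) (htail : PolyTail μ)
    (h : ℝ) (hent : HasEntropy μ h) (hdim : 1/2 < h / lyapunov μ) :
    (∀ s : ℕ → ℕ, StrictMono s →
      ∀ᵐ x ∂μ, EquidistributedMod1 fun k => (s k : ℝ) * x) ∧
    (∀ m : ℕ, 2 ≤ m → ∀ᵐ x ∂μ, EquidistributedMod1 fun k => (m : ℝ) ^ k * x) := by
  obtain ⟨B, θ, C, S⟩ := GaussFourier.exists_gibbsSys hμX hinv hφH hφ0 hL hGibbs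
  have hdec := S.exists_muFourier_decay htail hent hdim
  refine ⟨fun s hs => GaussFourier.ae_equidistributedMod1_of_decay hdec hs, fun m hm => ?_⟩
  have := GaussFourier.ae_equidistributedMod1_of_decay hdec
    (s := fun k => m ^ k) (pow_right_strictMono₀ (by omega))
  simpa only [Nat.cast_pow] using this
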